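/- arXiv:1910.10984 — 4 statements merged into one kernel-verified Lean document; each statement's English description precedes it below -/
import Mathlib

section
/- For natural numbers 1 ≤ n₁ | n₂, the Erdős–Ginzburg–Ziv constant satisfies s(C_{n₁} ⊕ C_{n₂}) = 2n₁ + 2n₂ − 3. -/
/-- The `m`-th Davenport constant: smallest `t` such that every sequence (multiset) over `G`
of length `≥ t` contains `m` disjoint non-empty zero-sum subsequences. -/
noncomputable def DavenportM (G : Type*) [AddCommGroup G] (m : ℕ) : ℕ :=
  sInf {t | ∀ S : Multiset G, t ≤ Multiset.card S →
    ∃ L : Multiset (Multiset G), Multiset.card L = m ∧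
      (∀ T ∈ L, T ≠ 0 ∧ T.sum = 0) ∧ L.sum ≤ S}

/-- The Davenport constant: smallest `t` such that every sequence over `G` of length `≥ t`
has a non-empty zero-sum subsequence. -/
noncomputable def Davenport (G : Type*) [AddCommGroup G] : ℕ :=
  sInf {t | ∀ S : Multiset G, t ≤ Multiset.card S → ∃ T ≤ S, T ≠ 0 ∧ T.sum = 0}

/-- `η(G)`: smallest `t` such that every sequence over `G` of length `≥ t` has a non-empty
zero-sum subsequence of length at most `exp G`. -/
noncomputable def etaC (G : Type*) [AddCommGroup G] : ℕ :=
  sInf {t | ∀ S : Multiset G, t ≤ Multiset.card S →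
    ∃ T ≤ S, T ≠ 0 ∧ T.sum = 0 ∧ Multiset.card T ≤ AddMonoid.exponent G}

/-- The Erdős–Ginzburg–Ziv constant `s(G)`: smallest `t` such that every sequence over `G` of
length `≥ t` has a zero-sum subsequence of length exactly `exp G`. -/
noncomputable def egz (G : Type*) [AddCommGroup G] : ℕ :=
  sInf {t | ∀ S : Multiset G, t ≤ Multiset.card S →
    ∃ T ≤ S, T.sum = 0 ∧ Multiset.card T = AddMonoid.exponent G}

namespace EgzRankTwo

open Finset

/-- The alternating sum over the vertices of a cube of a polynomial of degree less than the dimension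
vanishes. -/
theorem sum_neg_one_pow_mul_eval_eq_zero {ι R : Type*} [DecidableEq ι] [CommRing R]
    (f : MvPolynomial ι R) (s : Finset ι) (hf : f.totalDegree < #s) :
    ∑ I ∈ s.powerset, (-1) ^ #I * MvPolynomial.eval (fun i ↦ if i ∈ I then 1 else 0) f = 0 := by
  simp only [MvPolynomial.eval_eq, mul_sum]
  rw [sum_comm]
  refine sum_eq_zero fun d hd ↦ ?_
  obtain ⟨i, his, hid⟩ : ∃ i ∈ s, i ∉ d.support := by
    by_contra! h
    have h1 : #s ≤ #d.support := card_le_card h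
    have h2 : #d.support ≤ d.sum fun _ e ↦ e := by
      rw [Finsupp.sum, card_eq_sum_ones]
      exact sum_le_sum fun j hj ↦ Nat.one_le_iff_ne_zero.2 (Finsupp.mem_support_iff.1 hj)
    have h3 := MvPolynomial.le_totalDegree hd
    omega
  rw [← insert_erase his, sum_powerset_insert (notMem_erase i s), ← sum_add_distrib]
  refine sum_eq_zero fun I hI ↦ ?_
  have hiI : i ∉ I := fun h ↦ notMem_erase i s (mem_powerset.1 hI h)
  have : ∏ j ∈ d.support, (if j ∈ insert i I then (1 : R) else 0) ^ d j =
      ∏ j ∈ d.support, (if j ∈ I then (1 : R) else 0) ^ d j := by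
    refine prod_congr rfl fun j hj ↦ ?_
    have : j ≠ i := by rintro rfl; exact hid hj
    simp [mem_insert, this]
  rw [this, card_insert_of_notMem hiI]
  ring

/-- The number of zero-sum subfamilies of length `n` of the family `a` restricted to `s`. -/
def zeroSumCount {ι G : Type*} [DecidableEq G] [AddCommMonoid G]
    (a : ι → G) (n : ℕ) (s : Finset ι) : ℕ :=
  #{I ∈ s.powersetCard n | ∑ i ∈ I, a i = 0}

section ZeroSumCount

variable {ι G : Type*} [DecidableEq G] [AddCommGroup G] (a : ι → G)

theorem zeroSumCount_zero (s : Finset ι) : zeroSumCount a 0 s = 1 := by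
  simp [zeroSumCount, filter_singleton]

theorem zeroSumCount_eq_zero_of_card_lt {n : ℕ} {s : Finset ι} (h : #s < n) :
    zeroSumCount a n s = 0 := by
  simp [zeroSumCount, powersetCard_eq_empty.2 h]

theorem zeroSumCount_eq_zero_iff {n : ℕ} {s : Finset ι} :
    zeroSumCount a n s = 0 ↔ ∀ I ⊆ s, #I = n → ∑ i ∈ I, a i ≠ 0 := by
  simp only [zeroSumCount, card_eq_zero, filter_eq_empty_iff, mem_powersetCard, and_imp]

theorem zeroSumCount_eq_zero_of_subset {n : ℕ} {s t : Finset ι} (hst : s ⊆ t)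
    (h : zeroSumCount a n t = 0) : zeroSumCount a n s = 0 := by
  rw [zeroSumCount_eq_zero_iff] at *
  exact fun I hI ↦ h I (hI.trans hst)

variable [DecidableEq ι]

theorem zeroSumCount_insert_zero {n : ℕ} {s : Finset ι} {i : ι} (hi : i ∉ s) (ha : a i = 0) :
    zeroSumCount a (n + 1) (insert i s) = zeroSumCount a (n + 1) s + zeroSumCount a n s := by
  have key : ∀ I ∈ s.powersetCard n, i ∉ I := fun I hI h ↦ hi ((mem_powersetCard.1 hI).1 h)
  rw [zeroSumCount, powersetCard_succ_insert hi, filter_union, card_union_of_disjoint]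
  · congr 1
    rw [filter_image, card_image_of_injOn]
    · refine congrArg card (filter_congr fun I hI ↦ ?_)
      rw [sum_insert (key I hI), ha, zero_add]
    · intro I hI J hJ h
      have hI' := key I (mem_filter.1 (mem_coe.1 hI)).1
      have hJ' := key J (mem_filter.1 (mem_coe.1 hJ)).1
      rw [← erase_insert hI', ← erase_insert hJ']
      exact congrArg (fun K ↦ K.erase i) h
  · refine disjoint_left.2 fun I hI hI' ↦ ?_
    obtain ⟨J, -, rfl⟩ := mem_image.1 (mem_filter.1 hI').1
    exact hi ((mem_powersetCard.1 (mem_filter.1 hI).1).1 (mem_insert_self i J))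

theorem sum_powersetCard_zeroSumCount {m n : ℕ} (hn : n ≤ m) (s : Finset ι) :
    ∑ J ∈ s.powersetCard m, zeroSumCount a n J =
      (#s - n).choose (m - n) * zeroSumCount a n s := by
  simp only [zeroSumCount, card_eq_sum_ones {I ∈ powersetCard n _ | _}]
  rw [sum_comm' (t' := {I ∈ s.powersetCard n | ∑ i ∈ I, a i = 0})
    (s' := fun I ↦ {J ∈ s.powersetCard m | I ⊆ J})]
  · rw [mul_sum]
    refine sum_congr rfl fun I hI ↦ ?_
    simp only [mem_filter, mem_powersetCard] at hI
    rw [← card_eq_sum_ones, card_filter_powersetCard_subset I s m hI.1.1 (hI.1.2 ▸ hn), hI.1.2,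
      mul_one]
  · intro J I
    simp only [mem_filter, mem_powersetCard]
    constructor
    · rintro ⟨⟨h1, h2⟩, ⟨h3, h4⟩, h5⟩
      exact ⟨⟨⟨h1, h2⟩, h3⟩, ⟨h3.trans h1, h4⟩, h5⟩
    · rintro ⟨⟨⟨h1, h2⟩, h3⟩, ⟨h6, h4⟩, h5⟩
      exact ⟨⟨h1, h2⟩, ⟨h3, h4⟩, h5⟩

/-- Splitting a zero-sum subfamily of length `k + l` into two zero-sum parts of lengths `k` and
`l` is the same as choosing two disjoint zero-sum subfamilies of these lengths. -/
theorem sum_zeroSumCount_sdiff (k l : ℕ) (s : Finset ι) :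
    ∑ A ∈ s.powersetCard k with ∑ i ∈ A, a i = 0, zeroSumCount a l (s \ A) =
      ∑ B ∈ s.powersetCard (k + l) with ∑ i ∈ B, a i = 0, zeroSumCount a l B := by
  simp only [zeroSumCount]
  rw [← card_sigma, ← card_sigma]
  refine card_nbij' (fun x ↦ ⟨x.1 ∪ x.2, x.2⟩) (fun x ↦ ⟨x.1 \ x.2, x.2⟩) ?_ ?_ ?_ ?_
  · rintro ⟨A, C⟩ h
    simp only [mem_coe, mem_sigma, mem_filter, mem_powersetCard] at h ⊢
    obtain ⟨⟨⟨h1, h2⟩, h3⟩, ⟨h4, h5⟩, h6⟩ := h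
    have hd : Disjoint A C := (disjoint_of_subset_left h4 sdiff_disjoint).symm
    refine ⟨⟨⟨union_subset h1 (h4.trans sdiff_subset), ?_⟩, ?_⟩, ⟨subset_union_right, h5⟩, h6⟩
    · rw [card_union_of_disjoint hd, h2, h5]
    · rw [sum_union hd, h3, h6, add_zero]
  · rintro ⟨B, C⟩ h
    simp only [mem_coe, mem_sigma, mem_filter, mem_powersetCard] at h ⊢
    obtain ⟨⟨⟨h1, h2⟩, h3⟩, ⟨h4, h5⟩, h6⟩ := h
    refine ⟨⟨⟨sdiff_subset.trans h1, ?_⟩, ?_⟩, ⟨?_, h5⟩, h6⟩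
    · rw [card_sdiff_of_subset h4]; omega
    · rw [← sum_sdiff h4, h6, add_zero] at h3
      exact h3
    · exact fun x hx ↦ mem_sdiff.2 ⟨h1 (h4 hx), fun hx' ↦ (mem_sdiff.1 hx').2 hx⟩
  · rintro ⟨A, C⟩ h
    simp only [mem_coe, mem_sigma, mem_filter, mem_powersetCard] at h
    have hd : Disjoint A C := (disjoint_of_subset_left h.2.1.1 sdiff_disjoint).symm
    simp [union_sdiff_cancel_right hd]
  · rintro ⟨B, C⟩ h
    simp only [mem_coe, mem_sigma, mem_filter, mem_powersetCard] at h
    simp [sdiff_union_of_subset h.2.1.1]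

end ZeroSumCount

section Reiher

variable {ι : Type*} [DecidableEq ι] {p : ℕ} [Fact p.Prime] (a : ι → ZMod p × ZMod p)

theorem sum_neg_one_pow_zeroSum_eq_zero {s : Finset ι} (hs : 3 * p - 2 ≤ #s) :
    ∑ I ∈ s.powerset with p ∣ #I ∧ ∑ i ∈ I, a i = 0, (-1 : ZMod p) ^ #I = 0 := by
  have hp := (Fact.out : p.Prime).two_le
  let L (c : ι → ZMod p) : MvPolynomial ι (ZMod p) :=
    1 - (∑ i ∈ s, MvPolynomial.C (c i) * MvPolynomial.X i) ^ (p - 1)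
  have hdeg (c : ι → ZMod p) : (L c).totalDegree ≤ p - 1 := by
    refine (MvPolynomial.totalDegree_sub _ _).trans (max_le (by simp) ?_)
    refine (MvPolynomial.totalDegree_pow _ _).trans ?_
    refine (Nat.mul_le_mul_left _
      (MvPolynomial.totalDegree_finsetSum_le (d := 1) fun i _ ↦ ?_)).trans
      (mul_one _).le
    refine (MvPolynomial.totalDegree_mul _ _).trans ?_
    simp
  have heval (c : ι → ZMod p) {I : Finset ι} (hI : I ⊆ s) :
      MvPolynomial.eval (fun i ↦ if i ∈ I then 1 else 0) (L c) =
        if ∑ i ∈ I, c i = 0 then 1 else 0 := by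
    have : ∑ i ∈ s, c i * (if i ∈ I then 1 else 0) = ∑ i ∈ I, c i := by
      simp only [mul_ite, mul_one, mul_zero, ← sum_filter, filter_mem_eq_inter,
        inter_eq_right.2 hI]
    simp only [L, map_sub, map_one, map_pow, map_sum, map_mul, MvPolynomial.eval_C,
      MvPolynomial.eval_X, this, ZMod.pow_card_sub_one]
    split_ifs <;> simp_all
  have hlt : (L 1 * L (fun i ↦ (a i).1) * L fun i ↦ (a i).2).totalDegree < #s := by
    have h1 := MvPolynomial.totalDegree_mul (L 1 * L fun i ↦ (a i).1) (L fun i ↦ (a i).2)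
    have h2 := MvPolynomial.totalDegree_mul (L 1) (L fun i ↦ (a i).1)
    have h3 := hdeg 1
    have h4 := hdeg fun i ↦ (a i).1
    have h5 := hdeg fun i ↦ (a i).2
    omega
  rw [← sum_neg_one_pow_mul_eval_eq_zero _ s hlt, sum_filter]
  refine sum_congr rfl fun I hI ↦ ?_
  have hI' := mem_powerset.1 hI
  simp only [map_mul, heval _ hI', Prod.ext_iff, Prod.fst_sum, Prod.snd_sum, Prod.fst_zero,
    Prod.snd_zero, Pi.one_apply, sum_const, nsmul_one, ZMod.natCast_eq_zero_iff]
  split_ifs <;> simp_all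

theorem zeroSumCount_alternating (hodd : Odd p) {s : Finset ι} (hs : 3 * p - 2 ≤ #s)
    (hs' : #s < 4 * p) :
    (1 - zeroSumCount a p s + zeroSumCount a (2 * p) s - zeroSumCount a (3 * p) s : ZMod p) =
      0 := by
  have hp := (Fact.out : p.Prime).pos
  rw [← sum_neg_one_pow_zeroSum_eq_zero a hs, sum_filter, sum_powerset]
  have key (n : ℕ) : ∑ I ∈ s.powersetCard n,
      (if p ∣ #I ∧ ∑ i ∈ I, a i = 0 then (-1 : ZMod p) ^ #I else 0) =
        if p ∣ n then (-1) ^ n * (zeroSumCount a n s : ZMod p) else 0 := by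
    rw [sum_congr rfl (g := fun I ↦
      if p ∣ n then (if ∑ i ∈ I, a i = 0 then (-1 : ZMod p) ^ n else 0) else 0)]
    · split_ifs
      · rw [← sum_filter, sum_const, nsmul_eq_mul, zeroSumCount, mul_comm]
      · simp
    · intro I hI
      rw [(mem_powersetCard.1 hI).2]
      split_ifs <;> simp_all
  simp only [key]
  rw [← sum_filter, sum_subset (s₂ := (range 4).image (p * ·))]
  · rw [sum_image fun x _ y _ h ↦ Nat.eq_of_mul_eq_mul_left hp h]
    simp only [sum_range_succ, range_zero, sum_empty, mul_zero, mul_one, pow_zero,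
      zeroSumCount_zero, pow_mul, hodd.neg_one_pow]
    rw [mul_comm p 2, mul_comm p 3]
    push_cast
    ring
  · intro n hn
    obtain ⟨hn, k, rfl⟩ := mem_filter.1 hn
    refine mem_image.2 ⟨k, mem_range.2 ?_, rfl⟩
    have := mem_range.1 hn
    by_contra! h
    have := Nat.mul_le_mul_left p h
    omega
  · intro n hn hn'
    obtain ⟨k, -, rfl⟩ := mem_image.1 hn
    rw [zeroSumCount_eq_zero_of_card_lt, Nat.cast_zero, mul_zero]
    by_contra! h
    exact hn' (mem_filter.2 ⟨mem_range.2 (by omega), dvd_mul_right _ _⟩)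

theorem zeroSumCount_two_mul_eq_neg_one (hodd : Odd p) {s : Finset ι} (hs : 3 * p - 2 ≤ #s)
    (hs' : #s < 3 * p) (h : zeroSumCount a p s = 0) :
    (zeroSumCount a (2 * p) s : ZMod p) = -1 := by
  have := zeroSumCount_alternating a hodd hs (by omega)
  rw [h, zeroSumCount_eq_zero_of_card_lt a hs'] at this
  push_cast at this
  linear_combination this

theorem zeroSumCount_three_mul_eq_zero (hodd : Odd p) {s : Finset ι}
    (h : zeroSumCount a p s = 0) : zeroSumCount a (3 * p) s = 0 := by
  have hp := (Fact.out : p.Prime).pos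
  rw [zeroSumCount_eq_zero_iff]
  intro B hBs hB hB0
  obtain ⟨x, hx⟩ : B.Nonempty := card_pos.1 (by omega)
  have hcard := card_erase_of_mem hx
  have h1 := zeroSumCount_two_mul_eq_neg_one a hodd (s := B.erase x) (by omega) (by omega)
    (zeroSumCount_eq_zero_of_subset a ((erase_subset _ _).trans hBs) h)
  have h2 : zeroSumCount a (2 * p) (B.erase x) ≠ 0 := by
    intro h0
    rw [h0] at h1
    simp at h1
  rw [Ne, zeroSumCount_eq_zero_iff] at h2
  push Not at h2
  obtain ⟨C, hC, hCcard, hC0⟩ := h2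
  have hCB := hC.trans (erase_subset _ _)
  refine zeroSumCount_eq_zero_iff a |>.1 h (B \ C) (sdiff_subset.trans hBs) ?_ ?_
  · rw [card_sdiff_of_subset hCB]; omega
  · rw [← sum_sdiff hCB, hC0, add_zero] at hB0
    exact hB0

theorem zeroSumCount_sub_one_eq (hodd : Odd p) {s : Finset ι} (hs : #s = 4 * p - 3)
    (h : zeroSumCount a p s = 0) :
    (zeroSumCount a (p - 1) s : ZMod p) = zeroSumCount a (3 * p - 1) s := by
  have hp := (Fact.out : p.Prime).two_le
  have h1 := congrArg (Nat.cast : ℕ → ZMod p) (sum_zeroSumCount_sdiff a (p - 1) (2 * p) s)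
  have hA : ∀ A ∈ {A ∈ s.powersetCard (p - 1) | ∑ i ∈ A, a i = 0},
      (zeroSumCount a (2 * p) (s \ A) : ZMod p) = -1 := by
    intro A hA
    simp only [mem_filter, mem_powersetCard] at hA
    have := card_sdiff_of_subset hA.1.1
    exact zeroSumCount_two_mul_eq_neg_one a hodd (by omega) (by omega)
      (zeroSumCount_eq_zero_of_subset a sdiff_subset h)
  have hB : ∀ B ∈ {B ∈ s.powersetCard (p - 1 + 2 * p) | ∑ i ∈ B, a i = 0},
      (zeroSumCount a (2 * p) B : ZMod p) = -1 := by
    intro B hB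
    simp only [mem_filter, mem_powersetCard] at hB
    exact zeroSumCount_two_mul_eq_neg_one a hodd (by omega) (by omega)
      (zeroSumCount_eq_zero_of_subset a hB.1.1 h)
  rw [Nat.cast_sum, Nat.cast_sum, sum_congr rfl hA, sum_congr rfl hB] at h1
  simp only [sum_const, nsmul_eq_mul, mul_neg, mul_one, neg_inj] at h1
  rwa [show p - 1 + 2 * p = 3 * p - 1 by omega] at h1

theorem choose_cast_zmod {m k r : ℕ} (hr : r < p) :
    ((m * p + r).choose (k * p + r) : ZMod p) = m.choose k := by
  have hp := (Fact.out : p.Prime).pos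
  have h (l : ℕ) : (l * p + r) % p = r ∧ (l * p + r) / p = l := by
    rw [mul_comm, Nat.mul_add_mod, Nat.mod_eq_of_lt hr, Nat.mul_add_div hp, Nat.div_eq_of_lt hr]
    simp
  have := Choose.choose_modEq_choose_mod_mul_choose_div_nat (p := p) (n := m * p + r)
    (k := k * p + r)
  rw [(h m).1, (h m).2, (h k).1, (h k).2, Nat.choose_self, one_mul] at this
  exact (ZMod.natCast_eq_natCast_iff _ _ _).2 this

theorem zeroSumCount_alternating_of_card_eq (hodd : Odd p) {s : Finset ι} {i : ι} (hi : i ∉ s)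
    (hai : a i = 0) (hs : #s = 3 * p - 3) :
    (1 - zeroSumCount a (p - 1) s - zeroSumCount a p s + zeroSumCount a (2 * p - 1) s +
      zeroSumCount a (2 * p) s : ZMod p) = 0 := by
  have hp := (Fact.out : p.Prime).two_le
  have hc := card_insert_of_notMem hi
  have h := zeroSumCount_alternating a hodd (s := insert i s) (by omega) (by omega)
  have h1 := zeroSumCount_insert_zero a (n := p - 1) hi hai
  have h2 := zeroSumCount_insert_zero a (n := 2 * p - 1) hi hai
  rw [Nat.sub_add_cancel (by omega)] at h1 h2
  rw [h1, h2, zeroSumCount_eq_zero_of_card_lt a (n := 3 * p) (by omega)] at h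
  push_cast at h
  linear_combination h

theorem zeroSumCount_double_counting (hodd : Odd p) {s : Finset ι} {i : ι} (hi : i ∉ s)
    (hai : a i = 0) (hs : #s = 4 * p - 3) :
    (3 - 2 * zeroSumCount a (p - 1) s - 2 * zeroSumCount a p s + zeroSumCount a (2 * p - 1) s +
      zeroSumCount a (2 * p) s : ZMod p) = 0 := by
  have hp : 3 ≤ p := by
    have := (Fact.out : p.Prime).two_le
    obtain ⟨k, rfl⟩ := hodd
    omega
  have h0 : ∑ J ∈ s.powersetCard (3 * p - 3), (1 - zeroSumCount a (p - 1) J -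
      zeroSumCount a p J + zeroSumCount a (2 * p - 1) J + zeroSumCount a (2 * p) J : ZMod p) =
        0 := by
    refine sum_eq_zero fun J hJ ↦ ?_
    obtain ⟨hJs, hJ⟩ := mem_powersetCard.1 hJ
    exact zeroSumCount_alternating_of_card_eq a hodd (fun h ↦ hi (hJs h)) hai hJ
  have hsum (n m k r : ℕ) (hn : n ≤ 3 * p - 3) (hr : r < p) (h1 : #s - n = m * p + r)
      (h2 : 3 * p - 3 - n = k * p + r) :
      ∑ J ∈ s.powersetCard (3 * p - 3), (zeroSumCount a n J : ZMod p) =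
        m.choose k * zeroSumCount a n s := by
    rw [← Nat.cast_sum, sum_powersetCard_zeroSumCount a hn, h1, h2, Nat.cast_mul,
      choose_cast_zmod hr]
  have hone := hsum 0 3 2 (p - 3) (by omega) (by omega) (by omega) (by omega)
  simp only [zeroSumCount_zero, Nat.cast_one] at hone
  simp only [sum_add_distrib, sum_sub_distrib] at h0
  rw [hone, hsum (p - 1) 2 1 (p - 2) (by omega) (by omega) (by omega) (by omega),
    hsum p 2 1 (p - 3) (by omega) (by omega) (by omega) (by omega),
    hsum (2 * p - 1) 1 0 (p - 2) (by omega) (by omega) (by omega) (by omega),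
    hsum (2 * p) 1 0 (p - 3) (by omega) (by omega) (by omega) (by omega)] at h0
  simpa [Nat.choose] using h0

/-- **Reiher's theorem** (the Kemnitz conjecture) for odd primes. -/
theorem zeroSumCount_ne_zero (hodd : Odd p) {s : Finset ι} {i : ι} (hi : i ∉ s)
    (hai : a i = 0) (hs : #s = 4 * p - 3) : zeroSumCount a p s ≠ 0 := by
  intro h
  have hp : 3 ≤ p := by
    have := (Fact.out : p.Prime).two_le
    obtain ⟨k, rfl⟩ := hodd
    omega
  have h3 := zeroSumCount_three_mul_eq_zero a hodd h
  have e1 := zeroSumCount_alternating a hodd (s := s) (by omega) (by omega)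
  have hc := card_insert_of_notMem hi
  have e2 := zeroSumCount_alternating a hodd (s := insert i s) (by omega) (by omega)
  have i1 := zeroSumCount_insert_zero a (n := p - 1) hi hai
  have i2 := zeroSumCount_insert_zero a (n := 2 * p - 1) hi hai
  have i3 := zeroSumCount_insert_zero a (n := 3 * p - 1) hi hai
  rw [Nat.sub_add_cancel (by omega)] at i1 i2 i3
  have e3 := zeroSumCount_double_counting a hodd hi hai hs
  have e4 := zeroSumCount_sub_one_eq a hodd hs h
  rw [i1, i2, i3] at e2
  rw [h, h3] at e1 e2
  rw [h] at e3
  push_cast at e1 e2 e3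
  have h2 : ((2 : ℕ) : ZMod p) = 0 := by
    push_cast
    linear_combination e3 - e2 + e4
  rw [ZMod.natCast_eq_zero_iff] at h2
  exact absurd (Nat.le_of_dvd two_pos h2) (by omega)

end Reiher

theorem exists_le_map_eq_of_le_map {α β : Type*} (f : α → β) {s : Multiset α} {u : Multiset β}
    (h : u ≤ s.map f) : ∃ t ≤ s, t.map f = u := by
  induction s using Quotient.inductionOn with
  | _ l =>
  induction u using Quotient.inductionOn with
  | _ m =>
  obtain ⟨m', hm', hsub⟩ := h
  obtain ⟨l', hl', rfl⟩ := List.sublist_map_iff.1 hsub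
  exact ⟨l', Multiset.coe_le.2 hl'.subperm, Quotient.sound hm'⟩

theorem exists_le_add_of_le_add {α : Type*} {s t u : Multiset α} (h : u ≤ s + t) :
    ∃ s' ≤ s, ∃ t' ≤ t, u = s' + t' := by
  classical
  exact ⟨u ∩ s, Multiset.inter_le_right, u - s, Multiset.sub_le_iff_le_add'.2 h, by
    rw [add_comm]; exact (Multiset.sub_add_inter u s).symm⟩

/-- Every multiset of at least `t` integer vectors has a submultiset of cardinality `n` whose sum
is divisible by `a` in the first coordinate and by `b` in the second one. -/
def HasDvdSumOfCard (a b n t : ℕ) : Prop :=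
  ∀ S : Multiset (ℤ × ℤ), t ≤ S.card →
    ∃ T ≤ S, T.card = n ∧ (a : ℤ) ∣ T.sum.1 ∧ (b : ℤ) ∣ T.sum.2

namespace HasDvdSumOfCard

theorem of_finset {a b n t : ℕ}
    (h : ∀ (s : Finset ((ℤ × ℤ) × ℕ)) (f : (ℤ × ℤ) × ℕ → ℤ × ℤ), #s = t →
      ∃ I ⊆ s, #I = n ∧ (a : ℤ) ∣ (∑ i ∈ I, f i).1 ∧ (b : ℤ) ∣ (∑ i ∈ I, f i).2) :
    HasDvdSumOfCard a b n t := by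
  intro S hS
  obtain ⟨s, hsS, hs⟩ := exists_subset_card_eq (s := S.toEnumFinset) (n := t) (by simpa using hS)
  obtain ⟨I, hI, hcard, h1, h2⟩ := h s Prod.fst hs
  exact ⟨I.1.map Prod.fst, Multiset.map_fst_le_of_subset_toEnumFinset (hI.trans hsS),
    by simpa using hcard, h1, h2⟩

theorem of_prime {p : ℕ} (hp : p.Prime) : HasDvdSumOfCard p p p (4 * p - 3) := by
  have : Fact p.Prime := ⟨hp⟩
  refine of_finset fun s f hs ↦ ?_
  let a : Option ((ℤ × ℤ) × ℕ) → ZMod p × ZMod p :=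
    fun o ↦ o.elim 0 fun i ↦ (((f i).1 : ZMod p), ((f i).2 : ZMod p))
  suffices ∃ I ⊆ s, #I = p ∧ ∑ i ∈ I, a (some i) = 0 by
    obtain ⟨I, hI, hcard, h0⟩ := this
    refine ⟨I, hI, hcard, ?_⟩
    simp only [Prod.ext_iff, Prod.fst_sum, Prod.snd_sum, Prod.fst_zero, Prod.snd_zero] at h0 ⊢
    simp only [a, Option.elim_some, ← Int.cast_sum, ZMod.intCast_zmod_eq_zero_iff_dvd] at h0
    exact h0
  obtain rfl | hodd := hp.eq_two_or_odd'
  · obtain ⟨i, hi, j, hj, hij, h⟩ := exists_ne_map_eq_of_card_lt_of_maps_to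
      (s := s) (t := univ) (f := fun i ↦ a (some i)) (by simp [hs])
      fun _ _ ↦ mem_coe.2 (mem_univ _)
    refine ⟨{i, j}, by simp [insert_subset_iff, hi, hj], card_pair hij, ?_⟩
    rw [sum_pair hij, h]
    exact Prod.ext (CharTwo.add_self_eq_zero _) (CharTwo.add_self_eq_zero _)
  · have h := zeroSumCount_ne_zero a hodd (s := s.map .some) (i := none) (by simp) rfl
      (by simpa using hs)
    rw [Ne, zeroSumCount_eq_zero_iff] at h
    push Not at h
    obtain ⟨J, hJ, hcard, h0⟩ := h
    obtain ⟨I, hI, rfl⟩ := subset_map_iff.1 hJ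
    exact ⟨I, hI, by simpa using hcard, by simpa using h0⟩

theorem one_left (n : ℕ) : HasDvdSumOfCard 1 n n (2 * n - 1) :=
  of_finset fun s f hs ↦ by
    obtain ⟨I, hI, hcard, h⟩ := Int.erdos_ginzburg_ziv (fun i ↦ (f i).2) hs.ge
    exact ⟨I, hI, hcard, by simp, by rwa [Prod.snd_sum]⟩

theorem exists_disjoint_family {a b n t : ℕ} (h : HasDvdSumOfCard a b n t) (r : ℕ)
    (S : Multiset (ℤ × ℤ)) (hS : t + n * r ≤ S.card) :
    ∃ L : Multiset (Multiset (ℤ × ℤ)), L.card = r + 1 ∧ L.sum ≤ S ∧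
      ∀ T ∈ L, T.card = n ∧ (a : ℤ) ∣ T.sum.1 ∧ (b : ℤ) ∣ T.sum.2 := by
  induction r generalizing S with
  | zero =>
    obtain ⟨T, hT, h'⟩ := h S (by simpa using hS)
    exact ⟨{T}, by simp, by simpa using hT, by simpa using h'⟩
  | succ r ih =>
    rw [mul_add_one] at hS
    obtain ⟨T, hT, h'⟩ := h S (by omega)
    obtain ⟨U, rfl⟩ := Multiset.le_iff_exists_add.1 hT
    rw [Multiset.card_add, h'.1] at hS
    obtain ⟨L, hL, hLU, hL'⟩ := ih U (by omega)
    refine ⟨T ::ₘ L, by simp [hL], by simpa using hLU, ?_⟩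
    simpa using ⟨h', hL'⟩

theorem mul {a b n t a' b' n' r : ℕ} (h : HasDvdSumOfCard a b n t)
    (h' : HasDvdSumOfCard a' b' n' (r + 1)) :
    HasDvdSumOfCard (a * a') (b * b') (n * n') (t + n * r) := by
  intro S hS
  obtain ⟨L, hL, hLS, hLT⟩ := h.exists_disjoint_family r S hS
  obtain ⟨U, hU, hUcard, hU1, hU2⟩ :=
    h' (L.map fun T ↦ (T.sum.1 / (a : ℤ), T.sum.2 / (b : ℤ))) (by simp [hL])
  obtain ⟨M, hM, rfl⟩ := exists_le_map_eq_of_le_map _ hU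
  have hMT : ∀ T ∈ M, T.card = n ∧ (a : ℤ) ∣ T.sum.1 ∧ (b : ℤ) ∣ T.sum.2 :=
    fun T hT ↦ hLT T (Multiset.mem_of_le hM hT)
  have hsum : M.sum.card = n * M.card ∧
      M.sum.sum.1 = a * (M.map fun T ↦ (T.sum.1 / (a : ℤ), T.sum.2 / (b : ℤ))).sum.1 ∧
      M.sum.sum.2 = b * (M.map fun T ↦ (T.sum.1 / (a : ℤ), T.sum.2 / (b : ℤ))).sum.2 := by
    clear hM hU hU1 hU2 hUcard
    induction M using Multiset.induction with
    | empty => simp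
    | cons T M ih =>
      obtain ⟨i1, i2, i3⟩ := ih fun T' hT' ↦ hMT T' (Multiset.mem_cons_of_mem hT')
      obtain ⟨j1, j2, j3⟩ := hMT T (Multiset.mem_cons_self T M)
      simp only [Multiset.sum_cons, Multiset.map_cons, Multiset.card_add, Multiset.card_cons,
        Multiset.sum_add, Prod.fst_add, Prod.snd_add, i1, i2, i3, j1, mul_add,
        Int.mul_ediv_cancel' j2, Int.mul_ediv_cancel' j3, and_true]
      ring
  have hML : M.sum ≤ L.sum := by
    obtain ⟨N, rfl⟩ := Multiset.le_iff_exists_add.1 hM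
    exact (Multiset.le_add_right _ _).trans_eq (Multiset.sum_add M N).symm
  refine ⟨M.sum, hML.trans hLS, ?_, ?_, ?_⟩
  · rw [hsum.1, ← hUcard, Multiset.card_map]
  · rw [hsum.2.1, Nat.cast_mul]
    exact mul_dvd_mul_left _ hU1
  · rw [hsum.2.2, Nat.cast_mul]
    exact mul_dvd_mul_left _ hU2

/-- **Reiher's theorem** (the Kemnitz conjecture). -/
theorem self {n : ℕ} (hn : 1 ≤ n) : HasDvdSumOfCard n n n (4 * n - 3) := by
  induction n using Nat.prime_composite_induction with
  | zero => omega
  | one =>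
    simpa using one_left 1
  | prime p hp => exact of_prime hp
  | composite m hm ihm n hn' ihn =>
    have hr : 4 * n - 3 = 4 * (n - 1) + 1 := by omega
    convert (ihm (by omega)).mul (hr ▸ ihn (by omega)) using 1
    obtain ⟨n, rfl⟩ := Nat.exists_eq_add_of_le' (show 1 ≤ n by omega)
    simp only [Nat.add_sub_cancel, mul_add, mul_left_comm m 4 n]
    omega

theorem self_mul {m k : ℕ} (hm : 1 ≤ m) (hk : 1 ≤ k) :
    HasDvdSumOfCard m (m * k) (m * k) (2 * m + 2 * (m * k) - 3) := by
  have hr : 2 * k - 1 = 2 * (k - 1) + 1 := by omega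
  convert (self hm).mul (hr ▸ one_left k) using 1
  · simp
  · obtain ⟨k, rfl⟩ := Nat.exists_eq_add_of_le' hk
    simp only [Nat.add_sub_cancel, mul_add, mul_left_comm m 2 k]
    omega

end HasDvdSumOfCard

theorem exponent_zmod_prod {n₁ n₂ : ℕ} (hd : n₁ ∣ n₂) :
    AddMonoid.exponent (ZMod n₁ × ZMod n₂) = n₂ := by
  rw [AddMonoid.exponent_prod, ZMod.exponent, ZMod.exponent]
  exact Nat.lcm_eq_right hd

theorem exists_zero_sum_of_card_le {n₁ n₂ : ℕ} (h₁ : 1 ≤ n₁) (h₂ : 1 ≤ n₂) (hd : n₁ ∣ n₂)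
    (S : Multiset (ZMod n₁ × ZMod n₂)) (hS : 2 * n₁ + 2 * n₂ - 3 ≤ S.card) :
    ∃ T ≤ S, T.sum = 0 ∧ T.card = n₂ := by
  obtain ⟨k, rfl⟩ := hd
  have hk : 1 ≤ k := Nat.pos_of_mul_pos_left h₂
  let φ : ℤ × ℤ →+ ZMod n₁ × ZMod (n₁ * k) :=
    (Int.castAddHom _).prodMap (Int.castAddHom _)
  have hφ : Function.Surjective φ :=
    Function.Surjective.prodMap ZMod.intCast_surjective ZMod.intCast_surjective
  obtain ⟨S, rfl⟩ := Multiset.map_surjective_of_surjective hφ S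
  obtain ⟨T, hT, hcard, hT1, hT2⟩ :=
    HasDvdSumOfCard.self_mul h₁ hk S (by simpa using hS)
  refine ⟨T.map φ, Multiset.map_le_map hT, ?_, by simpa using hcard⟩
  rw [← map_multiset_sum]
  exact Prod.ext ((ZMod.intCast_zmod_eq_zero_iff_dvd _ _).2 hT1)
    ((ZMod.intCast_zmod_eq_zero_iff_dvd _ _).2 hT2)

theorem exists_no_zero_sum {n₁ n₂ : ℕ} (h₁ : 1 ≤ n₁) (h₂ : 1 ≤ n₂) :
    ∃ S : Multiset (ZMod n₁ × ZMod n₂), S.card = 2 * n₁ + 2 * n₂ - 4 ∧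
      ∀ T ≤ S, T.card = n₂ → T.sum ≠ 0 := by
  refine ⟨Multiset.replicate (n₂ - 1) (0, 0) + Multiset.replicate (n₂ - 1) (0, 1) +
    (Multiset.replicate (n₁ - 1) (1, 0) + Multiset.replicate (n₁ - 1) (1, 1)), ?_, ?_⟩
  · simp only [Multiset.card_add, Multiset.card_replicate]
    omega
  · intro T hT hcard h0
    obtain ⟨_, hx, _, hy, rfl⟩ := exists_le_add_of_le_add hT
    obtain ⟨_, ha, _, hb, rfl⟩ := exists_le_add_of_le_add hx
    obtain ⟨_, hc, _, hd, rfl⟩ := exists_le_add_of_le_add hy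
    obtain ⟨a, ha, rfl⟩ := Multiset.le_replicate_iff.1 ha
    obtain ⟨b, hb, rfl⟩ := Multiset.le_replicate_iff.1 hb
    obtain ⟨c, hc, rfl⟩ := Multiset.le_replicate_iff.1 hc
    obtain ⟨d, hd, rfl⟩ := Multiset.le_replicate_iff.1 hd
    simp only [Multiset.card_add, Multiset.card_replicate] at hcard
    simp only [Multiset.sum_add, Multiset.sum_replicate, Prod.ext_iff, Prod.fst_add, Prod.snd_add,
      Prod.smul_fst, Prod.smul_snd, Prod.fst_zero, Prod.snd_zero, smul_zero, nsmul_one, zero_add,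
      add_zero, ← Nat.cast_add, ZMod.natCast_eq_zero_iff] at h0
    obtain ⟨⟨x, hx⟩, ⟨y, hy⟩⟩ := h0
    have hx2 : x < 2 := by
      by_contra! h
      have := Nat.mul_le_mul_left n₁ h
      omega
    have hy2 : y < 2 := by
      by_contra! h
      have := Nat.mul_le_mul_left n₂ h
      omega
    interval_cases x <;> interval_cases y <;> omega

end EgzRankTwo

theorem stmt_3 (n₁ n₂ : ℕ) (h₁ : 1 ≤ n₁) (h₂ : 1 ≤ n₂) (hd : n₁ ∣ n₂) :
    egz (ZMod n₁ × ZMod n₂) = 2 * n₁ + 2 * n₂ - 3 := by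
  refine le_antisymm (Nat.sInf_le ?_) (le_csInf ⟨2 * n₁ + 2 * n₂ - 3, ?_⟩ fun t ht ↦ ?_)
  · rw [Set.mem_ofPred_eq, EgzRankTwo.exponent_zmod_prod hd]
    exact EgzRankTwo.exists_zero_sum_of_card_le h₁ h₂ hd
  · rw [Set.mem_ofPred_eq, EgzRankTwo.exponent_zmod_prod hd]
    exact EgzRankTwo.exists_zero_sum_of_card_le h₁ h₂ hd
  · rw [Set.mem_ofPred_eq, EgzRankTwo.exponent_zmod_prod hd] at ht
    obtain ⟨S, hS, hST⟩ := EgzRankTwo.exists_no_zero_sum h₁ h₂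
    by_contra! hlt
    obtain ⟨T, hT, h0, hcard⟩ := ht S (by omega)
    exact hST T hT hcard h0
end

section
/- For every non-trivial finite abelian group G, D(G) ≤ exp(G)·(1 + log(|G|/exp(G))). -/
theorem AddChar.map_sum_eq_prod {A M ι : Type*} [AddCommMonoid A] [CommMonoid M]
    (ψ : AddChar A M) (f : ι → A) (s : Finset ι) : ψ (∑ i ∈ s, f i) = ∏ i ∈ s, ψ (f i) :=
  map_prod ψ.toMonoidHom (fun i ↦ Multiplicative.ofAdd (f i)) s

open Finset in
/-- Some value in `ℂˣ` is taken at `g` by at least a proportion `1 / exp G` of the characters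
in `A`. -/
theorem exists_card_filter_apply_ne_le {G : Type*} [AddCommGroup G] [Finite G]
    (A : Finset (AddChar G ℂ)) (g : G) :
    ∃ z : ℂ, z ≠ 0 ∧ (#{χ ∈ A | χ g ≠ z} : ℝ) ≤
      #A * (1 - 1 / (AddMonoid.exponent G : ℝ)) := by
  classical
  set n := AddMonoid.exponent G with hn
  have hn0 : n ≠ 0 := AddMonoid.exponent_ne_zero_of_finite
  have hnR : (n : ℝ) ≠ 0 := Nat.cast_ne_zero.mpr hn0
  have hcard : #(Polynomial.nthRootsFinset n (1 : ℂ)) = n :=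
    (Complex.isPrimitiveRoot_exp n hn0).card_nthRootsFinset
  have hmaps : ∀ χ ∈ A, χ g ∈ Polynomial.nthRootsFinset n (1 : ℂ) := fun χ _ ↦ by
    rw [Polynomial.mem_nthRootsFinset (Nat.pos_of_ne_zero hn0), ← AddChar.map_nsmul_eq_pow,
      AddMonoid.exponent_nsmul_eq_zero, AddChar.map_zero_eq_one]
  obtain ⟨z, hz, hle⟩ := exists_le_card_fiber_of_nsmul_le_card_of_maps_to
    (b := (#A : ℝ) / n) hmaps (card_pos.mp (by omega)) (by
      rw [hcard, nsmul_eq_mul, mul_div_cancel₀ _ hnR])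
  refine ⟨z, ?_, ?_⟩
  · rintro rfl
    rw [Polynomial.mem_nthRootsFinset (Nat.pos_of_ne_zero hn0), zero_pow hn0] at hz
    exact zero_ne_one hz
  · have h := card_filter_add_card_filter_not (s := A) (fun χ ↦ χ g = z)
    have h' : (#{χ ∈ A | χ g = z} : ℝ) + #{χ ∈ A | χ g ≠ z} = #A := by exact_mod_cast h
    rw [mul_sub, mul_one_div]
    linarith

/-- A choice of nonzero scalars for which each character in `A` agrees with its scalar at
some index of `s`. -/
def HasCoveringScalars {G ι : Type*} [AddCommGroup G] (f : ι → G) (A : Finset (AddChar G ℂ))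
    (s : Finset ι) : Prop :=
  ∃ a : ι → ℂ, (∀ i, a i ≠ 0) ∧ ∀ χ ∈ A, ∃ i ∈ s, χ (f i) = a i

open Finset in
theorem HasCoveringScalars.insert {G ι : Type*} [AddCommGroup G] [DecidableEq ι] {f : ι → G}
    {A : Finset (AddChar G ℂ)} {s : Finset ι} {i : ι} (hi : i ∉ s) {z : ℂ} (hz : z ≠ 0)
    (h : HasCoveringScalars f {χ ∈ A | χ (f i) ≠ z} s) :
    HasCoveringScalars f A (insert i s) := by
  obtain ⟨a, ha, hcov⟩ := h
  refine ⟨Function.update a i z, fun j ↦ ?_, fun χ hχ ↦ ?_⟩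
  · rcases eq_or_ne j i with rfl | hj
    · simpa using hz
    · simpa [hj] using ha j
  · by_cases hχz : χ (f i) = z
    · exact ⟨i, mem_insert_self i s, by simpa using hχz⟩
    · obtain ⟨j, hj, hje⟩ := hcov χ (mem_filter.mpr ⟨hχ, hχz⟩)
      have hji : j ≠ i := ne_of_mem_of_not_mem hj hi
      exact ⟨j, mem_insert_of_mem hj, by simpa [hji] using hje⟩

open Finset in
theorem hasCoveringScalars_of_card_le {G ι : Type*} [AddCommGroup G] [Finite G] (f : ι → G)
    (s : Finset ι) : ∀ A : Finset (AddChar G ℂ), #A ≤ #s → HasCoveringScalars f A s := by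
  classical
  induction s using Finset.induction_on with
  | empty =>
    intro A hA
    have hA' : A = ∅ := by simpa using hA
    exact ⟨1, fun _ ↦ one_ne_zero, by simp [hA']⟩
  | insert i s hi ih =>
    intro A hA
    obtain ⟨z, hz, hle⟩ := exists_card_filter_apply_ne_le A (f i)
    refine HasCoveringScalars.insert hi hz (ih _ ?_)
    rw [card_insert_of_notMem hi] at hA
    rcases A.eq_empty_or_nonempty with rfl | hne
    · simp
    · have hn : (0 : ℝ) < AddMonoid.exponent G :=
        Nat.cast_pos.mpr (Nat.pos_of_ne_zero AddMonoid.exponent_ne_zero_of_finite)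
      have hApos : (0 : ℝ) < #A := Nat.cast_pos.mpr hne.card_pos
      have hlt : (#{χ ∈ A | χ (f i) ≠ z} : ℝ) < #A := by
        have : 0 < (#A : ℝ) * (1 / AddMonoid.exponent G) := by positivity
        linarith
      have hlt' : #{χ ∈ A | χ (f i) ≠ z} < #A := by exact_mod_cast hlt
      omega

open Finset in
theorem hasCoveringScalars_of_card_mul_pow_lt {G ι : Type*} [AddCommGroup G] [Finite G]
    (f : ι → G) (c k : ℕ) : ∀ (s : Finset ι) (A : Finset (AddChar G ℂ)), k + c ≤ #s →
      #A * (1 - 1 / (AddMonoid.exponent G : ℝ)) ^ k < c + 1 → HasCoveringScalars f A s := by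
  classical
  induction k with
  | zero =>
    intro s A hs hA
    have hA' : #A < c + 1 := by
      rw [pow_zero, mul_one] at hA
      exact_mod_cast hA
    exact hasCoveringScalars_of_card_le f s A (by omega)
  | succ k ih =>
    intro s A hs hA
    obtain ⟨i, hi⟩ : s.Nonempty := card_pos.mp (by omega)
    obtain ⟨z, hz, hle⟩ := exists_card_filter_apply_ne_le A (f i)
    rw [← insert_erase hi]
    refine HasCoveringScalars.insert (notMem_erase i s) hz (ih _ _ ?_ (lt_of_le_of_lt ?_ hA))
    · rw [card_erase_of_mem hi]
      omega
    · have h1 : (1 : ℝ) ≤ AddMonoid.exponent G :=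
        Nat.one_le_cast.mpr (Nat.one_le_iff_ne_zero.mpr AddMonoid.exponent_ne_zero_of_finite)
      have h0 : 0 ≤ 1 - 1 / (AddMonoid.exponent G : ℝ) :=
        sub_nonneg.mpr ((div_le_one (by linarith)).mpr h1)
      rw [pow_succ', ← mul_assoc]
      exact mul_le_mul_of_nonneg_right hle (pow_nonneg h0 k)

open Finset in
/-- If every character of `G` is covered, then expanding `∑ χ, ∏ i, (a i - χ (f i)) = 0` yields
a nonempty zero-sum subfamily. -/
theorem HasCoveringScalars.exists_sum_eq_zero {G ι : Type*} [AddCommGroup G] [Fintype G]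
    [Fintype ι] {f : ι → G} (h : HasCoveringScalars f univ univ) :
    ∃ s : Finset ι, s.Nonempty ∧ ∑ i ∈ s, f i = 0 := by
  classical
  obtain ⟨a, ha, hcov⟩ := h
  by_contra! hfree
  have hvanish : ∑ χ : AddChar G ℂ, ∏ i, (-χ (f i) + a i) = 0 :=
    sum_eq_zero fun χ _ ↦ by
      obtain ⟨i, hi, hie⟩ := hcov χ (mem_univ χ)
      exact prod_eq_zero hi (by rw [hie, neg_add_cancel])
  have hexpand : ∑ χ : AddChar G ℂ, ∏ i, (-χ (f i) + a i) =
      Fintype.card G * ∏ i, a i := by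
    have hprod (χ : AddChar G ℂ) (s : Finset ι) :
        ∏ i ∈ s, -χ (f i) = (-1) ^ #s * χ (∑ i ∈ s, f i) := by
      rw [prod_neg, AddChar.map_sum_eq_prod]
    simp_rw [prod_add, hprod]
    rw [sum_comm, sum_eq_single_of_mem ∅ (empty_mem_powerset univ)]
    · simp [AddChar.card_eq]
    · intro s _ hs
      rw [← sum_mul, ← mul_sum, AddChar.sum_apply_eq_ite,
        if_neg (hfree s (nonempty_iff_ne_empty.mpr hs)), mul_zero, zero_mul]
  rw [hexpand] at hvanish
  exact mul_ne_zero (Nat.cast_ne_zero.mpr Fintype.card_ne_zero)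
    (prod_ne_zero_iff.mpr fun i _ ↦ ha i) hvanish

open Finset in
theorem Multiset.exists_le_sum_eq_zero_of_card_mul_pow_lt {G : Type*} [AddCommGroup G]
    [Fintype G] {c k : ℕ}
    (hck : Fintype.card G * (1 - 1 / (AddMonoid.exponent G : ℝ)) ^ k < c + 1)
    (S : Multiset G) (hS : k + c ≤ Multiset.card S) : ∃ T ≤ S, T ≠ 0 ∧ T.sum = 0 := by
  classical
  obtain ⟨l, rfl⟩ := Quot.exists_rep S
  have hcov : HasCoveringScalars l.get univ univ :=
    hasCoveringScalars_of_card_mul_pow_lt l.get c k univ univ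
      (by simpa using hS) (by simpa [AddChar.card_eq] using hck)
  obtain ⟨s, hs, hsum⟩ := hcov.exists_sum_eq_zero
  refine ⟨s.val.map l.get, ?_, ?_, hsum⟩
  · calc s.val.map l.get ≤ (univ : Finset (Fin l.length)).val.map l.get :=
          Multiset.map_le_map (val_le_iff.mpr (subset_univ s))
      _ = (l : Multiset G) := by
          rw [Fin.univ_val_map, List.ofFn_get]
  · simpa using hs.ne_empty

theorem stmt_8 (G : Type*) [AddCommGroup G] [Fintype G] [Nontrivial G] :
    (Davenport G : ℝ) ≤ (AddMonoid.exponent G : ℝ) *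
      (1 + Real.log ((Fintype.card G : ℝ) / (AddMonoid.exponent G : ℝ))) := by
  have hn0 : AddMonoid.exponent G ≠ 0 := AddMonoid.exponent_ne_zero_of_finite
  have hle : AddMonoid.exponent G ≤ Fintype.card G :=
    Nat.le_of_dvd Fintype.card_pos AddGroup.exponent_dvd_card
  set n := AddMonoid.exponent G with hn
  have hn1 : (1 : ℝ) ≤ n := Nat.one_le_cast.mpr (Nat.one_le_iff_ne_zero.mpr hn0)
  have hnpos : (0 : ℝ) < n := by linarith
  have hm : (0 : ℝ) < Fintype.card G := Nat.cast_pos.mpr Fintype.card_pos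
  set L := (n : ℝ) * Real.log (Fintype.card G / n) with hL
  have hL0 : 0 ≤ L :=
    mul_nonneg hnpos.le (Real.log_nonneg ((one_le_div hnpos).mpr (Nat.cast_le.mpr hle)))
  have hpow : (Fintype.card G : ℝ) * (1 - 1 / (n : ℝ)) ^ (⌊L⌋₊ + 1) < (n - 1 : ℕ) + 1 := by
    have hlt : Real.log (Fintype.card G / n) < (⌊L⌋₊ + 1 : ℕ) * (1 / (n : ℝ)) := by
      rw [mul_one_div, lt_div_iff₀ hnpos, mul_comm]
      exact_mod_cast Nat.lt_floor_add_one L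
    rw [Nat.cast_pred (Nat.pos_of_ne_zero hn0), sub_add_cancel]
    calc (Fintype.card G : ℝ) * (1 - 1 / (n : ℝ)) ^ (⌊L⌋₊ + 1)
        ≤ Fintype.card G * Real.exp (-(1 / (n : ℝ))) ^ (⌊L⌋₊ + 1) := by
          gcongr
          · exact sub_nonneg.mpr ((div_le_one hnpos).mpr hn1)
          · exact Real.one_sub_le_exp_neg _
      _ = Fintype.card G * Real.exp (-((⌊L⌋₊ + 1 : ℕ) * (1 / (n : ℝ)))) := by
          rw [← Real.exp_nat_mul, mul_neg]
      _ < Fintype.card G * Real.exp (-Real.log (Fintype.card G / n)) := by gcongr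
      _ = n := by
          rw [Real.exp_neg, Real.exp_log (div_pos hm hnpos)]
          field_simp
  have hD : Davenport G ≤ ⌊L⌋₊ + 1 + (n - 1) :=
    Nat.sInf_le fun S hS ↦ Multiset.exists_le_sum_eq_zero_of_card_mul_pow_lt hpow S hS
  calc (Davenport G : ℝ) ≤ (n + ⌊L⌋₊ : ℕ) := Nat.cast_le.mpr (by omega)
    _ ≤ n + L := by
        rw [Nat.cast_add]
        exact add_le_add le_rfl (Nat.floor_le hL0)
    _ = n * (1 + Real.log (Fintype.card G / n)) := by rw [hL]; ring
end

section
/- For every natural number n ≥ 2, η(C_n³) ≤ 20369(n−1) + 1. -/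
open Finset

/-- Functions on finsets that are polynomials of degree at most `k` in the indicators of the
elements, over `R`. -/
def cubePoly (R : Type*) [CommRing R] (ι : Type*) [DecidableEq ι] (k : ℕ) :
    Submodule R (Finset ι → R) :=
  Submodule.span R {f | ∃ U : Finset ι, #U ≤ k ∧ f = fun T => if U ⊆ T then 1 else 0}

section CubePoly

variable {R : Type*} [CommRing R] {ι : Type*} [DecidableEq ι]

lemma indicator_mem_cubePoly {k : ℕ} {U : Finset ι} (hU : #U ≤ k) :
    (fun T => if U ⊆ T then 1 else 0) ∈ cubePoly R ι k :=
  Submodule.subset_span ⟨U, hU, rfl⟩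

lemma cubePoly_mono {k l : ℕ} (h : k ≤ l) : cubePoly R ι k ≤ cubePoly R ι l :=
  Submodule.span_mono fun _ ⟨U, hU, hf⟩ => ⟨U, hU.trans h, hf⟩

lemma one_mem_cubePoly (k : ℕ) : (1 : Finset ι → R) ∈ cubePoly R ι k := by
  convert indicator_mem_cubePoly (R := R) (U := (∅ : Finset ι)) (k := k) (by simp) using 1
  ext T
  simp

lemma mul_mem_cubePoly {k l : ℕ} {f g : Finset ι → R} (hf : f ∈ cubePoly R ι k)
    (hg : g ∈ cubePoly R ι l) : f * g ∈ cubePoly R ι (k + l) := by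
  refine Submodule.mul_le.1 ?_ f hf g hg
  rw [cubePoly, cubePoly, Submodule.span_mul_span, Submodule.span_le]
  rintro _ ⟨_, ⟨U, hU, rfl⟩, _, ⟨V, hV, rfl⟩, rfl⟩
  refine Submodule.subset_span ⟨U ∪ V, (card_union_le U V).trans (by lia), ?_⟩
  ext T
  by_cases h1 : U ⊆ T <;> by_cases h2 : V ⊆ T <;> simp [h1, h2, union_subset_iff]

lemma pow_mem_cubePoly {k : ℕ} {f : Finset ι → R} (hf : f ∈ cubePoly R ι k) (e : ℕ) :
    f ^ e ∈ cubePoly R ι (e * k) := by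
  induction e with
  | zero => simpa using one_mem_cubePoly 0
  | succ e ih => rw [pow_succ, add_mul, one_mul]; exact mul_mem_cubePoly ih hf

/-- A polynomial of degree less than the dimension has vanishing alternating sum over the cube. -/
lemma alternating_sum_eq_zero {k : ℕ} {f : Finset ι → R} (hf : f ∈ cubePoly R ι k)
    {s : Finset ι} (hk : k < #s) : ∑ T ∈ s.powerset, (-1) ^ #T * f T = 0 := by
  induction hf using Submodule.span_induction with
  | mem f hf =>
    obtain ⟨U, hU, rfl⟩ := hf
    obtain ⟨i, hi, hiU⟩ : ∃ i ∈ s, i ∉ U := by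
      by_contra! h
      exact absurd (card_le_card (show s ⊆ U from h)) (by lia)
    obtain ⟨s', his', rfl⟩ : ∃ s', i ∉ s' ∧ insert i s' = s :=
      ⟨s.erase i, by simp, insert_erase hi⟩
    rw [sum_powerset_insert his', ← sum_add_distrib]
    refine sum_eq_zero fun T hT => ?_
    have hiT : i ∉ T := fun h => his' (mem_powerset.1 hT h)
    by_cases hUT : U ⊆ T <;>
      simp [card_insert_of_notMem hiT, pow_succ, subset_insert_iff_of_notMem hiU, hUT]
  | zero => simp
  | add f g _ _ hf hg => simp [mul_add, sum_add_distrib, hf, hg]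
  | smul a f _ hf =>
    simp only [Pi.smul_apply, smul_eq_mul, mul_left_comm _ a]
    rw [← mul_sum, hf, mul_zero]

omit [DecidableEq ι] in
lemma alternating_sum_eq_apply_empty {f : Finset ι → R} {s : Finset ι}
    (h : ∀ T ⊆ s, T.Nonempty → f T = 0) : ∑ T ∈ s.powerset, (-1) ^ #T * f T = f ∅ := by
  rw [sum_eq_single_of_mem ∅ (by simp)]
  · simp
  · intro T hT hne
    rw [h T (mem_powerset.1 hT) (nonempty_iff_ne_empty.2 hne), mul_zero]

lemma sum_mem_cubePoly [Finite ι] (x : ι → R) : (fun T => ∑ i ∈ T, x i) ∈ cubePoly R ι 1 := by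
  have := Fintype.ofFinite ι
  have : (fun T => ∑ i ∈ T, x i) =
      ∑ i, x i • (fun T : Finset ι => if {i} ⊆ T then (1 : R) else 0) := by
    ext T
    simp [Finset.sum_apply]
  rw [this]
  exact Submodule.sum_mem _ fun i _ => Submodule.smul_mem _ _ (indicator_mem_cubePoly (by simp))

lemma choose_mem_cubePoly [Finite ι] (k : ℕ) :
    (fun T => ((#T).choose k : R)) ∈ cubePoly R ι k := by
  have := Fintype.ofFinite ι
  have : (fun T => ((#T).choose k : R)) =
      ∑ U ∈ powersetCard k univ, (fun T : Finset ι => if U ⊆ T then (1 : R) else 0) := by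
    ext T
    simp only [Finset.sum_apply, sum_boole]
    rw [← card_powersetCard]
    congr 2
    ext U
    simp [mem_powersetCard, and_comm]
  rw [this]
  exact Submodule.sum_mem _ fun U hU => indicator_mem_cubePoly (mem_powersetCard.1 hU).2.le

end CubePoly

section ZeroSumPlane

variable {p : ℕ} [hp : Fact p.Prime] {ι : Type*} [DecidableEq ι]

/-- The indicator that `x`, `y` and the cardinality all sum to zero modulo `p`. -/
def zeroSumIndicator (p : ℕ) (x y : ι → ZMod p) : Finset ι → ZMod p :=
  (1 - (fun T => ∑ i ∈ T, x i) ^ (p - 1)) * (1 - (fun T => ∑ i ∈ T, y i) ^ (p - 1)) *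
    (1 - (fun T => ∑ _i ∈ T, (1 : ZMod p)) ^ (p - 1))

lemma zeroSumIndicator_mem_cubePoly [Finite ι] (x y : ι → ZMod p) :
    zeroSumIndicator p x y ∈ cubePoly (ZMod p) ι (3 * (p - 1)) := by
  have key (z : ι → ZMod p) :
      1 - (fun T => ∑ i ∈ T, z i) ^ (p - 1) ∈ cubePoly (ZMod p) ι (p - 1) :=
    Submodule.sub_mem _ (one_mem_cubePoly _) <| by
      simpa using pow_mem_cubePoly (sum_mem_cubePoly z) (p - 1)
  convert mul_mem_cubePoly (mul_mem_cubePoly (key x) (key y)) (key fun _ => 1) using 1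
  · rw [show 3 * (p - 1) = p - 1 + (p - 1) + (p - 1) by ring]
  · rfl

omit [DecidableEq ι] in
lemma zeroSumIndicator_empty (x y : ι → ZMod p) : zeroSumIndicator p x y ∅ = 1 := by
  have := hp.out.two_le
  simp [zeroSumIndicator, zero_pow (show p - 1 ≠ 0 by lia)]

omit [DecidableEq ι] in
lemma of_zeroSumIndicator_ne_zero {x y : ι → ZMod p} {T : Finset ι}
    (h : zeroSumIndicator p x y T ≠ 0) : ∑ i ∈ T, x i = 0 ∧ ∑ i ∈ T, y i = 0 ∧ p ∣ #T := by
  have key {z : ZMod p} (hz : 1 - z ^ (p - 1) ≠ 0) : z = 0 := by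
    by_contra h0
    exact hz (by rw [ZMod.pow_card_sub_one_eq_one h0, sub_self])
  simp only [zeroSumIndicator, Pi.mul_apply, Pi.sub_apply, Pi.pow_apply, Pi.one_apply, ne_eq,
    mul_eq_zero, not_or] at h
  refine ⟨key h.1.1, key h.1.2, (ZMod.natCast_eq_zero_iff _ _).1 ?_⟩
  simpa using key h.2

lemma exists_zeroSum_dvd_card [Finite ι] (x y : ι → ZMod p) {s : Finset ι}
    (hs : 3 * (p - 1) < #s) :
    ∃ T ⊆ s, T.Nonempty ∧ ∑ i ∈ T, x i = 0 ∧ ∑ i ∈ T, y i = 0 ∧ p ∣ #T := by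
  by_contra! h
  have h1 := alternating_sum_eq_zero (zeroSumIndicator_mem_cubePoly x y) hs
  rw [alternating_sum_eq_apply_empty, zeroSumIndicator_empty] at h1
  · exact one_ne_zero h1
  · intro T hT hne
    by_contra h0
    obtain ⟨hx, hy, hd⟩ := of_zeroSumIndicator_ne_zero h0
    exact h T hT hne hx hy hd

lemma exists_zeroSum_card_eq_of_card_eq_three_mul [Finite ι] {x y : ι → ZMod p} {s : Finset ι}
    (hs : #s = 3 * p) (hx : ∑ i ∈ s, x i = 0) (hy : ∑ i ∈ s, y i = 0) :
    ∃ T ⊆ s, #T = p ∧ ∑ i ∈ T, x i = 0 ∧ ∑ i ∈ T, y i = 0 := by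
  have hp2 := hp.out.two_le
  obtain ⟨i, hi⟩ : s.Nonempty := card_pos.1 (by lia)
  obtain ⟨T, hT, hne, hTx, hTy, c, hc⟩ :=
    exists_zeroSum_dvd_card x y (s := s.erase i) (by rw [card_erase_of_mem hi]; lia)
  have hTs := hT.trans (erase_subset i s)
  have hlt : #T ≤ 3 * p - 1 := by
    simpa [card_erase_of_mem hi, hs] using card_le_card hT
  have hpos := hne.card_pos
  have hc3 : c < 3 := by
    by_contra! h
    have := Nat.mul_le_mul_left p h
    lia
  interval_cases c
  · lia
  · exact ⟨T, hTs, by lia, hTx, hTy⟩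
  · refine ⟨s \ T, sdiff_subset, by rw [card_sdiff_of_subset hTs]; lia, ?_, ?_⟩
    · rw [sum_sdiff_eq_sub hTs, hx, hTx, sub_zero]
    · rw [sum_sdiff_eq_sub hTs, hy, hTy, sub_zero]

/-- Rónyai's bound: among `4 p - 2` elements of `C_p ^ 2` there are `p` with sum zero. -/
lemma exists_zeroSum_card_eq [Finite ι] (hp2 : p ≠ 2) (x y : ι → ZMod p) {s : Finset ι}
    (hs : 4 * p - 2 ≤ #s) :
    ∃ T ⊆ s, #T = p ∧ ∑ i ∈ T, x i = 0 ∧ ∑ i ∈ T, y i = 0 := by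
  by_contra! h
  have hp3 : 3 ≤ p := lt_of_le_of_ne hp.out.two_le (Ne.symm hp2)
  obtain ⟨s', hs's, hs'⟩ := exists_subset_card_eq hs
  have hmem : (zeroSumIndicator p x y * ((fun T => ((#T).choose p : ZMod p)) - (2 : ZMod p) • 1)) ∈
      cubePoly (ZMod p) ι (3 * (p - 1) + p) :=
    mul_mem_cubePoly (zeroSumIndicator_mem_cubePoly x y) <|
      Submodule.sub_mem _ (choose_mem_cubePoly p) (Submodule.smul_mem _ _ (one_mem_cubePoly p))
  have h1 := alternating_sum_eq_zero hmem (s := s') (by lia)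
  rw [alternating_sum_eq_apply_empty] at h1
  · have h2 : (2 : ZMod p) ≠ 0 := fun h0 => by
      have := Nat.le_of_dvd two_pos ((ZMod.natCast_eq_zero_iff 2 p).1 (by simpa using h0))
      lia
    simp [zeroSumIndicator_empty, Nat.choose_eq_zero_of_lt hp.out.pos] at h1
    exact h2 h1
  · intro T hT hne
    by_contra h0
    obtain ⟨hz, hb⟩ := mul_ne_zero_iff.1 h0
    obtain ⟨hx, hy, c, hc⟩ := of_zeroSumIndicator_ne_zero hz
    have hTs := hT.trans hs's
    have hlt := card_le_card hT
    have hpos := hne.card_pos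
    have hc4 : c < 4 := by
      by_contra! h
      have := Nat.mul_le_mul_left p h
      lia
    interval_cases c
    · lia
    · exact h T hTs (by lia) hx hy
    · apply hb
      have hch : ((2 * p).choose p : ZMod p) = 2 := by
        have := Choose.choose_modEq_choose_mod_mul_choose_div_nat (n := 2 * p) (k := p) (p := p)
        rw [← ZMod.natCast_eq_natCast_iff] at this
        simpa [Nat.mul_div_cancel _ hp.out.pos, Nat.div_self hp.out.pos] using this
      simp [hc, mul_comm p 2, hch]
    · obtain ⟨T', hT', h3, h4, h5⟩ :=
        exists_zeroSum_card_eq_of_card_eq_three_mul (s := T) (by lia) hx hy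
      exact h T' (hT'.trans hTs) h3 h4 h5

end ZeroSumPlane

section ShiftGain

variable {G : Type*} [AddCommGroup G] [DecidableEq G]

/-- The number of elements of `Y` that leave `Y` under translation by `x`. -/
def shiftGain (Y : Finset G) (x : G) : ℕ := #{y ∈ Y | y + x ∉ Y}

lemma shiftGain_add_overlap (Y : Finset G) (x : G) :
    #{y ∈ Y | y + x ∈ Y} + shiftGain Y x = #Y :=
  card_filter_add_card_filter_not _

lemma card_union_image_add (Y : Finset G) (x : G) :
    #(Y ∪ Y.image (· + x)) = #Y + shiftGain Y x := by
  have h : Y ∪ Y.image (· + x) = Y ∪ {y ∈ Y | y + x ∉ Y}.image (· + x) := by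
    ext z
    simp only [mem_union, mem_image, mem_filter]
    grind
  rw [h, card_union_of_disjoint, card_image_of_injective _ (add_left_injective x), shiftGain]
  rw [disjoint_left]
  grind

lemma shiftGain_zero (Y : Finset G) : shiftGain Y 0 = 0 := by
  simp [shiftGain]

lemma shiftGain_add_le (Y : Finset G) (x x' : G) :
    shiftGain Y (x + x') ≤ shiftGain Y x + shiftGain Y x' := by
  have h : {y ∈ Y | y + (x + x') ∉ Y} ⊆
      {y ∈ Y | y + x ∉ Y} ∪ {y ∈ Y | y + x' ∉ Y}.image (· - x) := by
    intro y hy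
    simp only [mem_union, mem_image, mem_filter] at hy ⊢
    by_cases h : y + x ∈ Y
    · exact Or.inr ⟨y + x, ⟨h, by rw [add_assoc]; exact hy.2⟩, by simp⟩
    · exact Or.inl ⟨hy.1, h⟩
  exact (card_le_card h).trans ((card_union_le _ _).trans (add_le_add_right card_image_le _))

lemma shiftGain_nsmul_le (Y : Finset G) (x : G) (n : ℕ) :
    shiftGain Y (n • x) ≤ n * shiftGain Y x := by
  induction n with
  | zero => simp [shiftGain_zero]
  | succ n ih => grind [succ_nsmul, shiftGain_add_le Y (n • x) x]

lemma shiftGain_sum_le {κ : Type*} (Y : Finset G) (K : Finset κ) (x : κ → G) :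
    shiftGain Y (∑ k ∈ K, x k) ≤ ∑ k ∈ K, shiftGain Y (x k) := by
  classical
  induction K using Finset.induction_on with
  | empty => simp [shiftGain_zero]
  | insert k K hk ih =>
    rw [sum_insert hk, sum_insert hk]
    exact (shiftGain_add_le _ _ _).trans (by lia)

lemma sum_overlap_le {κ : Type*} (Y : Finset G) (K : Finset κ) {g : κ → G}
    (hg : Set.InjOn g K) : ∑ k ∈ K, #{y ∈ Y | y + g k ∈ Y} ≤ #Y * #Y := by
  simp only [card_filter]
  rw [sum_comm, ← smul_eq_mul, ← sum_const]
  refine sum_le_sum fun y _ => ?_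
  rw [← card_filter]
  refine card_le_card_of_injOn (fun k => y + g k) (fun k hk => (mem_filter.1 hk).2) ?_
  intro k hk k' hk' h
  exact hg (mem_filter.1 hk).1 (mem_filter.1 hk').1 (add_left_cancel h)

end ShiftGain

section Box

variable {p : ℕ} [hp : Fact p.Prime]

lemma injOn_box_sum {V : Type*} [AddCommGroup V] [Module (ZMod p) V] {d L : ℕ} (hL : L ≤ p)
    {w : Fin d → V} (hw : LinearIndependent (ZMod p) w) :
    Set.InjOn (fun a : Fin d → ℕ => ∑ k, a k • w k)
      (Fintype.piFinset fun _ : Fin d => range L) := by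
  intro a ha b hb hab
  simp only [Fintype.coe_piFinset, coe_range, Set.mem_pi, Set.mem_univ, Set.mem_Iio,
    true_imp_iff] at ha hb
  simp only [← Nat.cast_smul_eq_nsmul (ZMod p)] at hab
  funext k
  have := congrFun (hw.fintypeLinearCombination_injective
    (a₁ := fun k => (a k : ZMod p)) (a₂ := fun k => (b k : ZMod p)) hab) k
  rw [ZMod.natCast_eq_natCast_iff'] at this
  rwa [Nat.mod_eq_of_lt ((ha k).trans_le hL), Nat.mod_eq_of_lt ((hb k).trans_le hL)] at this

/-- Isoperimetry along a basis: translation by some basis vector enlarges a set of size `y`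
by about `y ^ (2 / 3)`. -/
lemma exists_card_le_shiftGain_of_linearIndependent {V : Type*} [AddCommGroup V] [DecidableEq V]
    [Module (ZMod p) V] {L : ℕ} (hL : L ≤ p) {w : Fin 3 → V}
    (hw : LinearIndependent (ZMod p) w) {Y : Finset V} (hY : 2 * #Y ≤ L ^ 3) :
    ∃ k, #Y ≤ 6 * L * shiftGain Y (w k) := by
  by_contra! h
  have hYpos : 0 < #Y := by have := h 0; lia
  have hLpos : 0 < L := by
    by_contra! h0
    obtain rfl : L = 0 := by lia
    simp at hY
    simp [hY] at hYpos
  have hsum := sum_overlap_le Y _ (injOn_box_sum hL hw)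
  set B := Fintype.piFinset fun _ : Fin 3 => range L with hB
  have hBcard : #B = L ^ 3 := by simp [hB]
  have hgain (a : Fin 3 → ℕ) (ha : a ∈ B) : 2 * shiftGain Y (∑ k, a k • w k) < #Y := by
    have h1 : shiftGain Y (∑ k, a k • w k) ≤ ∑ k, a k * shiftGain Y (w k) :=
      (shiftGain_sum_le _ _ _).trans (sum_le_sum fun k _ => shiftGain_nsmul_le _ _ _)
    have h2 (k : Fin 3) : 6 * L * (a k * shiftGain Y (w k)) ≤ (L - 1) * #Y := by
      have hk : a k ≤ L - 1 := by
        have := Fintype.mem_piFinset.1 ha k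
        simp at this
        lia
      calc 6 * L * (a k * shiftGain Y (w k)) = a k * (6 * L * shiftGain Y (w k)) := by ring
        _ ≤ (L - 1) * #Y := Nat.mul_le_mul hk (h k).le
    have h3 : 6 * L * shiftGain Y (∑ k, a k • w k) ≤ 3 * ((L - 1) * #Y) := by
      refine (Nat.mul_le_mul_left _ h1).trans ?_
      rw [mul_sum]
      exact (sum_le_sum fun k _ => h2 k).trans (by simp)
    have h4 : (L - 1) * #Y < L * #Y := Nat.mul_lt_mul_of_pos_right (by lia) hYpos
    by_contra! h5
    have := Nat.mul_le_mul_left (3 * L) h5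
    nlinarith
  have hlt : ∑ a ∈ B, 2 * shiftGain Y (∑ k, a k • w k) < ∑ _a ∈ B, #Y :=
    sum_lt_sum_of_nonempty (card_pos.1 (by rw [hBcard]; positivity)) hgain
  have htot : ∑ a ∈ B, (#{y ∈ Y | y + ∑ k, a k • w k ∈ Y} + shiftGain Y (∑ k, a k • w k)) =
      ∑ _a ∈ B, #Y := sum_congr rfl fun a _ => shiftGain_add_overlap _ _
  rw [sum_add_distrib] at htot
  rw [← mul_sum] at hlt
  simp only [sum_const, hBcard, smul_eq_mul] at hlt htot
  nlinarith

end Box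

section Plane

variable {p : ℕ} [hp : Fact p.Prime] {ι : Type*}

/-- A sequence in `C_p ^ 3` without short zero-sum subsequences has few elements on each plane. -/
lemma card_plane_lt [Finite ι] (hp2 : p ≠ 2) {s : Finset ι} {v : ι → Fin 3 → ZMod p}
    (hfree : ∀ t ⊆ s, t.Nonempty → #t ≤ p → ∑ i ∈ t, v i ≠ 0) {a : Fin 3 → ZMod p} (ha : a ≠ 0)
    (c : ZMod p) : #{i ∈ s | a ⬝ᵥ v i = c} < 4 * p - 2 := by
  classical
  by_contra! h
  obtain ⟨k, hk⟩ := Function.ne_iff.1 ha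
  obtain ⟨T, hT, hcard, h1, h2⟩ :=
    exists_zeroSum_card_eq hp2 (fun i => v i (k + 1)) (fun i => v i (k + 2)) h
  refine hfree T (hT.trans (filter_subset _ _)) (card_pos.1 (hcard ▸ hp.out.pos)) hcard.le ?_
  have h3 : a ⬝ᵥ ∑ i ∈ T, v i = 0 := by
    rw [dotProduct_sum, sum_congr rfl fun i hi => (mem_filter.1 (hT hi)).2]
    simp [hcard]
  rw [← Finset.sum_apply] at h1 h2
  generalize ∑ i ∈ T, v i = S at *
  simp only [Pi.zero_apply] at hk
  have h4 : a k * S k = 0 := by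
    rw [dotProduct, Fin.sum_univ_three] at h3
    fin_cases k <;> simp_all
  have h5 : S k = 0 := by simpa [hk] using h4
  funext j
  fin_cases k <;> fin_cases j <;> simp_all

/-- A sequence in `C_p ^ 3` with few elements on each plane contains a basis. -/
lemma exists_linearIndependent_of_card_plane_lt {s : Finset ι} {v : ι → Fin 3 → ZMod p}
    (h : ∀ a : Fin 3 → ZMod p, a ≠ 0 → #{i ∈ s | a ⬝ᵥ v i = 0} < #s) :
    ∃ f : Fin 3 → ι, (∀ k, f k ∈ s) ∧ LinearIndependent (ZMod p) fun k => v (f k) := by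
  have htop : Submodule.span (ZMod p) (v '' s) = ⊤ := by
    by_contra hne
    obtain ⟨φ, hφ, hle⟩ := Submodule.exists_le_ker_of_lt_top _ (lt_top_iff_ne_top.2 hne)
    obtain ⟨a, rfl⟩ := (dotProductEquiv (ZMod p) (Fin 3)).surjective φ
    have ha : a ≠ 0 := by rintro rfl; simp at hφ
    refine (h a ha).ne (congrArg card (filter_true_of_mem fun i hi => ?_))
    simpa using hle (Submodule.subset_span ⟨i, hi, rfl⟩)
  obtain ⟨g, hg, -, hli⟩ := Submodule.exists_fun_fin_finrank_span_eq (ZMod p) (v '' (s : Set ι))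
  have hrank : Module.finrank (ZMod p) (Submodule.span (ZMod p) (v '' (s : Set ι))) = 3 := by
    rw [htop, finrank_top, Module.finrank_fin_fun]
  choose f hf hfg using hg
  refine ⟨fun k => f (Fin.cast hrank.symm k), fun k => hf _, ?_⟩
  simp only [hfg]
  exact hli.comp _ (Fin.cast_injective _)

end Plane

section Fourier

variable {p : ℕ} [hp : Fact p.Prime]

lemma sum_stdAddChar_dotProduct {d : ℕ} (x : Fin d → ZMod p) :
    ∑ a : Fin d → ZMod p, ZMod.stdAddChar (a ⬝ᵥ x) = if x = 0 then (p : ℂ) ^ d else 0 := by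
  classical
  let ψ : AddChar (Fin d → ZMod p) ℂ := ZMod.stdAddChar.compAddMonoidHom
    (AddMonoidHom.mk' (fun a => a ⬝ᵥ x) fun a b => add_dotProduct a b x)
  have hψ : ψ = 0 ↔ x = 0 := by
    constructor
    · intro h
      by_contra hx
      obtain ⟨k, hk⟩ := Function.ne_iff.1 hx
      have h1 : (ZMod.stdAddChar (Pi.single k 1 ⬝ᵥ x) : ℂ) = 1 := DFunLike.congr_fun h _
      rw [single_dotProduct, one_mul, ← AddChar.map_zero_eq_one (ZMod.stdAddChar (N := p))] at h1
      exact hk (ZMod.injective_stdAddChar h1)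
    · rintro rfl
      ext a
      simp [ψ]
  have h := AddChar.sum_eq_ite ψ
  simp only [hψ] at h
  refine h.trans ?_
  simp

/-- The Fourier transform of the indicator of a finite set. -/
noncomputable def fourierSum {d : ℕ} (Y : Finset (Fin d → ZMod p)) (a : Fin d → ZMod p) : ℂ :=
  ∑ y ∈ Y, ZMod.stdAddChar (a ⬝ᵥ y)

lemma sum_normSq_fourierSum_mul {d : ℕ} (Y : Finset (Fin d → ZMod p)) (x : Fin d → ZMod p) :
    ∑ a, (Complex.normSq (fourierSum Y a) : ℂ) * ZMod.stdAddChar (a ⬝ᵥ x) =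
      (p : ℂ) ^ d * #{y ∈ Y | y + x ∈ Y} := by
  have h1 (a : Fin d → ZMod p) :
      (Complex.normSq (fourierSum Y a) : ℂ) * ZMod.stdAddChar (a ⬝ᵥ x) =
        ∑ y ∈ Y, ∑ z ∈ Y, ZMod.stdAddChar (a ⬝ᵥ (y + x - z)) := by
    rw [← Complex.mul_conj, fourierSum, map_sum, sum_mul_sum, sum_mul]
    refine sum_congr rfl fun y _ => ?_
    rw [sum_mul]
    refine sum_congr rfl fun z _ => ?_
    rw [← AddChar.map_neg_eq_conj, dotProduct_sub, dotProduct_add, sub_eq_add_neg,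
      AddChar.map_add_eq_mul, AddChar.map_add_eq_mul]
    ring
  simp only [h1]
  rw [sum_comm, card_filter, Nat.cast_sum, mul_sum]
  refine sum_congr rfl fun y _ => ?_
  rw [sum_comm]
  simp only [sum_stdAddChar_dotProduct, sub_eq_zero]
  simp

lemma re_sum_overlap_le {d : ℕ} {κ : Type*} (Y : Finset (Fin d → ZMod p)) (K : Finset κ)
    (x : κ → Fin d → ZMod p) {θ : ℝ}
    (hθ : ∀ a ≠ 0, (∑ k ∈ K, ZMod.stdAddChar (a ⬝ᵥ x k)).re ≤ θ * #K) :
    (p : ℝ) ^ d * ∑ k ∈ K, (#{y ∈ Y | y + x k ∈ Y} : ℝ) ≤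
      #K * ((#Y : ℝ) ^ 2 + θ * ((p : ℝ) ^ d * #Y - (#Y : ℝ) ^ 2)) := by
  classical
  have h1 : (p : ℝ) ^ d * ∑ k ∈ K, (#{y ∈ Y | y + x k ∈ Y} : ℝ) =
      ∑ a, Complex.normSq (fourierSum Y a) * (∑ k ∈ K, ZMod.stdAddChar (a ⬝ᵥ x k)).re := by
    have : ((p : ℂ) ^ d * ∑ k ∈ K, (#{y ∈ Y | y + x k ∈ Y} : ℂ)) =
        ∑ a, (Complex.normSq (fourierSum Y a) : ℂ) * ∑ k ∈ K, ZMod.stdAddChar (a ⬝ᵥ x k) := by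
      simp only [mul_sum, ← sum_normSq_fourierSum_mul]
      rw [sum_comm]
    have := congrArg Complex.re this
    rw [Complex.re_sum] at this
    simp only [Complex.re_ofReal_mul] at this
    rw [← this]
    norm_cast
  have h2 : ∑ a, Complex.normSq (fourierSum Y a) = (p : ℝ) ^ d * #Y := by
    have := sum_normSq_fourierSum_mul Y 0
    simp only [dotProduct_zero, AddChar.map_zero_eq_one, mul_one, add_zero, filter_mem_eq_inter,
      inter_self] at this
    exact_mod_cast this
  have h3 : fourierSum Y 0 = #Y := by simp [fourierSum]
  rw [← add_sum_erase _ _ (mem_univ (0 : Fin d → ZMod p)), h3, Complex.normSq_natCast] at h1 h2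
  have h4 : ∑ a ∈ univ.erase 0, Complex.normSq (fourierSum Y a) *
        (∑ k ∈ K, ZMod.stdAddChar (a ⬝ᵥ x k)).re ≤
      ∑ a ∈ univ.erase 0, Complex.normSq (fourierSum Y a) * (θ * #K) :=
    sum_le_sum fun a ha =>
      mul_le_mul_of_nonneg_left (hθ a (ne_of_mem_erase ha)) (Complex.normSq_nonneg _)
  rw [← sum_mul, eq_sub_of_add_eq' h2] at h4
  rw [h1]
  simp only [zero_dotProduct, AddChar.map_zero_eq_one, sum_const, nsmul_eq_mul, mul_one,
    Complex.natCast_re] at h4 ⊢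
  linarith

lemma le_norm_stdAddChar_sub_one (k : ZMod p) :
    4 * (k.valMinAbs.natAbs : ℝ) / p ≤ ‖(ZMod.stdAddChar k : ℂ) - 1‖ := by
  have hp0 : (0 : ℝ) < p := by exact_mod_cast hp.out.pos
  set m := k.valMinAbs with hm
  have hk : k = (m : ZMod p) := (ZMod.coe_valMinAbs k).symm
  have hmp : (m.natAbs : ℝ) ≤ p / 2 := by
    rw [le_div_iff₀ two_pos]
    have := ZMod.natAbs_valMinAbs_le k
    exact_mod_cast (show m.natAbs * 2 ≤ p by lia)
  rw [hk, ZMod.stdAddChar_coe]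
  have h1 : (2 * Real.pi * Complex.I * m / p : ℂ) = Complex.I * ((2 * Real.pi * m / p : ℝ) : ℂ) := by
    push_cast
    ring
  rw [h1, Complex.norm_exp_I_mul_ofReal_sub_one, norm_mul, Real.norm_eq_abs, Real.norm_eq_abs,
    abs_two]
  have habs : (m.natAbs : ℝ) = |(m : ℝ)| := by
    rw [← Int.cast_abs, Int.abs_eq_natAbs, Int.cast_natCast]
  have h2 : |Real.sin (2 * Real.pi * m / p / 2)| = |Real.sin (Real.pi * m.natAbs / p)| := by
    rw [show 2 * Real.pi * m / p / 2 = Real.pi * m / p by ring, habs]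
    rcases abs_cases (m : ℝ) with ⟨h, -⟩ | ⟨h, -⟩ <;> rw [h]
    rw [mul_neg, neg_div, Real.sin_neg, abs_neg]
  rw [h2]
  have h3 : Real.pi * m.natAbs / p ≤ Real.pi / 2 := by
    rw [div_le_iff₀ hp0]
    nlinarith [Real.pi_pos]
  have h4 := Real.mul_le_sin (by positivity) h3
  have h5 : 2 / Real.pi * (Real.pi * m.natAbs / p) = 2 * m.natAbs / p := by
    field_simp
  have h6 := le_abs_self (Real.sin (Real.pi * m.natAbs / p))
  rw [h5] at h4
  calc 4 * (m.natAbs : ℝ) / p = 2 * (2 * m.natAbs / p) := by ring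
    _ ≤ _ := by linarith

lemma norm_sum_stdAddChar_pow_le {k : ZMod p} {J : ℕ}
    (hk : p ≤ k.valMinAbs.natAbs * J) :
    ‖∑ j ∈ range J, (ZMod.stdAddChar k : ℂ) ^ j‖ ≤ J / 2 := by
  have hp0 : (0 : ℝ) < p := by exact_mod_cast hp.out.pos
  have hk' : (p : ℝ) ≤ k.valMinAbs.natAbs * J := by exact_mod_cast hk
  have h1 := le_norm_stdAddChar_sub_one k
  set z : ℂ := ZMod.stdAddChar k
  have hz : ‖z‖ = 1 := AddChar.norm_apply _ _
  have h2 : ‖∑ j ∈ range J, z ^ j‖ * ‖z - 1‖ ≤ 2 := by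
    rw [← norm_mul, geom_sum_mul]
    refine (norm_sub_le _ _).trans ?_
    rw [norm_pow, hz, one_pow, norm_one]
    norm_num
  rw [div_le_iff₀ hp0] at h1
  have h3 : 4 * (p : ℝ) ≤ ‖z - 1‖ * p * J := by nlinarith [Nat.cast_nonneg (α := ℝ) J]
  have h4 : 4 ≤ ‖z - 1‖ * J := by
    by_contra! h
    nlinarith
  have h5 : 0 < ‖z - 1‖ := by
    by_contra! h
    nlinarith [norm_nonneg (z - 1)]
  by_contra! h
  nlinarith

end Fourier

section Expansion

variable {p : ℕ} [hp : Fact p.Prime] {ι : Type*}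

/-- If few `v i` lie on each hyperplane, then translation by some `v i` enlarges any set of at
most half of the elements by a factor `1 + 1 / (8 J)`. -/
lemma exists_card_le_shiftGain_of_card_plane_le {d : ℕ} {s : Finset ι} {v : ι → Fin d → ZMod p}
    {q M J : ℕ} (hplane : ∀ a : Fin d → ZMod p, a ≠ 0 → ∀ c, #{i ∈ s | a ⬝ᵥ v i = c} ≤ q)
    (hs : 2 * ((2 * M + 1) * q) ≤ #s) (hs0 : 0 < #s) (hJ : 0 < J) (hM : p ≤ (M + 1) * J)
    {Y : Finset (Fin d → ZMod p)} (hY : 2 * #Y ≤ p ^ d) :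
    ∃ i ∈ s, #Y ≤ 8 * J * shiftGain Y (v i) := by
  classical
  by_contra! h
  have hchar (a : Fin d → ZMod p) (ha : a ≠ 0) :
      (∑ k ∈ s ×ˢ range J, ZMod.stdAddChar (a ⬝ᵥ (k.2 • v k.1))).re ≤
        3 / 4 * #(s ×ˢ range J) := by
    have hbad : #{i ∈ s | (a ⬝ᵥ v i).valMinAbs.natAbs ≤ M} ≤ q * (2 * M + 1) := by
      refine (card_le_mul_card_image_of_maps_to (f := fun i => a ⬝ᵥ v i)
        (t := (Icc (-M : ℤ) M).image (Int.cast : ℤ → ZMod p)) ?_ q ?_).trans ?_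
      · intro i hi
        have := (mem_filter.1 hi).2
        exact mem_image.2 ⟨(a ⬝ᵥ v i).valMinAbs, mem_Icc.2 (by lia), ZMod.coe_valMinAbs _⟩
      · intro c _
        exact (card_le_card (filter_subset_filter _ (filter_subset _ _))).trans (hplane a ha c)
      · refine Nat.mul_le_mul_left _ (card_image_le.trans ?_)
        rw [Int.card_Icc]
        lia
    have hterm (i : ι) : ‖∑ j ∈ range J, (ZMod.stdAddChar (a ⬝ᵥ (j • v i)) : ℂ)‖ ≤
        J / 2 + if (a ⬝ᵥ v i).valMinAbs.natAbs ≤ M then (J / 2 : ℝ) else 0 := by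
      simp only [dotProduct_smul, AddChar.map_nsmul_eq_pow]
      split_ifs with hi
      · refine (norm_sum_le _ _).trans ?_
        simp [AddChar.norm_apply]
      · rw [add_zero]
        exact norm_sum_stdAddChar_pow_le (hM.trans (Nat.mul_le_mul_right _ (by lia)))
    rw [sum_product]
    refine (Complex.re_le_norm _).trans ((norm_sum_le _ _).trans
      ((sum_le_sum fun i _ => hterm i).trans ?_))
    rw [sum_add_distrib, ← sum_filter, sum_const, sum_const, card_product, card_range]
    have h1 : (4 : ℝ) * #{i ∈ s | (a ⬝ᵥ v i).valMinAbs.natAbs ≤ M} ≤ 2 * #s := by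
      exact_mod_cast (show 4 * #{i ∈ s | (a ⬝ᵥ v i).valMinAbs.natAbs ≤ M} ≤ 2 * #s by lia)
    have h2 : (0 : ℝ) < J := by exact_mod_cast hJ
    simp only [nsmul_eq_mul]
    push_cast
    nlinarith
  have hover := re_sum_overlap_le Y (s ×ˢ range J) (fun k => k.2 • v k.1) hchar
  have hK : 0 < #(s ×ˢ range J) := by
    rw [card_product, card_range]
    exact Nat.mul_pos hs0 hJ
  have hlt : ∑ k ∈ s ×ˢ range J, 8 * shiftGain Y (k.2 • v k.1) < ∑ _k ∈ s ×ˢ range J, #Y := by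
    refine sum_lt_sum_of_nonempty (card_pos.1 hK) fun k hk => ?_
    obtain ⟨h1, h2⟩ := mem_product.1 hk
    have h3 := shiftGain_nsmul_le Y (v k.1) k.2
    have h4 := Nat.mul_le_mul_right (shiftGain Y (v k.1)) (mem_range.1 h2).le
    have := h k.1 h1
    rw [mul_assoc] at this
    lia
  have htot : ∑ k ∈ s ×ˢ range J, (#{y ∈ Y | y + k.2 • v k.1 ∈ Y} + shiftGain Y (k.2 • v k.1)) =
      ∑ _k ∈ s ×ˢ range J, #Y := sum_congr rfl fun k _ => shiftGain_add_overlap _ _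
  rw [sum_add_distrib] at htot
  rw [← mul_sum] at hlt
  simp only [sum_const, smul_eq_mul] at hlt htot
  rw [← Nat.cast_sum] at hover
  set O := ∑ k ∈ s ×ˢ range J, #{y ∈ Y | y + k.2 • v k.1 ∈ Y}
  set N := #(s ×ˢ range J)
  have h1 : (7 : ℝ) * (N * #Y) < 8 * O := by
    exact_mod_cast (show 7 * (N * #Y) < 8 * O by lia)
  have h2 : (2 : ℝ) * #Y ≤ (p : ℝ) ^ d := by exact_mod_cast hY
  have h3 : (0 : ℝ) < (p : ℝ) ^ d := pow_pos (by exact_mod_cast hp.out.pos) _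
  have h4 : (0 : ℝ) ≤ N * #Y := by positivity
  nlinarith [mul_le_mul_of_nonneg_left h2 h4, mul_lt_mul_of_pos_left h1 h3]

end Expansion

section Growth

variable {ι V : Type*} [AddCommGroup V] {v : ι → V} {A : Finset ι} {N : ℕ}

/-- Some `m` indices from `A` have at least `y`, or more than `N / 2`, distinct subset sums. -/
def SubsetSumsReach (v : ι → V) (A : Finset ι) (N m : ℕ) (y : ℝ) : Prop :=
  ∃ t ⊆ A, #t ≤ m ∧ ∃ Y : Finset V, (∀ z ∈ Y, ∃ u ⊆ t, ∑ i ∈ u, v i = z) ∧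
    (y ≤ #Y ∨ N < 2 * #Y)

variable [DecidableEq ι] [DecidableEq V]

lemma SubsetSumsReach.succ {m : ℕ} {y y' : ℝ} (h : SubsetSumsReach v A N m y)
    (hstep : ∀ t ⊆ A, #t ≤ m → ∀ Y : Finset V, 2 * #Y ≤ N → y ≤ #Y →
      y' ≤ #Y ∨ ∃ i ∈ A \ t, y' ≤ #Y + shiftGain Y (v i)) :
    SubsetSumsReach v A N (m + 1) y' := by
  obtain ⟨t, htA, htm, Y, hYt, hY⟩ := h
  by_cases hN : N < 2 * #Y
  · exact ⟨t, htA, by lia, Y, hYt, Or.inr hN⟩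
  obtain h | ⟨i, hi, h⟩ := hstep t htA htm Y (by lia) (hY.resolve_right hN)
  · exact ⟨t, htA, by lia, Y, hYt, Or.inl h⟩
  rw [mem_sdiff] at hi
  refine ⟨insert i t, insert_subset hi.1 htA, (card_insert_le _ _).trans (by lia),
    Y ∪ Y.image (· + v i), ?_, Or.inl ?_⟩
  · intro z hz
    obtain hz | hz := mem_union.1 hz
    · obtain ⟨u, hu, rfl⟩ := hYt z hz
      exact ⟨u, hu.trans (subset_insert _ _), rfl⟩
    · obtain ⟨x, hx, rfl⟩ := mem_image.1 hz
      obtain ⟨u, hu, rfl⟩ := hYt x hx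
      refine ⟨insert i u, insert_subset_insert _ hu, ?_⟩
      rw [sum_insert fun h => hi.2 (hu h), add_comm]
  · rw [card_union_image_add]
    exact_mod_cast h

lemma SubsetSumsReach.double {q J : ℕ} (hJ : 0 < J)
    (hexp : ∀ t ⊆ A, #t ≤ q → ∀ Y : Finset V, 2 * #Y ≤ N →
      ∃ i ∈ A \ t, #Y ≤ J * shiftGain Y (v i))
    {m : ℕ} {y : ℝ} (hy : 0 ≤ y) (h : SubsetSumsReach v A N m y) (hm : m + J ≤ q) :
    SubsetSumsReach v A N (m + J) (2 * y) := by
  have hJ' : (0 : ℝ) < J := by exact_mod_cast hJ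
  have key (k : ℕ) (hk : k ≤ J) : SubsetSumsReach v A N (m + k) (y + k * (y / J)) := by
    induction k with
    | zero => simpa using h
    | succ k ih =>
      refine (ih (by lia)).succ fun t htA htm Y hYN hyY => Or.inr ?_
      obtain ⟨i, hi, hgain⟩ := hexp t htA (by lia) Y hYN
      refine ⟨i, hi, ?_⟩
      have h1 : (#Y : ℝ) ≤ J * shiftGain Y (v i) := by exact_mod_cast hgain
      have h2 : y / J ≤ shiftGain Y (v i) := by
        rw [div_le_iff₀ hJ']
        have : 0 ≤ (k : ℝ) * (y / J) := by positivity
        linarith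
      push_cast
      linarith
  convert key J le_rfl using 1
  field_simp
  ring

lemma SubsetSumsReach.two_pow {q J : ℕ} (hJ : 0 < J)
    (hexp : ∀ t ⊆ A, #t ≤ q → ∀ Y : Finset V, 2 * #Y ≤ N →
      ∃ i ∈ A \ t, #Y ≤ J * shiftGain Y (v i))
    {m : ℕ} {y : ℝ} (hy : 0 ≤ y) (h : SubsetSumsReach v A N m y) (k : ℕ)
    (hm : m + k * J ≤ q) : SubsetSumsReach v A N (m + k * J) (2 ^ k * y) := by
  induction k with
  | zero => simpa using h
  | succ k ih =>
    have := (ih (by lia)).double hJ hexp (by positivity) (by lia)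
    convert this using 1 <;> ring

lemma subsetSumsReach_cube {q P : ℕ}
    (hbox : ∀ t ⊆ A, #t ≤ q → ∀ Y : Finset V, ∀ L ≤ P, 2 * #Y ≤ L ^ 3 →
      ∃ i ∈ A \ t, #Y ≤ 6 * L * shiftGain Y (v i)) (m : ℕ) (hm : m ≤ q)
    (hP : (12 / 5 : ℝ) * (1 + m / 50) ≤ P) :
    SubsetSumsReach v A N m ((1 + m / 50 : ℝ) ^ 3) := by
  induction m with
  | zero => exact ⟨∅, by simp, by simp, {0}, fun z hz => ⟨∅, by simp, by simp_all⟩, by simp⟩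
  | succ m ih =>
    push_cast at hP
    refine (ih (by lia) (by linarith)).succ fun t htA htm Y hYN hyY => ?_
    have hs : (1 : ℝ) ≤ 1 + m / 50 := by
      have : (0 : ℝ) ≤ m / 50 := by positivity
      linarith
    have hsucc : (1 + ((m + 1 : ℕ) : ℝ) / 50) = 1 + m / 50 + 1 / 50 := by
      push_cast
      ring
    rw [hsucc]
    replace hP : (12 / 5 : ℝ) * (1 + m / 50) ≤ P := by linarith
    generalize (1 + m / 50 : ℝ) = x at *
    rw [or_iff_not_imp_left, not_le]
    intro hlt
    set L := ⌊7 / 5 * x⌋₊ + 1 with hL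
    have hL1 : 7 / 5 * x < L := by
      rw [hL]
      push_cast
      exact Nat.lt_floor_add_one _
    have hL2 : (L : ℝ) ≤ 12 / 5 * x := by
      have := Nat.floor_le (show 0 ≤ 7 / 5 * x by linarith)
      rw [hL]
      push_cast
      linarith
    have hLP : L ≤ P := by exact_mod_cast hL2.trans hP
    have hYL : 2 * #Y ≤ L ^ 3 := by
      have h1 : (7 / 5 * x) ^ 3 ≤ (L : ℝ) ^ 3 := by gcongr
      have h2 : (x + 1 / 50) ^ 3 ≤ (51 / 50 * x) ^ 3 := by gcongr; linarith
      have h3 : (0 : ℝ) < x ^ 3 := by positivity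
      have : (2 : ℝ) * #Y ≤ (L : ℝ) ^ 3 := by nlinarith
      exact_mod_cast this
    obtain ⟨i, hi, hgain⟩ := hbox t htA (by lia) Y L hLP hYL
    refine ⟨i, hi, ?_⟩
    have h1 : (#Y : ℝ) ≤ 6 * L * shiftGain Y (v i) := by exact_mod_cast hgain
    have h2 : x ^ 2 ≤ 72 / 5 * shiftGain Y (v i) := by
      have h3 : 6 * (L : ℝ) * shiftGain Y (v i) ≤ 6 * (12 / 5 * x) * shiftGain Y (v i) := by gcongr
      have h4 : x * x ^ 2 ≤ x * (72 / 5 * shiftGain Y (v i)) := by nlinarith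
      exact le_of_mul_le_mul_left h4 (by linarith)
    nlinarith

end Growth

section Prime

variable {p : ℕ} [hp : Fact p.Prime] {ι : Type*} [DecidableEq ι]

/-- If few `v i` lie on each plane, then fewer than `p / 2` of them have subset sums covering
more than half of `C_p ^ 3`. -/
lemma exists_subsetSums_gt_half (hp5 : 5092 ≤ p) {A : Finset ι} {v : ι → Fin 3 → ZMod p}
    (hplane : ∀ a : Fin 3 → ZMod p, a ≠ 0 → ∀ c, #{i ∈ A | a ⬝ᵥ v i = c} ≤ 4 * p)
    (hA : 20000 * p ≤ #A) :
    ∃ t ⊆ A, 2 * #t + 2 ≤ p ∧ ∃ Y : Finset (Fin 3 → ZMod p),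
      (∀ z ∈ Y, ∃ u ⊆ t, ∑ i ∈ u, v i = z) ∧ p ^ 3 < 2 * #Y := by
  have hcard {t : Finset ι} (htA : t ⊆ A) (ht : #t ≤ p) : 19999 * p ≤ #(A \ t) := by
    rw [card_sdiff_of_subset htA]
    lia
  have hplane' (t : Finset ι) (a : Fin 3 → ZMod p) (ha : a ≠ 0) (c : ZMod p) :
      #{i ∈ A \ t | a ⬝ᵥ v i = c} ≤ 4 * p :=
    (card_le_card (filter_subset_filter _ sdiff_subset)).trans (hplane a ha c)
  have hbox : ∀ t ⊆ A, #t ≤ p → ∀ Y : Finset (Fin 3 → ZMod p), ∀ L ≤ p, 2 * #Y ≤ L ^ 3 →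
      ∃ i ∈ A \ t, #Y ≤ 6 * L * shiftGain Y (v i) := by
    intro t htA ht Y L hL hY
    obtain ⟨f, hf, hli⟩ := exists_linearIndependent_of_card_plane_lt (s := A \ t) (v := v)
      fun a ha => (hplane' t a ha 0).trans_lt (by have := hcard htA ht; lia)
    obtain ⟨k, hk⟩ := exists_card_le_shiftGain_of_linearIndependent hL hli hY
    exact ⟨f k, hf k, hk⟩
  set J := p / 800 with hJ
  have hexp : ∀ t ⊆ A, #t ≤ p → ∀ Y : Finset (Fin 3 → ZMod p), 2 * #Y ≤ p ^ 3 →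
      ∃ i ∈ A \ t, #Y ≤ 8 * J * shiftGain Y (v i) := by
    intro t htA ht Y hY
    have := hcard htA ht
    exact exists_card_le_shiftGain_of_card_plane_le (M := 933) (hplane' t) (by lia) (by lia)
      (by lia) (by lia) hY
  have hp5' : (5092 : ℝ) ≤ p := by exact_mod_cast hp5
  have hm1 : ((p / 5 : ℕ) : ℝ) ≤ p / 5 := Nat.cast_div_le
  have hm2 : (p : ℝ) / 5 - 1 ≤ (p / 5 : ℕ) := by
    have : (p : ℝ) ≤ 5 * (p / 5 : ℕ) + 4 := by exact_mod_cast (show p ≤ 5 * (p / 5) + 4 by lia)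
    linarith
  have h1 : SubsetSumsReach v A (p ^ 3) (p / 5) ((1 + (p / 5 : ℕ) / 50 : ℝ) ^ 3) :=
    subsetSumsReach_cube hbox (p / 5) (by lia) (by linarith)
  have h2 := h1.two_pow (by lia) hexp (by positivity) 23 (by lia)
  obtain ⟨t, htA, ht, Y, hYt, hY⟩ := h2
  refine ⟨t, htA, by lia, Y, hYt, ?_⟩
  refine hY.elim (fun h => ?_) id
  have h3 : ((p : ℝ) / 250) ^ 3 ≤ (1 + (p / 5 : ℕ) / 50 : ℝ) ^ 3 := by
    gcongr
    linarith
  have h4 : (0 : ℝ) < (p : ℝ) ^ 3 := by positivity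
  have h5 : (p : ℝ) ^ 3 < 2 * #Y := by
    rw [div_pow] at h3
    norm_num at h h3
    linarith
  exact_mod_cast h5

/-- Two sets covering more than half of the group each give every element as a sum. -/
lemma exists_add_eq_of_card_lt {G : Type*} [AddCommGroup G] [Fintype G] [DecidableEq G]
    {Y Z : Finset G} (h : Fintype.card G < #Y + #Z) (g : G) : ∃ y ∈ Y, ∃ z ∈ Z, y + z = g := by
  by_contra! hne
  have hdisj : Disjoint Y (Z.image fun z => g - z) := by
    rw [disjoint_left]
    intro y hy hy'
    obtain ⟨z, hz, rfl⟩ := mem_image.1 hy'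
    exact hne _ hy z hz (by simp)
  have := card_le_univ (Y ∪ Z.image fun z => g - z)
  rw [card_union_of_disjoint hdisj, card_image_of_injective _ sub_right_injective] at this
  lia

lemma exists_short_zeroSum_of_ne_two [Finite ι] (hp2 : p ≠ 2) {s : Finset ι}
    {v : ι → Fin 3 → ZMod p} (hs : 20369 * (p - 1) < #s) :
    ∃ t ⊆ s, t.Nonempty ∧ #t ≤ p ∧ ∑ i ∈ t, v i = 0 := by
  by_contra! hfree
  have hplane (a : Fin 3 → ZMod p) (ha : a ≠ 0) (c : ZMod p) := card_plane_lt hp2 hfree ha c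
  have hp5 : 5092 ≤ p := by
    have h1 : #s ≤ (4 * p - 3) * #(univ : Finset (ZMod p)) :=
      card_le_mul_card_image_of_maps_to (f := fun i => Pi.single 0 1 ⬝ᵥ v i) (by simp) _
        fun c _ => Nat.le_of_lt_succ ((hplane (Pi.single 0 1) (by simp) c).trans_le (by lia))
    rw [card_univ, ZMod.card] at h1
    have hp1 := hp.out.two_le
    obtain ⟨r, rfl⟩ : ∃ r, p = r + 1 := ⟨p - 1, by lia⟩
    have h2 : 4 * (r + 1) - 3 = 4 * r + 1 := by lia
    rw [h2] at h1
    simp only [Nat.add_sub_cancel] at hs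
    by_contra! h3
    have h4 : r ≤ 5090 := by lia
    nlinarith
  have hplane' (t : Finset ι) (a : Fin 3 → ZMod p) (ha : a ≠ 0) (c : ZMod p) :
      #{i ∈ s \ t | a ⬝ᵥ v i = c} ≤ 4 * p :=
    (card_le_card (filter_subset_filter _ sdiff_subset)).trans
      ((hplane a ha c).le.trans (by lia))
  obtain ⟨t₁, ht₁, hc₁, Y₁, hY₁, hh₁⟩ :=
    exists_subsetSums_gt_half hp5 (hplane' ∅) (by rw [sdiff_empty]; lia)
  rw [sdiff_empty] at ht₁
  obtain ⟨t₂, ht₂, hc₂, Y₂, hY₂, hh₂⟩ :=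
    exists_subsetSums_gt_half hp5 (hplane' t₁) (by rw [card_sdiff_of_subset ht₁]; lia)
  obtain ⟨i, his, hi⟩ : ∃ i ∈ s, i ∉ t₁ ∪ t₂ := by
    by_contra! h
    have := card_le_card (show s ⊆ t₁ ∪ t₂ from h)
    have := card_union_le t₁ t₂
    lia
  obtain ⟨y, hy, z, hz, hyz⟩ := exists_add_eq_of_card_lt (Y := Y₁) (Z := Y₂)
    (by simp only [Fintype.card_pi, ZMod.card, prod_const, card_univ, Fintype.card_fin]; lia) (-v i)
  obtain ⟨u₁, hu₁, rfl⟩ := hY₁ y hy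
  obtain ⟨u₂, hu₂, rfl⟩ := hY₂ z hz
  have hdisj : Disjoint u₁ u₂ :=
    (disjoint_sdiff (s := t₁) (t := s)).mono hu₁ (hu₂.trans ht₂)
  have hiu : i ∉ u₁ ∪ u₂ := fun h => hi (union_subset_union hu₁ hu₂ h)
  refine hfree (insert i (u₁ ∪ u₂)) ?_ (insert_nonempty _ _) ?_ ?_
  · exact insert_subset his
      (union_subset (hu₁.trans ht₁) (hu₂.trans (ht₂.trans sdiff_subset)))
  · have := card_le_card hu₁
    have := card_le_card hu₂
    rw [card_insert_of_notMem hiu, card_union_of_disjoint hdisj]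
    lia
  · rw [sum_insert hiu, sum_union hdisj, hyz, add_neg_cancel]

lemma exists_short_zeroSum [Finite ι] {s : Finset ι} {v : ι → Fin 3 → ZMod p}
    (hs : 20369 * (p - 1) < #s) : ∃ t ⊆ s, t.Nonempty ∧ #t ≤ p ∧ ∑ i ∈ t, v i = 0 := by
  obtain rfl | hp2 := eq_or_ne p 2
  · obtain ⟨i, hi, j, hj, hij, hv⟩ := exists_ne_map_eq_of_card_lt_of_maps_to (s := s)
      (t := (univ : Finset (Fin 3 → ZMod 2))) (f := v) (by simp at hs ⊢; lia) (by simp)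
    exact ⟨{i, j}, by simp [insert_subset_iff, hi, hj], by simp, card_le_two,
      by rw [sum_pair hij, hv, CharTwo.add_self_eq_zero]⟩
  · exact exists_short_zeroSum_of_ne_two hp2 hs

end Prime

section Composite

/-- Every sequence of more than `C * (n - 1)` integer vectors has a non-empty subsequence of
length at most `n` whose sum is divisible by `n`. -/
def HasShortZeroSums (C d n : ℕ) : Prop :=
  ∀ (ι : Type) [Finite ι] (s : Finset ι) (v : ι → Fin d → ℤ), C * (n - 1) < #s →
    ∃ t ⊆ s, t.Nonempty ∧ #t ≤ n ∧ ∀ k, (n : ℤ) ∣ ∑ i ∈ t, v i k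

lemma hasShortZeroSums_one (C d : ℕ) : HasShortZeroSums C d 1 := by
  intro ι _ s v hs
  obtain ⟨i, hi⟩ := card_pos.1 (pos_of_gt hs)
  exact ⟨{i}, by simpa using hi, by simp, by simp, by simp⟩

lemma hasShortZeroSums_prime {p : ℕ} (hp : p.Prime) : HasShortZeroSums 20369 3 p := by
  classical
  have := Fact.mk hp
  intro ι _ s v hs
  obtain ⟨t, hts, hne, hcard, hsum⟩ :=
    exists_short_zeroSum (v := fun i k => (v i k : ZMod p)) hs
  refine ⟨t, hts, hne, hcard, fun k => (ZMod.intCast_zmod_eq_zero_iff_dvd _ _).1 ?_⟩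
  have := congrFun hsum k
  rw [Finset.sum_apply] at this
  simpa using this

lemma HasShortZeroSums.exists_disjoint {C d a : ℕ} (h : HasShortZeroSums C d a) {ι : Type}
    [Finite ι] (s : Finset ι) (v : ι → Fin d → ℤ) (r : ℕ) (hs : C * (a - 1) + a * r < #s + a) :
    ∃ 𝒯 : Finset (Finset ι), #𝒯 = r ∧ (𝒯 : Set (Finset ι)).PairwiseDisjoint id ∧
      ∀ t ∈ 𝒯, t ⊆ s ∧ t.Nonempty ∧ #t ≤ a ∧ ∀ k, (a : ℤ) ∣ ∑ i ∈ t, v i k := by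
  classical
  induction r with
  | zero => exact ⟨∅, by simp⟩
  | succ r ih =>
    obtain ⟨𝒯, hcard, hdisj, hT⟩ := ih (by lia)
    have hU : #(𝒯.biUnion id) ≤ r * a := by
      rw [← hcard]
      exact card_biUnion_le_card_mul _ _ _ fun t ht => (hT t ht).2.2.1
    obtain ⟨t, hts, hne, hta, hdvd⟩ := h ι (s \ 𝒯.biUnion id) v (by
      have := le_card_sdiff (𝒯.biUnion id) s
      lia)
    have htU (u : Finset ι) (hu : u ∈ 𝒯) : Disjoint t u :=
      (sdiff_disjoint (s := 𝒯.biUnion id) (t := s)).mono hts (subset_biUnion_of_mem id hu)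
    have ht : t ∉ 𝒯 := fun ht => hne.ne_empty (disjoint_self.1 (htU t ht))
    refine ⟨insert t 𝒯, by rw [card_insert_of_notMem ht, hcard], ?_, ?_⟩
    · rw [coe_insert]
      exact hdisj.insert fun u hu _ => htU u hu
    · intro u hu
      obtain rfl | hu := mem_insert.1 hu
      · exact ⟨hts.trans sdiff_subset, hne, hta, hdvd⟩
      · exact hT u hu

lemma HasShortZeroSums.mul {C d a b : ℕ} (ha : 0 < a) (hb : 0 < b) (h : HasShortZeroSums C d a)
    (h' : HasShortZeroSums C d b) : HasShortZeroSums C d (a * b) := by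
  classical
  intro ι _ s v hs
  obtain ⟨𝒯, hcard, hdisj, hT⟩ := h.exists_disjoint s v (C * (b - 1) + 1) (by
    obtain ⟨a, rfl⟩ := Nat.exists_eq_succ_of_ne_zero ha.ne'
    obtain ⟨b, rfl⟩ := Nat.exists_eq_succ_of_ne_zero hb.ne'
    have : (a.succ * b.succ - 1) = a + a.succ * b := by
      rw [Nat.mul_succ]
      lia
    rw [this] at hs
    simp only [Nat.succ_sub_one]
    linarith)
  obtain ⟨𝒰, h𝒰, hne, hub, hdvd⟩ := h' (Finset ι) 𝒯 (fun t k => (∑ i ∈ t, v i k) / a) (by lia)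
  refine ⟨𝒰.biUnion id, biUnion_subset.2 fun t ht => (hT t (h𝒰 ht)).1, ?_, ?_, fun k => ?_⟩
  · obtain ⟨t, ht⟩ := hne
    exact (hT t (h𝒰 ht)).2.1.mono (subset_biUnion_of_mem id ht)
  · refine (card_biUnion_le_card_mul _ _ a fun t ht => (hT t (h𝒰 ht)).2.2.1).trans ?_
    rw [mul_comm]
    exact Nat.mul_le_mul_left _ hub
  · rw [sum_biUnion (hdisj.subset (by exact_mod_cast h𝒰))]
    have : ∑ t ∈ 𝒰, ∑ i ∈ id t, v i k = a * ∑ t ∈ 𝒰, (∑ i ∈ t, v i k) / a := by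
      rw [mul_sum]
      exact sum_congr rfl fun t ht => (Int.mul_ediv_cancel' ((hT t (h𝒰 ht)).2.2.2 k)).symm
    rw [this, Nat.cast_mul]
    exact mul_dvd_mul_left _ (hdvd k)

lemma hasShortZeroSums_of_pos {n : ℕ} (hn : 0 < n) : HasShortZeroSums 20369 3 n := by
  induction n using Nat.recOnMul with
  | zero => lia
  | one => exact hasShortZeroSums_one _ _
  | prime p hp => exact hasShortZeroSums_prime hp
  | mul a b iha ihb =>
    have ha := Nat.pos_of_mul_pos_right hn
    have hb := Nat.pos_of_mul_pos_left hn
    exact (iha ha).mul ha hb (ihb hb)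

end Composite

theorem stmt_12 (n : ℕ) (hn : 2 ≤ n) :
    etaC (ZMod n × ZMod n × ZMod n) ≤ 20369 * (n - 1) + 1 := by
  refine Nat.sInf_le fun S hS => ?_
  have hexp : AddMonoid.exponent (ZMod n × ZMod n × ZMod n) = n := by
    simp [AddMonoid.exponent_prod]
  let l := S.toList
  let v : Fin l.length → Fin 3 → ℤ := fun i =>
    ![(l.get i).1.cast, (l.get i).2.1.cast, (l.get i).2.2.cast]
  have hmap : (univ : Finset (Fin l.length)).val.map l.get = S := by
    rw [Fin.univ_val_map, List.ofFn_get, Multiset.coe_toList]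
  obtain ⟨t, -, hne, hcard, hdvd⟩ := hasShortZeroSums_of_pos (by lia : 0 < n) (Fin l.length) univ v
    (by simp [l]; lia)
  refine ⟨t.val.map l.get, ?_, ?_, ?_, ?_⟩
  · rw [← hmap]
    exact Multiset.map_le_map (Finset.val_le_iff.2 (subset_univ t))
  · simpa using hne.ne_empty
  · have h (k : Fin 3) := (ZMod.intCast_zmod_eq_zero_iff_dvd _ n).2 (hdvd k)
    have h0 := h 0
    have h1 := h 1
    have h2 := h 2
    simp [v] at h0 h1 h2
    change ∑ i ∈ t, l.get i = 0
    refine Prod.ext ?_ (Prod.ext ?_ ?_)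
    · simpa [Prod.fst_sum] using h0
    · simpa [Prod.fst_sum, Prod.snd_sum] using h1
    · simpa [Prod.snd_sum] using h2
  · rwa [hexp, Multiset.card_map]
end

section
/- For all natural numbers n₁, n₂, n₃ with 1 < n₁ | n₂ | n₃, D(C_{n₁} ⊕ C_{n₂} ⊕ C_{n₃}) ≤ 20367(n₁−1) + (n₂−1) + (n₃−1) + 1. -/
namespace ZeroSum

/-- Every sequence over `G` of length at least `N` has a non-empty zero-sum subsequence whose
length lies in `A`. -/
def HasZeroSum (G : Type*) [AddCommGroup G] (A : Set ℕ) (N : ℕ) : Prop :=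
  ∀ S : Multiset G, N ≤ S.card → ∃ T ≤ S, T ≠ 0 ∧ T.sum = 0 ∧ T.card ∈ A

/-- A (not necessarily surjective) presentation of `G` as an extension of `H` by `K`. -/
def IsExtension (K G H : Type*) [AddCommGroup K] [AddCommGroup G] [AddCommGroup H] : Prop :=
  ∃ (ι : K →+ G) (φ : G →+ H), ∀ g, φ g = 0 → ∃ k, ι k = g

section Extension

lemma sum_mono_of_le {α : Type*} {L L' : Multiset (Multiset α)} (h : L' ≤ L) : L'.sum ≤ L.sum := by
  obtain ⟨U, rfl⟩ := Multiset.le_iff_exists_add.1 h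
  simp

lemma exists_le_map_eq {α β : Type*} (f : α → β) {S : Multiset α} {T : Multiset β}
    (h : T ≤ S.map f) : ∃ S' ≤ S, S'.map f = T := by
  induction S using Quotient.inductionOn
  induction T using Quotient.inductionOn
  obtain ⟨l, hl, hs⟩ := h
  obtain ⟨l', hl', rfl⟩ := List.sublist_map_iff.1 hs
  exact ⟨l', hl'.subperm, Quotient.sound hl⟩

variable {K G H : Type*} [AddCommGroup K] [AddCommGroup G] [AddCommGroup H]
  {A B C : Set ℕ} {m N : ℕ}

lemma HasZeroSum.mono {N' : ℕ} (h : HasZeroSum G A N) (hA : A ⊆ B) (hN : N ≤ N') :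
    HasZeroSum G B N' := by
  intro S hS
  obtain ⟨T, hT, h0, hs, hc⟩ := h S (hN.trans hS)
  exact ⟨T, hT, h0, hs, hA hc⟩

lemma HasZeroSum.of_injective (h : HasZeroSum H A N) (φ : G →+ H)
    (hφ : Function.Injective φ) : HasZeroSum G A N := by
  intro S hS
  obtain ⟨T, hT, h0, hs, hc⟩ := h (S.map φ) (by simpa using hS)
  obtain ⟨T, hTS, rfl⟩ := exists_le_map_eq φ hT
  refine ⟨T, hTS, ?_, ?_, by simpa using hc⟩
  · rintro rfl; simp at h0
  · rw [← map_multiset_sum] at hs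
    exact hφ (by simpa using hs)

/-- Extraction of `k` disjoint subsequences whose images in `H` have sum zero. -/
lemma exists_disjoint_subsequences (φ : G →+ H) (hA : ∀ a ∈ A, a ≤ m) (hAB : A ⊆ B)
    (h₁ : HasZeroSum H A (N + m)) (h₂ : HasZeroSum H B N) (k : ℕ) (S : Multiset G)
    (hS : m * k + N ≤ S.card + m) :
    ∃ L : Multiset (Multiset G), L.card = k ∧
      (∀ T ∈ L, T ≠ 0 ∧ φ T.sum = 0 ∧ T.card ∈ B) ∧ L.sum ≤ S := by
  classical
  have pull : ∀ {D : Set ℕ} {M : ℕ}, HasZeroSum H D M → ∀ S : Multiset G, M ≤ S.card →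
      ∃ T ≤ S, T ≠ 0 ∧ φ T.sum = 0 ∧ T.card ∈ D := by
    intro D M hD S hS
    obtain ⟨T, hT, h0, hs, hc⟩ := hD (S.map φ) (by simpa using hS)
    obtain ⟨T, hTS, rfl⟩ := exists_le_map_eq φ hT
    refine ⟨T, hTS, ?_, by rwa [map_multiset_sum], by simpa using hc⟩
    rintro rfl; simp at h0
  induction k generalizing S with
  | zero => exact ⟨0, by simp⟩
  | succ k ih =>
    obtain ⟨T, hTS, hT, hlen⟩ : ∃ T ≤ S, (T ≠ 0 ∧ φ T.sum = 0 ∧ T.card ∈ B) ∧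
        (k = 0 ∨ T.card ≤ m) := by
      rcases Nat.eq_zero_or_pos k with rfl | hk
      · obtain ⟨T, hT, h⟩ := pull h₂ S (by omega)
        exact ⟨T, hT, h, Or.inl rfl⟩
      · have hmk : m * 1 ≤ m * k := Nat.mul_le_mul_left m hk
        obtain ⟨T, hT, h0, hs, hc⟩ := pull h₁ S (by rw [Nat.mul_succ] at hS; omega)
        exact ⟨T, hT, ⟨h0, hs, hAB hc⟩, Or.inr (hA _ hc)⟩
    obtain ⟨L, hL, hLT, hLS⟩ : ∃ L : Multiset (Multiset G), L.card = k ∧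
        (∀ T ∈ L, T ≠ 0 ∧ φ T.sum = 0 ∧ T.card ∈ B) ∧ L.sum ≤ S - T := by
      rcases hlen with rfl | hlen
      · exact ⟨0, by simp⟩
      · refine ih (S - T) ?_
        have := Multiset.card_le_card hTS
        rw [Multiset.card_sub hTS]
        rw [Nat.mul_succ] at hS
        omega
    refine ⟨T ::ₘ L, by simp [hL], ?_, ?_⟩
    · intro U hU
      rcases Multiset.mem_cons.1 hU with rfl | hU
      exacts [hT, hLT U hU]
    · rw [Multiset.sum_cons, add_comm]
      exact (le_tsub_iff_right hTS).1 hLS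

/-- Zero-sum subsequences in an extension, by first summing blocks to zero in the quotient. -/
lemma HasZeroSum.extension {D : Set ℕ} {k : ℕ} (hE : IsExtension K G H) (hA : ∀ a ∈ A, a ≤ m)
    (hAB : A ⊆ B) (h₁ : HasZeroSum H A (N + m)) (h₂ : HasZeroSum H B N) (hK : HasZeroSum K C k)
    (hD : ∀ L : Multiset ℕ, L.card ∈ C → (∀ x ∈ L, x ∈ B) → L.sum ∈ D) :
    HasZeroSum G D (m * k + N - m) := by
  obtain ⟨ι, φ, hker⟩ := hE
  intro S hS
  obtain ⟨L, hLk, hL, hLS⟩ :=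
    exists_disjoint_subsequences φ hA hAB h₁ h₂ k S (by omega)
  choose! κ hκ using hker
  obtain ⟨T', hT', h0, hs, hc⟩ := hK (L.map fun T ↦ κ T.sum) (by simp [hLk])
  obtain ⟨L', hL', rfl⟩ := exists_le_map_eq _ hT'
  have hmem : ∀ T ∈ L', T ≠ 0 ∧ φ T.sum = 0 ∧ T.card ∈ B := fun T hT ↦
    hL T (Multiset.mem_of_le hL' hT)
  have hsum : ∀ L : Multiset (Multiset G), L.sum.sum = (L.map Multiset.sum).sum := by
    intro L
    induction L using Multiset.induction with
    | empty => simp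
    | cons a L ih => simp [ih]
  have hcard : ∀ L : Multiset (Multiset G), L.sum.card = (L.map Multiset.card).sum := by
    intro L
    induction L using Multiset.induction with
    | empty => simp
    | cons a L ih => simp [ih]
  refine ⟨L'.sum, (sum_mono_of_le hL').trans hLS, ?_, ?_, ?_⟩
  · intro h
    obtain ⟨T, hT⟩ := Multiset.exists_mem_of_ne_zero (s := L') (by rintro rfl; simp at h0)
    have hle : T ≤ L'.sum := by
      simpa using sum_mono_of_le (Multiset.singleton_le.2 hT)
    exact (hmem T hT).1 (le_antisymm (h ▸ hle) (Multiset.zero_le _))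
  · have h := congrArg ι hs
    rw [map_zero, map_multiset_sum, Multiset.map_map] at h
    rw [hsum, ← h]
    exact congrArg _ (Multiset.map_congr rfl fun T hT ↦ (hκ _ (hmem T hT).2.1).symm)
  · rw [hcard]
    refine hD _ (by simpa using hc) fun x hx ↦ ?_
    obtain ⟨T, hT, rfl⟩ := Multiset.mem_map.1 hx
    exact (hmem T hT).2.2

lemma HasZeroSum.extension_univ {k : ℕ} (hE : IsExtension K G H) (hA : ∀ a ∈ A, a ≤ m)
    (h₁ : HasZeroSum H A (N + m)) (h₂ : HasZeroSum H Set.univ N)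
    (hK : HasZeroSum K Set.univ k) : HasZeroSum G Set.univ (m * k + N - m) :=
  HasZeroSum.extension hE hA (Set.subset_univ _) h₁ h₂ hK fun _ _ _ ↦ Set.mem_univ _

lemma HasZeroSum.extension_Iic {n k : ℕ} (hE : IsExtension K G H)
    (hH : HasZeroSum H (Set.Iic m) N) (hK : HasZeroSum K (Set.Iic n) k) :
    HasZeroSum G (Set.Iic (m * n)) (m * k + N - m) := by
  refine HasZeroSum.extension hE (fun _ h ↦ h) subset_rfl (hH.mono subset_rfl (by omega)) hH hK ?_
  intro L hL hLm
  have h := Multiset.sum_le_card_nsmul L m hLm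
  rw [smul_eq_mul, mul_comm] at h
  exact h.trans (Nat.mul_le_mul_left m hL)

lemma HasZeroSum.extension_singleton {n k : ℕ} (hE : IsExtension K G H)
    (hH : HasZeroSum H {m} N) (hK : HasZeroSum K {n} k) :
    HasZeroSum G {m * n} (m * k + N - m) := by
  refine HasZeroSum.extension hE (fun _ h ↦ le_of_eq h) subset_rfl
    (hH.mono subset_rfl (by omega)) hH hK ?_
  intro L hL hLm
  rw [Multiset.eq_replicate_of_mem hLm, Multiset.sum_replicate, smul_eq_mul, mul_comm _ m]
  exact congrArg (m * ·) hL

lemma IsExtension.prod {K' G' H' : Type*} [AddCommGroup K'] [AddCommGroup G'] [AddCommGroup H']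
    (h : IsExtension K G H) (h' : IsExtension K' G' H') :
    IsExtension (K × K') (G × G') (H × H') := by
  obtain ⟨ι, φ, hk⟩ := h
  obtain ⟨ι', φ', hk'⟩ := h'
  refine ⟨ι.prodMap ι', φ.prodMap φ', fun ⟨g, g'⟩ hg ↦ ?_⟩
  simp only [AddMonoidHom.prodMap_def, AddMonoidHom.prod_apply, AddMonoidHom.comp_apply,
    AddMonoidHom.coe_fst, AddMonoidHom.coe_snd, Prod.mk_eq_zero] at hg
  obtain ⟨x, hx⟩ := hk g hg.1
  obtain ⟨x', hx'⟩ := hk' g' hg.2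
  exact ⟨(x, x'), by simp [hx, hx']⟩

end Extension

lemma isExtension_zmod (d e : ℕ) : IsExtension (ZMod e) (ZMod (d * e)) (ZMod d) := by
  let ι : ZMod e →+ ZMod (d * e) := ZMod.lift e
    ⟨(AddMonoidHom.mulLeft (d : ZMod (d * e))).comp (Int.castAddHom _), by
      have h : ((d * e : ℕ) : ZMod (d * e)) = 0 := ZMod.natCast_self _
      simpa only [Nat.cast_mul, AddMonoidHom.comp_apply, AddMonoidHom.coe_mulLeft,
        Int.coe_castAddHom, Int.cast_natCast] using h⟩
  refine ⟨ι, (ZMod.castHom (dvd_mul_right d e) (ZMod d)).toAddMonoidHom, fun g hg ↦ ?_⟩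
  obtain ⟨z, rfl⟩ := ZMod.intCast_surjective g
  have hz : ((z : ℤ) : ZMod d) = 0 := by simpa using hg
  obtain ⟨w, rfl⟩ := (ZMod.intCast_zmod_eq_zero_iff_dvd z d).1 hz
  refine ⟨(w : ZMod e), ?_⟩
  simp [ι]

/-! ### Functions of low degree on the Boolean cube -/

section PolynomialMethod

variable {ι F : Type*} [DecidableEq ι] [Field F]

/-- The indicator of `K ⊆ J`, that is, the monomial `∏ i ∈ K, x i` at the indicator of `J`. -/
def cubeMonomial (F : Type*) [Field F] (K J : Finset ι) : F := if K ⊆ J then 1 else 0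

/-- Functions on the Boolean cube given by multilinear polynomials of degree at most `d`. -/
def degreeLECube (ι F : Type*) [DecidableEq ι] [Field F] (d : ℕ) : Submodule F (Finset ι → F) :=
  Submodule.span F (cubeMonomial F '' {K | K.card ≤ d})

lemma cubeMonomial_mem {K : Finset ι} {d : ℕ} (h : K.card ≤ d) :
    cubeMonomial F K ∈ degreeLECube ι F d :=
  Submodule.subset_span ⟨K, h, rfl⟩

lemma mul_mem_degreeLECube {d e : ℕ} {f g : Finset ι → F} (hf : f ∈ degreeLECube ι F d)
    (hg : g ∈ degreeLECube ι F e) : f * g ∈ degreeLECube ι F (d + e) := by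
  have h := Submodule.mul_mem_mul hf hg
  rw [degreeLECube, degreeLECube, Submodule.span_mul_span] at h
  refine Submodule.span_mono ?_ h
  rintro _ ⟨_, ⟨K, hK, rfl⟩, _, ⟨K', hK', rfl⟩, rfl⟩
  refine ⟨K ∪ K', (Finset.card_union_le _ _).trans (add_le_add hK hK'), ?_⟩
  funext J
  by_cases h1 : K ⊆ J <;> by_cases h2 : K' ⊆ J <;>
    simp [cubeMonomial, Finset.union_subset_iff, h1, h2]

lemma const_mem_degreeLECube (c : F) (d : ℕ) :
    (fun _ ↦ c : Finset ι → F) ∈ degreeLECube ι F d := by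
  have h : (fun _ ↦ c : Finset ι → F) = c • cubeMonomial F ∅ := by
    funext J; simp [cubeMonomial]
  rw [h]
  exact Submodule.smul_mem _ _ (cubeMonomial_mem (by simp))

lemma pow_mem_degreeLECube {d : ℕ} {f : Finset ι → F} (hf : f ∈ degreeLECube ι F d) (n : ℕ) :
    f ^ n ∈ degreeLECube ι F (n * d) := by
  induction n with
  | zero => rw [pow_zero, Nat.zero_mul]; exact const_mem_degreeLECube 1 0
  | succ n ih => rw [pow_succ, Nat.succ_mul]; exact mul_mem_degreeLECube ih hf

lemma prod_mem_degreeLECube {d r : ℕ} {f : Fin r → Finset ι → F}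
    (hf : ∀ k, f k ∈ degreeLECube ι F d) : ∏ k, f k ∈ degreeLECube ι F (r * d) := by
  induction r with
  | zero => rw [Fin.prod_univ_zero, Nat.zero_mul]; exact const_mem_degreeLECube 1 0
  | succ r ih =>
    rw [Fin.prod_univ_castSucc, Nat.succ_mul]
    exact mul_mem_degreeLECube (ih fun k ↦ hf _) (hf _)

lemma sum_mem_degreeLECube [Fintype ι] (a : ι → F) :
    (fun J ↦ ∑ i ∈ J, a i) ∈ degreeLECube ι F 1 := by
  have h : (fun J ↦ ∑ i ∈ J, a i) = ∑ i, a i • cubeMonomial F {i} := by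
    funext J; simp [cubeMonomial, Finset.sum_apply, Finset.sum_ite_mem]
  rw [h]
  exact Submodule.sum_mem _ fun i _ ↦ Submodule.smul_mem _ _ (cubeMonomial_mem (by simp))

lemma choose_card_mem_degreeLECube [Fintype ι] (n : ℕ) :
    (fun J ↦ (J.card.choose n : F)) ∈ degreeLECube ι F n := by
  have h : (fun J : Finset ι ↦ (J.card.choose n : F)) =
      ∑ K ∈ Finset.univ.powersetCard n, cubeMonomial F K := by
    funext J
    rw [← Finset.card_powersetCard, Finset.sum_apply]
    simp only [cubeMonomial]
    rw [Finset.sum_boole]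
    congr 2
    ext K
    simp [Finset.mem_powersetCard, and_comm]
  rw [h]
  refine Submodule.sum_mem _ fun K hK ↦ cubeMonomial_mem ?_
  exact (Finset.mem_powersetCard.1 hK).2.le

lemma sum_neg_one_pow_card_eq_zero {d : ℕ} {f : Finset ι → F} (hf : f ∈ degreeLECube ι F d)
    {s : Finset ι} (hd : d < s.card) : ∑ J ∈ s.powerset, (-1) ^ J.card * f J = 0 := by
  induction hf using Submodule.span_induction with
  | mem f hf =>
    obtain ⟨K, hK, rfl⟩ := hf
    have hlt : K.card < s.card := lt_of_le_of_lt hK hd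
    obtain ⟨i, his, hiK⟩ := Finset.exists_mem_notMem_of_card_lt_card hlt
    obtain ⟨s, hi, rfl⟩ : ∃ s', i ∉ s' ∧ insert i s' = s :=
      ⟨s.erase i, by simp, Finset.insert_erase his⟩
    rw [Finset.sum_powerset_insert hi, ← Finset.sum_add_distrib]
    refine Finset.sum_eq_zero fun J hJ ↦ ?_
    have hiJ : i ∉ J := fun h ↦ hi (Finset.mem_powerset.1 hJ h)
    rw [Finset.card_insert_of_notMem hiJ]
    simp only [cubeMonomial, Finset.subset_insert_iff_of_notMem hiK]
    ring
  | zero => simp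
  | add f g _ _ hf hg => simp [mul_add, Finset.sum_add_distrib, hf, hg]
  | smul c f _ hf =>
    have h : ∀ J, (-1) ^ J.card * (c • f) J = c * ((-1) ^ J.card * f J) := fun J ↦ by
      simp only [Pi.smul_apply, smul_eq_mul]; ring
    simp_rw [h, ← Finset.mul_sum, hf, mul_zero]

lemma indicator_sum_eq_zero_mem_degreeLECube {p : ℕ} [Fact p.Prime] [Fintype ι] {r : ℕ}
    (f : ι → Fin r → ZMod p) :
    (fun J : Finset ι ↦ if ∑ i ∈ J, f i = 0 then (1 : ZMod p) else 0) ∈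
      degreeLECube ι (ZMod p) (r * (p - 1)) := by
  have hp : p - 1 ≠ 0 := by have := (Fact.out : p.Prime).two_le; omega
  have h : (fun J : Finset ι ↦ if ∑ i ∈ J, f i = 0 then (1 : ZMod p) else 0) =
      ∏ k : Fin r, ((fun _ ↦ 1) - (fun J : Finset ι ↦ ∑ i ∈ J, f i k) ^ (p - 1)) := by
    funext J
    simp only [Finset.prod_apply, Pi.sub_apply, Pi.pow_apply]
    split_ifs with h0
    · refine (Finset.prod_eq_one fun k _ ↦ ?_).symm
      have := congrFun h0 k
      simp only [Finset.sum_apply, Pi.zero_apply] at this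
      rw [this, zero_pow hp, sub_zero]
    · obtain ⟨k, hk⟩ := Function.ne_iff.1 h0
      simp only [Finset.sum_apply, Pi.zero_apply] at hk
      refine (Finset.prod_eq_zero (Finset.mem_univ k) ?_).symm
      rw [ZMod.pow_card_sub_one_eq_one hk, sub_self]
  rw [h]
  refine prod_mem_degreeLECube fun k ↦ Submodule.sub_mem _ (const_mem_degreeLECube _ _) ?_
  simpa using pow_mem_degreeLECube (sum_mem_degreeLECube (fun i ↦ f i k)) (p - 1)

end PolynomialMethod

section PrimeCase

variable {ι : Type*} {p : ℕ} [Fact p.Prime]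

lemma sum_vecCons_one_eq_zero_iff {r : ℕ} (f : ι → Fin r → ZMod p) (J : Finset ι) :
    ∑ i ∈ J, (Matrix.vecCons 1 (f i) : Fin (r + 1) → ZMod p) = 0 ↔
      p ∣ J.card ∧ ∑ i ∈ J, f i = 0 := by
  rw [← CharP.cast_eq_zero_iff (ZMod p) p]
  simp [funext_iff, Fin.forall_fin_succ, Finset.sum_apply]

variable [Fintype ι]

/-- Olson's theorem for elementary abelian groups. -/
lemma exists_nonempty_sum_eq_zero {r : ℕ} (f : ι → Fin r → ZMod p) {s : Finset ι}
    (hs : r * (p - 1) < s.card) : ∃ J ⊆ s, J.Nonempty ∧ ∑ i ∈ J, f i = 0 := by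
  classical
  by_contra! hcon
  have h := sum_neg_one_pow_card_eq_zero (indicator_sum_eq_zero_mem_degreeLECube f) hs
  rw [Finset.sum_eq_single ∅] at h
  · simp at h
  · intro J hJ hne
    rw [if_neg (hcon J (Finset.mem_powerset.1 hJ) (Finset.nonempty_iff_ne_empty.2 hne)), mul_zero]
  · simp

lemma exists_dvd_card_sum_eq_zero {r : ℕ} (f : ι → Fin r → ZMod p) {s : Finset ι}
    (hs : (r + 1) * (p - 1) < s.card) :
    ∃ J ⊆ s, J.Nonempty ∧ p ∣ J.card ∧ ∑ i ∈ J, f i = 0 := by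
  obtain ⟨J, hJ, hne, h⟩ := exists_nonempty_sum_eq_zero
    (fun i ↦ (Matrix.vecCons 1 (f i) : Fin (r + 1) → ZMod p)) hs
  exact ⟨J, hJ, hne, (sum_vecCons_one_eq_zero_iff f J).1 h⟩

lemma exists_card_le_sum_eq_zero (f : ι → Fin 2 → ZMod p) {s : Finset ι}
    (hs : 3 * (p - 1) < s.card) :
    ∃ J ⊆ s, J.Nonempty ∧ J.card ≤ p ∧ ∑ i ∈ J, f i = 0 := by
  classical
  have hp := (Fact.out : p.Prime).two_le
  obtain ⟨s, hs', hcard⟩ := Finset.exists_subset_card_eq (Nat.succ_le_of_lt hs)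
  obtain ⟨J, hJ, hne, ⟨q, hq⟩, hsum⟩ := exists_dvd_card_sum_eq_zero f (s := s) (by omega)
  have hJs := Finset.card_le_card hJ
  have hq3 : q < 3 := by
    by_contra! h
    have := Nat.mul_le_mul_left p h
    omega
  have hq0 : q ≠ 0 := by rintro rfl; simp at hq; simp [hq] at hne
  obtain rfl | rfl : q = 1 ∨ q = 2 := by omega
  · exact ⟨J, hJ.trans hs', hne, by omega, hsum⟩
  obtain ⟨i, hi⟩ := hne
  have hi' := Finset.card_erase_of_mem hi
  obtain ⟨T, hT, hTne, hTsum⟩ := exists_nonempty_sum_eq_zero f (s := J.erase i) (by omega)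
  have hTJ : T ⊆ J := hT.trans (Finset.erase_subset _ _)
  have hTc := Finset.card_le_card hT
  by_cases hc : T.card ≤ p
  · exact ⟨T, hTJ.trans (hJ.trans hs'), hTne, hc, hTsum⟩
  · have h1 := Finset.card_sdiff_add_card_eq_card hTJ
    have h2 := Finset.sum_sdiff (f := f) hTJ
    refine ⟨J \ T, Finset.sdiff_subset.trans (hJ.trans hs'), ?_, by omega, ?_⟩
    · rw [← Finset.card_pos]; omega
    · simpa [hTsum, hsum] using h2

lemma choose_two_mul_prime (hp : p ≠ 2) : ((2 * p).choose p : ZMod p) = 2 := by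
  have hp2 : 2 < p := lt_of_le_of_ne (Fact.out : p.Prime).two_le hp.symm
  have h := (Choose.choose_modEq_choose_mod_mul_choose_div_nat (n := 2 * p) (k := p) (p := p))
  have hp0 : 0 < p := by omega
  rw [Nat.mul_mod_left, Nat.mod_self, Nat.mul_div_cancel _ hp0, Nat.div_self hp0] at h
  simpa using (ZMod.natCast_eq_natCast_iff _ _ _).2 h

/-- Rónyai's bound for the Erdős–Ginzburg–Ziv constant of `(ZMod p)²`. -/
lemma exists_card_eq_sum_eq_zero (hp2 : p ≠ 2) (f : ι → Fin 2 → ZMod p) {s : Finset ι}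
    (hs : 4 * (p - 1) + 1 < s.card) :
    ∃ J ⊆ s, J.card = p ∧ ∑ i ∈ J, f i = 0 := by
  classical
  have hp := (Fact.out : p.Prime).two_le
  by_contra! hcon
  obtain ⟨s, hs', hcard⟩ := Finset.exists_subset_card_eq (Nat.succ_le_of_lt hs)
  replace hcon : ∀ J ⊆ s, J.card = p → ∑ i ∈ J, f i ≠ 0 := fun J hJ ↦ hcon J (hJ.trans hs')
  have h3 : ∀ J ⊆ s, J.card = 3 * p → ∑ i ∈ J, f i ≠ 0 := by
    intro J hJ hJc hsum
    obtain ⟨i, hi⟩ : J.Nonempty := by rw [← Finset.card_pos]; omega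
    have hi' := Finset.card_erase_of_mem hi
    obtain ⟨T, hT, hTne, ⟨q, hq⟩, hTsum⟩ :=
      exists_dvd_card_sum_eq_zero f (s := J.erase i) (by omega)
    have hTJ : T ⊆ J := hT.trans (Finset.erase_subset _ _)
    have hTc := Finset.card_le_card hT
    have hq3 : q < 3 := by
      by_contra! h
      have := Nat.mul_le_mul_left p h
      omega
    have hq0 : q ≠ 0 := by rintro rfl; simp at hq; simp [hq] at hTne
    obtain rfl | rfl : q = 1 ∨ q = 2 := by omega
    · exact hcon T (hTJ.trans hJ) (by omega) hTsum
    · have h1 := Finset.card_sdiff_add_card_eq_card hTJ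
      have h2 := Finset.sum_sdiff (f := f) hTJ
      exact hcon (J \ T) (Finset.sdiff_subset.trans hJ) (by omega) (by simpa [hTsum, hsum] using h2)
  have hdeg := mul_mem_degreeLECube
    (indicator_sum_eq_zero_mem_degreeLECube
      (fun i ↦ (Matrix.vecCons 1 (f i) : Fin 3 → ZMod p)))
    (Submodule.sub_mem _ (choose_card_mem_degreeLECube p) (const_mem_degreeLECube 2 p))
  have h := sum_neg_one_pow_card_eq_zero hdeg (s := s) (by omega)
  rw [Finset.sum_eq_single ∅] at h
  · have h2 : (2 : ZMod p) ≠ 0 := by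
      intro h2
      have : ((2 : ℕ) : ZMod p) = 0 := by exact_mod_cast h2
      rw [CharP.cast_eq_zero_iff (ZMod p) p] at this
      exact hp2 ((Nat.prime_dvd_prime_iff_eq Fact.out Nat.prime_two).1 this)
    have hp0 : p ≠ 0 := by omega
    simp [Nat.choose_eq_zero_of_lt (Nat.pos_of_ne_zero hp0), h2] at h
  · intro J hJ hne
    rw [Finset.mem_powerset] at hJ
    simp only [Pi.mul_apply, Pi.sub_apply, sum_vecCons_one_eq_zero_iff]
    split_ifs with h0
    · obtain ⟨⟨q, hq⟩, hsum⟩ := h0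
      have hJs := Finset.card_le_card hJ
      have hq4 : q < 4 := by
        by_contra! h
        have := Nat.mul_le_mul_left p h
        omega
      have hq0 : q ≠ 0 := by rintro rfl; simp at hq; exact hne hq
      obtain rfl | rfl | rfl : q = 1 ∨ q = 2 ∨ q = 3 := by omega
      · exact absurd hsum (hcon J hJ (by omega))
      · rw [hq, mul_comm p 2, choose_two_mul_prime hp2]; simp
      · exact absurd hsum (h3 J hJ (by omega))
    · simp
  · simp

end PrimeCase
/-! ### Translates of a subset of a finite abelian group -/

section Escape

variable {G : Type*} [AddCommGroup G] [DecidableEq G]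

/-- The number of elements of `Y` which are moved outside `Y` by the translation by `b`. -/
def escape (Y : Finset G) (b : G) : ℕ := {y ∈ Y | y + b ∉ Y}.card

lemma escape_zero (Y : Finset G) : escape Y 0 = 0 := by simp +contextual [escape]

lemma escape_add_le (Y : Finset G) (b c : G) : escape Y (b + c) ≤ escape Y b + escape Y c := by
  have h : {y ∈ Y | y + (b + c) ∉ Y} ⊆ {y ∈ Y | y + b ∉ Y} ∪
      ({y ∈ Y | y + c ∉ Y}.image (· - b)) := by
    intro y
    simp only [Finset.mem_filter, Finset.mem_union, Finset.mem_image]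
    rintro ⟨hy, hbc⟩
    by_cases hb : y + b ∈ Y
    · exact Or.inr ⟨y + b, ⟨hb, by rwa [add_assoc]⟩, by abel⟩
    · exact Or.inl ⟨hy, hb⟩
  exact (Finset.card_le_card h).trans ((Finset.card_union_le _ _).trans
    (by gcongr; exacts [le_rfl, Finset.card_image_le]))

lemma escape_nsmul_le (Y : Finset G) (j : ℕ) (b : G) : escape Y (j • b) ≤ j * escape Y b := by
  induction j with
  | zero => simp [escape_zero]
  | succ j ih =>
    rw [add_smul, one_smul, add_mul, one_mul]
    exact (escape_add_le _ _ _).trans (by gcongr)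

lemma card_filter_add_mem (Y : Finset G) (b : G) :
    ({y ∈ Y | y + b ∈ Y}.card : ℝ) = Y.card - escape Y b := by
  have := Finset.card_filter_add_card_filter_not (s := Y) (fun y ↦ y + b ∈ Y)
  rw [escape, ← this]
  push_cast
  ring

lemma card_image_add_union_image_add (Y : Finset G) (b c : G) :
    (Y.image (· + b) ∪ Y.image (· + c)).card = Y.card + escape Y (b - c) := by
  have h1 : (Y.image (· + c)).card = Y.card :=
    Finset.card_image_of_injective _ (add_left_injective c)
  have h2 : (Y.image (· + b) \ Y.image (· + c)) = {y ∈ Y | y + (b - c) ∉ Y}.image (· + b) := by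
    ext z
    simp only [Finset.mem_sdiff, Finset.mem_image, Finset.mem_filter]
    constructor
    · rintro ⟨⟨y, hy, rfl⟩, h⟩
      exact ⟨y, ⟨hy, fun h' ↦ h ⟨_, h', by abel⟩⟩, rfl⟩
    · rintro ⟨y, ⟨hy, h⟩, rfl⟩
      refine ⟨⟨y, hy, rfl⟩, ?_⟩
      rintro ⟨x, hx, hxy⟩
      exact h (by rwa [← add_sub_assoc, ← hxy, add_sub_cancel_right])
  rw [← Finset.sdiff_union_self_eq_union, Finset.card_union_of_disjoint Finset.sdiff_disjoint, h1,
    h2, Finset.card_image_of_injective _ (add_left_injective b), add_comm, escape]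

variable [Fintype G]

lemma sum_norm_sq_mul_apply (Y : Finset G) (b : G) :
    ∑ ψ : AddChar G ℂ, (‖∑ y ∈ Y, ψ y‖ ^ 2 : ℂ) * ψ b =
      Fintype.card G * ({y ∈ Y | y + b ∈ Y}.card : ℂ) := by
  have h (ψ : AddChar G ℂ) : (‖∑ y ∈ Y, ψ y‖ ^ 2 : ℂ) * ψ b =
      ∑ y ∈ Y, ∑ z ∈ Y, ψ (y + b - z) := by
    rw [← Complex.mul_conj', map_sum, Finset.sum_mul_sum, Finset.sum_mul]
    refine Finset.sum_congr rfl fun y _ ↦ ?_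
    rw [Finset.sum_mul]
    refine Finset.sum_congr rfl fun z _ ↦ ?_
    rw [← Complex.inv_eq_conj (ψ.norm_apply z), sub_eq_add_neg, AddChar.map_add_eq_mul,
      AddChar.map_add_eq_mul, AddChar.map_neg_eq_inv]
    ring
  simp_rw [h]
  rw [Finset.sum_comm, Finset.card_filter, Nat.cast_sum, Finset.mul_sum]
  refine Finset.sum_congr rfl fun y _ ↦ ?_
  rw [Finset.sum_comm]
  simp_rw [AddChar.sum_apply_eq_ite, sub_eq_zero]
  simp

lemma sum_norm_sq (Y : Finset G) :
    ∑ ψ : AddChar G ℂ, ‖∑ y ∈ Y, ψ y‖ ^ 2 = Fintype.card G * (Y.card : ℝ) := by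
  have h := sum_norm_sq_mul_apply Y 0
  simp only [AddChar.map_zero_eq_one, mul_one, add_zero, Finset.filter_mem_eq_inter,
    Finset.inter_self] at h
  exact_mod_cast h

/-- If the nontrivial character sums over the family `b` are small then, on average over the
family, a translation moves a positive proportion of the elements of `Y` outside `Y`. -/
lemma le_sum_escape {κ : Type*} (W : Finset κ) (b : κ → G) {c : ℝ} (hc : c ≤ 1)
    (hW : ∀ ψ : AddChar G ℂ, ψ ≠ 1 → ‖∑ w ∈ W, ψ (b w)‖ ≤ c * W.card)
    {Y : Finset G} (hY : 2 * Y.card ≤ Fintype.card G) :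
    (1 - c) / 2 * W.card * Y.card ≤ ∑ w ∈ W, (escape Y (b w) : ℝ) := by
  have h1 : (Fintype.card G : ℂ) * ((∑ w ∈ W, ({y ∈ Y | y + b w ∈ Y}.card : ℝ) : ℝ) : ℂ) =
      ∑ ψ : AddChar G ℂ, (‖∑ y ∈ Y, ψ y‖ ^ 2 : ℂ) * ∑ w ∈ W, ψ (b w) := by
    simp_rw [Finset.mul_sum]
    rw [Finset.sum_comm]
    simp_rw [sum_norm_sq_mul_apply]
    rw [← Finset.mul_sum]
    push_cast
    rfl
  have h2 : (Fintype.card G : ℝ) * ∑ w ∈ W, ({y ∈ Y | y + b w ∈ Y}.card : ℝ) ≤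
      ∑ ψ : AddChar G ℂ, ‖∑ y ∈ Y, ψ y‖ ^ 2 * ‖∑ w ∈ W, ψ (b w)‖ := by
    have h3 := congrArg norm h1
    rw [← Complex.ofReal_natCast, ← Complex.ofReal_mul, Complex.norm_real, Real.norm_eq_abs,
      abs_of_nonneg (by positivity)] at h3
    rw [h3]
    refine (norm_sum_le _ _).trans (Finset.sum_le_sum fun ψ _ ↦ ?_)
    simp
  have h3 : ∑ ψ : AddChar G ℂ, ‖∑ y ∈ Y, ψ y‖ ^ 2 * ‖∑ w ∈ W, ψ (b w)‖ ≤
      ∑ ψ : AddChar G ℂ, (c * W.card * ‖∑ y ∈ Y, ψ y‖ ^ 2 +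
        if ψ = 1 then (1 - c) * W.card * (Y.card : ℝ) ^ 2 else 0) := by
    refine Finset.sum_le_sum fun ψ _ ↦ ?_
    split_ifs with hψ
    · subst hψ
      simp only [AddChar.one_apply, Finset.sum_const, nsmul_eq_mul, mul_one,
        Complex.norm_natCast]
      exact le_of_eq (by ring)
    · rw [add_zero, mul_comm]
      exact mul_le_mul_of_nonneg_right (hW ψ hψ) (by positivity)
  rw [Finset.sum_add_distrib, ← Finset.mul_sum, sum_norm_sq, Finset.sum_ite_eq' ] at h3
  simp only [Finset.mem_univ, if_true] at h3
  have hG : (0 : ℝ) < Fintype.card G := by exact_mod_cast Fintype.card_pos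
  have hY' : (2 : ℝ) * Y.card ≤ Fintype.card G := by exact_mod_cast hY
  simp_rw [card_filter_add_mem, Finset.sum_sub_distrib, Finset.sum_const, nsmul_eq_mul] at h2
  have h4 := h2.trans h3
  have h5 : (1 - c) * W.card * (Y.card : ℝ) * (2 * Y.card) ≤
      (1 - c) * W.card * (Y.card : ℝ) * Fintype.card G := by
    gcongr
  refine le_of_mul_le_mul_left ?_ hG
  linarith

end Escape

/-! ### Exponential sums -/

section ExponentialSums

variable {p : ℕ} [NeZero p]

lemma norm_stdAddChar_sub_one_ge (c : ZMod p) :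
    4 * (c.valMinAbs.natAbs : ℝ) / p ≤ ‖ZMod.stdAddChar c - 1‖ := by
  have hp : (0 : ℝ) < p := by exact_mod_cast NeZero.pos p
  have hle : ((c.valMinAbs.natAbs : ℕ) : ℝ) ≤ p / 2 :=
    (Nat.cast_le.2 (ZMod.natAbs_valMinAbs_le c)).trans Nat.cast_div_le
  have h1 : ZMod.stdAddChar c =
      Complex.exp (Complex.I * ((2 * Real.pi * c.valMinAbs / p : ℝ) : ℂ)) := by
    conv_lhs => rw [← ZMod.coe_valMinAbs c]
    rw [ZMod.stdAddChar_coe]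
    push_cast
    ring_nf
  rw [Nat.cast_natAbs, Int.cast_abs] at *
  have habs : |2 * Real.pi * c.valMinAbs / p / 2| = Real.pi * |(c.valMinAbs : ℝ)| / p := by
    rw [show 2 * Real.pi * c.valMinAbs / p / 2 = Real.pi * c.valMinAbs / p by ring, abs_div,
      abs_mul, abs_of_pos Real.pi_pos, abs_of_pos hp]
  have h2 := Real.mul_abs_le_abs_sin (x := 2 * Real.pi * c.valMinAbs / p / 2) (by
    rw [habs, div_le_iff₀ hp]
    nlinarith [Real.pi_pos])
  rw [habs] at h2
  rw [h1, Complex.norm_exp_I_mul_ofReal_sub_one, norm_mul, Real.norm_eq_abs, Real.norm_eq_abs,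
    abs_two]
  refine le_trans (le_of_eq ?_) (mul_le_mul_of_nonneg_left h2 zero_le_two)
  field_simp [Real.pi_ne_zero]
  ring

lemma norm_sum_pow_stdAddChar_le (c : ZMod p) {h : ℕ} (hc : h < c.valMinAbs.natAbs) (t : ℕ) :
    ‖∑ j ∈ Finset.range t, ZMod.stdAddChar c ^ j‖ ≤ p / (2 * (h + 1)) := by
  have hp : (0 : ℝ) < p := by exact_mod_cast NeZero.pos p
  have h1 : ‖∑ j ∈ Finset.range t, ZMod.stdAddChar c ^ j‖ * ‖ZMod.stdAddChar c - 1‖ ≤ 2 := by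
    rw [← norm_mul, geom_sum_mul]
    refine (norm_sub_le _ _).trans ?_
    rw [norm_pow, AddChar.norm_apply, norm_one]
    norm_num
  have h2 : ((h : ℝ) + 1) ≤ (c.valMinAbs.natAbs : ℝ) := by exact_mod_cast hc
  have h3 : 4 * ((h : ℝ) + 1) / p ≤ ‖ZMod.stdAddChar c - 1‖ :=
    (by gcongr : 4 * ((h : ℝ) + 1) / p ≤ _).trans (norm_stdAddChar_sub_one_ge c)
  have h4 := (mul_le_mul_of_nonneg_left h3 (norm_nonneg _)).trans h1
  rw [mul_div_assoc', div_le_iff₀ hp] at h4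
  rw [le_div_iff₀ (by positivity)]
  linarith

lemma card_valMinAbs_natAbs_le (h : ℕ) :
    ({c : ZMod p | c.valMinAbs.natAbs ≤ h} : Finset (ZMod p)).card ≤ 2 * h + 1 := by
  have h1 : (({c : ZMod p | c.valMinAbs.natAbs ≤ h} : Finset (ZMod p)).image
      ZMod.valMinAbs) ⊆ Finset.Icc (-h : ℤ) h := by
    intro z
    simp only [Finset.mem_image, Finset.mem_filter, Finset.mem_univ, true_and, Finset.mem_Icc]
    rintro ⟨c, hc, rfl⟩
    omega
  have h2 := Finset.card_le_card h1
  rw [Finset.card_image_of_injective _ ZMod.injective_valMinAbs, Int.card_Icc] at h2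
  omega

end ExponentialSums

/-! ### Sequences with few terms in each affine hyperplane -/

section Hyperplanes

variable {p : ℕ} [Fact p.Prime] {r : ℕ}

lemma exists_eq_stdAddChar_mul (χ : AddChar (ZMod p) ℂ) :
    ∃ u : ZMod p, ∀ x, χ x = ZMod.stdAddChar (u * x) := by
  have h := (Fintype.bijective_iff_injective_and_card _).2
    ⟨AddChar.to_mulShift_inj_of_isPrimitive (ZMod.isPrimitive_stdAddChar p),
      (AddChar.card_eq (α := ZMod p)).symm⟩
  obtain ⟨u, rfl⟩ := h.2 χ
  exact ⟨u, fun x ↦ rfl⟩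

lemma exists_eq_stdAddChar_dotProduct (ψ : AddChar (Fin r → ZMod p) ℂ) :
    ∃ u : Fin r → ZMod p, ∀ x, ψ x = ZMod.stdAddChar (u ⬝ᵥ x) := by
  choose u hu using fun i ↦ exists_eq_stdAddChar_mul
    (ψ.compAddMonoidHom (AddMonoidHom.single (fun _ : Fin r ↦ ZMod p) i))
  refine ⟨u, fun x ↦ ?_⟩
  have h1 : ψ x = ∏ i, ψ (Pi.single i (x i)) := by
    conv_lhs => rw [← Finset.univ_sum_single x]
    exact map_prod ψ.toMonoidHom (fun i ↦ Multiplicative.ofAdd (Pi.single i (x i))) Finset.univ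
  have h2 : (ZMod.stdAddChar (u ⬝ᵥ x) : ℂ) = ∏ i, ZMod.stdAddChar (u i * x i) :=
    map_prod (ZMod.stdAddChar (N := p)).toMonoidHom
      (fun i ↦ Multiplicative.ofAdd (u i * x i)) Finset.univ
  rw [h1, h2]
  exact Finset.prod_congr rfl fun i _ ↦ hu i (x i)

variable {ι : Type*}

lemma card_filter_valMinAbs_le (g : ι → ZMod p) (R : Finset ι) {K h : ℕ}
    (hg : ∀ c, K * {i ∈ R | g i = c}.card ≤ R.card) (a : ZMod p) :
    K * {i ∈ R | (a - g i).valMinAbs.natAbs ≤ h}.card ≤ (2 * h + 1) * R.card := by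
  have h1 := Finset.card_eq_sum_card_fiberwise (f := fun i ↦ a - g i)
    (s := {i ∈ R | (a - g i).valMinAbs.natAbs ≤ h})
    (t := {c : ZMod p | c.valMinAbs.natAbs ≤ h}) (fun i hi ↦ by simpa using (by simpa using hi :
      i ∈ R ∧ _).2)
  rw [h1, Finset.mul_sum]
  refine (Finset.sum_le_card_nsmul _ _ R.card fun c _ ↦ ?_).trans ?_
  · refine le_trans (Nat.mul_le_mul_left _ (Finset.card_le_card ?_)) (hg (a - c))
    intro i
    simp only [Finset.mem_filter]
    rintro ⟨⟨hi, -⟩, rfl⟩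
    exact ⟨hi, by abel⟩
  · rw [smul_eq_mul]
    exact Nat.mul_le_mul_right _ (card_valMinAbs_natAbs_le h)

lemma norm_sum_differences_le {f : ι → Fin r → ZMod p} {R : Finset ι}
    (hR : ∀ u : Fin r → ZMod p, u ≠ 0 → ∀ c, 5000 * {i ∈ R | u ⬝ᵥ f i = c}.card ≤ R.card)
    {t : ℕ} (ht : p ≤ 450 * t) {ψ : AddChar (Fin r → ZMod p) ℂ} (hψ : ψ ≠ 1) :
    ‖∑ w ∈ R ×ˢ R ×ˢ Finset.range t, ψ (w.2.2 • (f w.1 - f w.2.1))‖ ≤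
      3 / 5 * (R ×ˢ R ×ˢ Finset.range t).card := by
  obtain ⟨u, hu⟩ := exists_eq_stdAddChar_dotProduct ψ
  have hu0 : u ≠ 0 := by
    rintro rfl
    exact hψ (by ext x; simp [hu])
  have key (x : ι) : ∑ y ∈ R, ‖∑ j ∈ Finset.range t, ψ (j • (f x - f y))‖ ≤
      3 / 5 * (R.card * t : ℝ) := by
    have h1 (y : ι) : ‖∑ j ∈ Finset.range t, ψ (j • (f x - f y))‖ ≤
        p / 1500 + if (u ⬝ᵥ f x - u ⬝ᵥ f y).valMinAbs.natAbs ≤ 749 then (t : ℝ) else 0 := by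
      simp_rw [AddChar.map_nsmul_eq_pow, hu, dotProduct_sub]
      split_ifs with h
      · refine le_add_of_nonneg_of_le (by positivity) ?_
        refine (norm_sum_le _ _).trans (le_of_eq ?_)
        simp
      · rw [add_zero]
        refine (norm_sum_pow_stdAddChar_le _ (not_le.1 h) t).trans (le_of_eq ?_)
        norm_num
    refine (Finset.sum_le_sum fun y _ ↦ h1 y).trans ?_
    rw [Finset.sum_add_distrib, Finset.sum_const, ← Finset.sum_filter, Finset.sum_const,
      nsmul_eq_mul, nsmul_eq_mul]
    have h2 := card_filter_valMinAbs_le (h := 749) (fun i ↦ u ⬝ᵥ f i) R (hR u hu0) (u ⬝ᵥ f x)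
    have h3 : (5000 : ℝ) * {i ∈ R | (u ⬝ᵥ f x - u ⬝ᵥ f i).valMinAbs.natAbs ≤ 749}.card ≤
        1499 * R.card := by exact_mod_cast h2
    have h4 : (p : ℝ) ≤ 450 * t := by exact_mod_cast ht
    have h5 := mul_le_mul_of_nonneg_right h3 (Nat.cast_nonneg (α := ℝ) t)
    have h6 := mul_le_mul_of_nonneg_left h4 (Nat.cast_nonneg (α := ℝ) R.card)
    have h7 : (0 : ℝ) ≤ R.card * t := by positivity
    linarith
  simp_rw [Finset.sum_product]
  refine (norm_sum_le _ _).trans ((Finset.sum_le_sum fun x _ ↦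
    (norm_sum_le _ _).trans (key x)).trans (le_of_eq ?_))
  simp only [Finset.sum_const, Finset.card_product, Finset.card_range, nsmul_eq_mul]
  push_cast
  ring

/-- If a sequence has few terms in each affine hyperplane, then translation by the difference of
two of its terms moves many elements of `Y` outside `Y`. -/
lemma exists_le_mul_escape {f : ι → Fin r → ZMod p} {R : Finset ι} (hR0 : R.Nonempty)
    (hR : ∀ u : Fin r → ZMod p, u ≠ 0 → ∀ c, 5000 * {i ∈ R | u ⬝ᵥ f i = c}.card ≤ R.card)
    {Y : Finset (Fin r → ZMod p)} (hY : 2 * Y.card ≤ p ^ r) :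
    ∃ x ∈ R, ∃ y ∈ R, 180 * Y.card ≤ p * escape Y (f x - f y) := by
  by_contra! hcon
  set t := p / 450 + 1 with ht
  have h1 := le_sum_escape (R ×ˢ R ×ˢ Finset.range t) (fun w ↦ w.2.2 • (f w.1 - f w.2.1))
    (c := 3 / 5) (by norm_num) (fun ψ hψ ↦ norm_sum_differences_le hR (by omega) hψ)
    (Y := Y) (by simpa using hY)
  have hp : (0 : ℝ) < p := by exact_mod_cast (Fact.out : p.Prime).pos
  have hRpos : (0 : ℝ) < R.card := by exact_mod_cast hR0.card_pos
  have h2 (x) (hx : x ∈ R) (y) (hy : y ∈ R) :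
      ∑ j ∈ Finset.range t, (escape Y (j • (f x - f y)) : ℝ) <
        t * Y.card / 5 := by
    have h3 : ∑ j ∈ Finset.range t, (escape Y (j • (f x - f y)) : ℝ) ≤
        ((∑ j ∈ Finset.range t, j : ℕ) : ℝ) * escape Y (f x - f y) := by
      rw [← Nat.cast_sum, ← Nat.cast_mul, Finset.sum_mul]
      exact Nat.cast_le.2 (Finset.sum_le_sum fun j _ ↦ escape_nsmul_le _ _ _)
    have h4 : (((∑ j ∈ Finset.range t, j : ℕ) : ℝ)) * 2 = t * (p / 450 : ℕ) := by
      exact_mod_cast Finset.sum_range_id_mul_two t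
    have h5 : ((p / 450 : ℕ) : ℝ) ≤ p / 450 := Nat.cast_div_le
    have h6 : (p : ℝ) * escape Y (f x - f y) < 180 * Y.card := by exact_mod_cast hcon x hx y hy
    have ht0 : (0 : ℝ) < t := by positivity
    have h7 := mul_le_mul_of_nonneg_right h5
      (by positivity : (0 : ℝ) ≤ t * escape Y (f x - f y))
    have h8 := mul_lt_mul_of_pos_left h6 ht0
    refine h3.trans_lt ?_
    rw [eq_div_of_mul_eq two_ne_zero h4]
    linarith
  simp_rw [Finset.sum_product] at h1
  have h3 : ∑ x ∈ R, ∑ y ∈ R, ∑ j ∈ Finset.range t, (escape Y (j • (f x - f y)) : ℝ) <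
      ∑ x ∈ R, ∑ y ∈ R, (t * Y.card / 5 : ℝ) :=
    Finset.sum_lt_sum_of_nonempty hR0 fun x hx ↦
      Finset.sum_lt_sum_of_nonempty hR0 fun y hy ↦ h2 x hx y hy
  refine absurd (h1.trans_lt h3) (not_lt.2 (le_of_eq ?_))
  simp only [Finset.sum_const, Finset.card_product, Finset.card_range, nsmul_eq_mul]
  push_cast
  ring

end Hyperplanes

/-! ### Translating by sums of differences -/

section Boxes

variable {p : ℕ} [Fact p.Prime] {ι : Type*}

lemma exists_linearIndependent_sub {r : ℕ} {f : ι → Fin r → ZMod p} {R : Finset ι} (i₀ : ι)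
    (hR : ∀ u : Fin r → ZMod p, u ≠ 0 → ∀ c, ∃ i ∈ R, u ⬝ᵥ f i ≠ c) :
    ∃ x : Fin r → ι, (∀ k, x k ∈ R) ∧ LinearIndependent (ZMod p) fun k ↦ f (x k) - f i₀ := by
  have hspan : Submodule.span (ZMod p) ((fun i ↦ f i - f i₀) '' R) = ⊤ := by
    by_contra hne
    obtain ⟨φ, hφ0, hφ⟩ := Submodule.exists_le_ker_of_lt_top _ (lt_top_iff_ne_top.2 hne)
    have hφu (v : Fin r → ZMod p) : (fun k ↦ φ (Pi.single k 1)) ⬝ᵥ v = φ v := by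
      conv_rhs => rw [← Finset.univ_sum_single v, map_sum]
      refine Finset.sum_congr rfl fun k _ ↦ ?_
      rw [mul_comm, ← smul_eq_mul, ← map_smul, ← Pi.single_smul, smul_eq_mul, mul_one]
    obtain ⟨i, hi, hne⟩ := hR (fun k ↦ φ (Pi.single k 1)) (by
      rintro h
      refine hφ0 (LinearMap.ext fun v ↦ ?_)
      rw [← hφu, h, zero_dotProduct, LinearMap.zero_apply]) (φ (f i₀))
    have := hφ (Submodule.subset_span ⟨i, hi, rfl⟩)
    rw [LinearMap.mem_ker, map_sub, sub_eq_zero] at this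
    exact hne (by rw [hφu, this])
  obtain ⟨g, hg, -, hli⟩ :=
    Submodule.exists_fun_fin_finrank_span_eq (ZMod p) ((fun i ↦ f i - f i₀) '' R)
  have hrank : Module.finrank (ZMod p) (Submodule.span (ZMod p) ((fun i ↦ f i - f i₀) '' R)) =
      r := by
    rw [hspan, finrank_top, Module.finrank_fin_fun]
  choose x hx hxg using hg
  refine ⟨x ∘ Fin.cast hrank.symm, fun k ↦ hx _, ?_⟩
  have heq : (fun k ↦ f ((x ∘ Fin.cast hrank.symm) k) - f i₀) = g ∘ Fin.cast hrank.symm :=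
    funext fun k ↦ hxg _
  rw [heq]
  exact hli.comp _ (Fin.cast_injective _)

lemma exists_card_le_two_mul_escape {r m : ℕ} {e : Fin r → Fin r → ZMod p}
    (he : LinearIndependent (ZMod p) e) (hm : m ≤ p) {Y : Finset (Fin r → ZMod p)}
    (hY : 2 * Y.card ≤ m ^ r) (hY0 : Y.Nonempty) :
    ∃ n : Fin r → ℕ, (∀ k, n k < m) ∧ Y.card ≤ 2 * escape Y (∑ k, n k • e k) := by
  by_contra! hcon
  set Q := Fintype.piFinset fun _ : Fin r ↦ Finset.range m with hQ
  have hQm (n) : n ∈ Q ↔ ∀ k, n k < m := by simp [hQ]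
  have hinj : Set.InjOn (fun n : Fin r → ℕ ↦ ∑ k, n k • e k) Q := by
    intro n hn n' hn' h
    simp only [← Nat.cast_smul_eq_nsmul (ZMod p)] at h
    have h1 := Fintype.linearIndependent_iff.1 he (fun k ↦ (n k : ZMod p) - n' k) (by
      simp only [sub_smul, Finset.sum_sub_distrib]
      exact sub_eq_zero.2 h)
    funext k
    have h2 := (ZMod.natCast_eq_natCast_iff' _ _ _).1 (sub_eq_zero.1 (h1 k))
    rwa [Nat.mod_eq_of_lt (((hQm n).1 hn k).trans_le hm),
      Nat.mod_eq_of_lt (((hQm n').1 hn' k).trans_le hm)] at h2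
  have h1 : ∑ n ∈ Q, {y ∈ Y | y + ∑ k, n k • e k ∈ Y}.card ≤ Y.card * Y.card := by
    simp_rw [Finset.card_filter]
    rw [Finset.sum_comm]
    refine Finset.sum_le_card_nsmul _ _ _ fun y _ ↦ ?_
    rw [← Finset.card_filter]
    refine Finset.card_le_card_of_injOn (fun n ↦ y + ∑ k, n k • e k) (fun n hn ↦ ?_) ?_
    · exact (Finset.mem_filter.1 hn).2
    · intro n hn n' hn' h
      exact hinj (Finset.mem_filter.1 hn).1 (Finset.mem_filter.1 hn').1 (add_left_cancel h)
  have h2 : ∑ n ∈ Q, Y.card < ∑ n ∈ Q, 2 * {y ∈ Y | y + ∑ k, n k • e k ∈ Y}.card := by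
    refine Finset.sum_lt_sum_of_nonempty ?_ fun n hn ↦ ?_
    · rw [← Finset.card_pos, hQ, Fintype.card_piFinset]
      have := hY0.card_pos
      simp only [Finset.card_range, Finset.prod_const, Finset.card_univ, Fintype.card_fin]
      omega
    · have := hcon n ((hQm n).1 hn)
      have h := Finset.card_filter_add_card_filter_not (s := Y) (fun y ↦ y + ∑ k, n k • e k ∈ Y)
      rw [escape] at this
      omega
  rw [← Finset.mul_sum, Finset.sum_const, smul_eq_mul, hQ, Fintype.card_piFinset] at h2
  simp only [Finset.card_range, Finset.prod_const, Finset.card_univ, Fintype.card_fin] at h2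
  nlinarith

/-- If the terms of a sequence are not contained in an affine plane, then translation by the
difference of two of its terms moves many elements of `Y` outside `Y`. -/
lemma exists_sq_le_mul_escape_pow {f : ι → Fin 3 → ZMod p} {R : Finset ι} (hR0 : R.Nonempty)
    (hR : ∀ u : Fin 3 → ZMod p, u ≠ 0 → ∀ c, ∃ i ∈ R, u ⬝ᵥ f i ≠ c)
    {Y : Finset (Fin 3 → ZMod p)} (hY : 2 * Y.card ≤ p ^ 3) (hY0 : Y.Nonempty) :
    ∃ x ∈ R, ∃ y ∈ R, Y.card ^ 2 ≤ 432 * escape Y (f x - f y) ^ 3 := by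
  obtain ⟨i₀, hi₀⟩ := hR0
  obtain ⟨x, hx, hli⟩ := exists_linearIndependent_sub i₀ hR
  have hex : ∃ m, 2 * Y.card ≤ m ^ 3 := ⟨p, hY⟩
  have hm := Nat.find_spec hex
  have hmp : Nat.find hex ≤ p := Nat.find_min' hex hY
  have hmin : ∀ m' < Nat.find hex, m' ^ 3 < 2 * Y.card := fun m' h ↦ not_le.1 (Nat.find_min hex h)
  generalize Nat.find hex = m at hm hmp hmin
  have hYpos := hY0.card_pos
  obtain _ | m := m
  · rw [zero_pow three_ne_zero] at hm
    omega
  obtain ⟨n, hn, hle⟩ := exists_card_le_two_mul_escape hli hmp hm hY0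
  obtain ⟨k, -, hk⟩ := Finset.exists_max_image Finset.univ (fun k ↦ escape Y (f (x k) - f i₀))
    ⟨0, Finset.mem_univ _⟩
  refine ⟨x k, hx k, i₀, hi₀, ?_⟩
  set g := escape Y (f (x k) - f i₀)
  have h1 : escape Y (∑ k, n k • (f (x k) - f i₀)) ≤ ∑ k : Fin 3, m * g := by
    refine (Finset.le_sum_of_subadditive _ (escape_zero Y).le (escape_add_le Y) _ _).trans
      (Finset.sum_le_sum fun l hl ↦ (escape_nsmul_le _ _ _).trans ?_)
    exact Nat.mul_le_mul (Nat.lt_succ_iff.1 (hn l)) (hk l hl)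
  simp only [Finset.sum_const, Finset.card_univ, Fintype.card_fin, smul_eq_mul] at h1
  have h2 : Y.card ≤ 6 * (m * g) := by omega
  have h3 := hmin m (Nat.lt_succ_self m)
  have h4 := Nat.pow_le_pow_left h2 3
  have h5 := Nat.mul_le_mul_right (216 * g ^ 3) h3.le
  refine Nat.le_of_mul_le_mul_left ?_ hYpos
  nlinarith

end Boxes

/-! ### Growth of the set of sums -/

section Growth

variable {p : ℕ} {ι : Type*}

/-- There is a subset `U` of `R` of size at most `2 * k` such that at least `y` elements, or more
than half of all elements, are sums of `k` terms of the sequence `f` with indices in `U`. -/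
def HasManySums (f : ι → Fin 3 → ZMod p) (R : Finset ι) (k : ℕ) (y : ℝ) : Prop :=
  ∃ U ⊆ R, U.card ≤ 2 * k ∧ ∃ Y : Finset (Fin 3 → ZMod p), Y.Nonempty ∧
    (∀ v ∈ Y, ∃ T ⊆ U, T.card = k ∧ ∑ i ∈ T, f i = v) ∧ (p ^ 3 < 2 * Y.card ∨ y ≤ Y.card)

variable {f : ι → Fin 3 → ZMod p} {R : Finset ι} {k : ℕ} {y : ℝ}

lemma hasManySums_zero (f : ι → Fin 3 → ZMod p) (R : Finset ι) : HasManySums f R 0 1 :=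
  ⟨∅, Finset.empty_subset _, by simp, {0}, by simp, by simp, by simp⟩

lemma HasManySums.mono {y' : ℝ} (h : HasManySums f R k y) (hy : y' ≤ y) : HasManySums f R k y' := by
  obtain ⟨U, hU, hUk, Y, hY, hYU, hlarge⟩ := h
  exact ⟨U, hU, hUk, Y, hY, hYU, hlarge.imp_right hy.trans⟩

variable [DecidableEq ι]

/-- Even after the removal of fewer than `p` terms, `R` is nonempty and only a proportion `1/5000`
of it lies in a given affine plane. -/
def IsSpread (f : ι → Fin 3 → ZMod p) (R : Finset ι) : Prop :=
  ∀ U : Finset ι, U.card < p → (R \ U).Nonempty ∧ ∀ u : Fin 3 → ZMod p, u ≠ 0 → ∀ c,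
    5000 * {i ∈ R \ U | u ⬝ᵥ f i = c}.card ≤ (R \ U).card

lemma HasManySums.succ {y' : ℝ} (h : HasManySums f R k y) (hR : IsSpread f R) (hk : 2 * k < p)
    (hstep : ∀ U : Finset ι, U.card < p → ∀ Y : Finset (Fin 3 → ZMod p), Y.Nonempty →
      2 * Y.card ≤ p ^ 3 → y ≤ Y.card →
      ∃ i ∈ R \ U, ∃ j ∈ R \ U, y' ≤ Y.card + escape Y (f i - f j)) :
    HasManySums f R (k + 1) y' := by
  obtain ⟨U, hU, hUk, Y, hY, hYU, hlarge⟩ := h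
  obtain ⟨i, hi, j, hj, hij⟩ : ∃ i ∈ R \ U, ∃ j ∈ R \ U,
      p ^ 3 < 2 * (Y.card + escape Y (f i - f j)) ∨ y' ≤ Y.card + escape Y (f i - f j) := by
    by_cases hp : p ^ 3 < 2 * Y.card
    · obtain ⟨i, hi⟩ := (hR U (by omega)).1
      exact ⟨i, hi, i, hi, Or.inl (by omega)⟩
    · obtain ⟨i, hi, j, hj, hij⟩ :=
        hstep U (by omega) Y hY (not_lt.1 hp) (hlarge.resolve_left hp)
      exact ⟨i, hi, j, hj, Or.inr hij⟩
  rw [Finset.mem_sdiff] at hi hj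
  refine ⟨insert i (insert j U), ?_, ?_, Y.image (· + f i) ∪ Y.image (· + f j), ?_, ?_, ?_⟩
  · exact Finset.insert_subset hi.1 (Finset.insert_subset hj.1 hU)
  · have h1 := Finset.card_insert_le i (insert j U)
    have h2 := Finset.card_insert_le j U
    omega
  · exact (hY.image _).mono Finset.subset_union_left
  · intro v hv
    obtain ⟨l, hl, hlU, w, hw, rfl⟩ : ∃ l ∉ U, l ∈ insert i (insert j U) ∧
        ∃ w ∈ Y, w + f l = v := by
      rw [Finset.mem_union, Finset.mem_image, Finset.mem_image] at hv
      obtain hv | hv := hv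
      · exact ⟨i, hi.2, by simp, hv⟩
      · exact ⟨j, hj.2, by simp, hv⟩
    obtain ⟨T, hT, hTk, rfl⟩ := hYU w hw
    have hlT : l ∉ T := fun h ↦ hl (hT h)
    refine ⟨insert l T, Finset.insert_subset hlU (hT.trans ?_), ?_, ?_⟩
    · exact (Finset.subset_insert _ _).trans (Finset.subset_insert _ _)
    · rw [Finset.card_insert_of_notMem hlT, hTk]
    · rw [Finset.sum_insert hlT, add_comm]
  · rw [card_image_add_union_image_add]
    exact_mod_cast hij

lemma HasManySums.succ_self (h : HasManySums f R k y) (hR : IsSpread f R) (hk : 2 * k < p) :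
    HasManySums f R (k + 1) y := by
  refine h.succ hR hk fun U hU Y _ _ hy ↦ ?_
  obtain ⟨i, hi⟩ := (hR U hU).1
  exact ⟨i, hi, i, hi, hy.trans (by simp)⟩

lemma HasManySums.of_le {l : ℕ} (h : HasManySums f R k y) (hR : IsSpread f R) (hkl : k ≤ l)
    (hl : 2 * l < p) : HasManySums f R l y := by
  induction l, hkl using Nat.le_induction with
  | base => exact h
  | succ l _ ih => exact (ih (by omega)).succ_self hR (by omega)

variable [Fact p.Prime]

lemma HasManySums.succ_add {g : ℝ} (h : HasManySums f R k y) (hR : IsSpread f R) (hk : 2 * k < p)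
    (hy : 0 ≤ y) (hg : 432 * g ^ 3 ≤ y ^ 2) : HasManySums f R (k + 1) (y + g) := by
  refine h.succ hR hk fun U hU Y hY hYp hyY ↦ ?_
  obtain ⟨hne, hplane⟩ := hR U hU
  obtain ⟨i, hi, j, hj, hij⟩ := exists_sq_le_mul_escape_pow (f := f) hne (fun u hu c ↦ by
    by_contra! hcon
    have h1 := hplane u hu c
    rw [Finset.filter_true_of_mem hcon] at h1
    have := hne.card_pos
    omega) hYp hY
  refine ⟨i, hi, j, hj, add_le_add hyY ?_⟩
  have h1 : (Y.card : ℝ) ^ 2 ≤ 432 * (escape Y (f i - f j) : ℝ) ^ 3 := by exact_mod_cast hij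
  have h2 : y ^ 2 ≤ (Y.card : ℝ) ^ 2 := by gcongr
  by_contra! hlt
  have h3 : (escape Y (f i - f j) : ℝ) ^ 3 < g ^ 3 := by gcongr
  linarith

lemma HasManySums.succ_mul (h : HasManySums f R k y) (hR : IsSpread f R) (hk : 2 * k < p) :
    HasManySums f R (k + 1) (y * (1 + 180 / p)) := by
  have hp : (0 : ℝ) < p := by exact_mod_cast (Fact.out : p.Prime).pos
  refine h.succ hR hk fun U hU Y hY hYp hyY ↦ ?_
  obtain ⟨i, hi, j, hj, hij⟩ := exists_le_mul_escape (hR U hU).1 (hR U hU).2 hYp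
  refine ⟨i, hi, j, hj, ?_⟩
  have h1 : (180 : ℝ) * Y.card ≤ p * escape Y (f i - f j) := by exact_mod_cast hij
  have h2 : (180 : ℝ) * Y.card / p ≤ escape Y (f i - f j) := by rwa [div_le_iff₀' hp]
  have h3 : y * (1 + 180 / p) ≤ Y.card * (1 + 180 / p) := by gcongr
  calc y * (1 + 180 / p) ≤ Y.card + 180 * Y.card / p := h3.trans (le_of_eq (by ring))
    _ ≤ _ := by gcongr

lemma hasManySums_cube (hR : IsSpread f R) (hk : 2 * k < p) :
    HasManySums f R k ((k + 32) ^ 3 / 32768) := by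
  induction k with
  | zero => exact (hasManySums_zero f R).mono (by norm_num)
  | succ k ih =>
    have hk0 : (0 : ℝ) ≤ k := k.cast_nonneg
    refine ((ih (by omega)).succ_add (g := 4 * (k + 32) ^ 2 / 32768) hR (by omega) (by positivity)
      ?_).mono ?_
    · have : 0 ≤ ((k : ℝ) + 32) ^ 6 := by positivity
      ring_nf at this ⊢
      linarith
    · push_cast
      nlinarith

lemma HasManySums.add_mul_pow (h : HasManySums f R k y) (hR : IsSpread f R) (j : ℕ)
    (hk : 2 * (k + j) < p) : HasManySums f R (k + j) (y * (1 + 180 / p) ^ j) := by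
  induction j with
  | zero => simpa using h
  | succ j ih =>
    rw [pow_succ, ← mul_assoc]
    exact (ih (by omega)).succ_mul hR (by omega)

lemma HasManySums.two_mul (h : HasManySums f R k y) (hR : IsSpread f R) (hy : 0 ≤ y) {q : ℕ}
    (hq : p ≤ 180 * q) (hk : 2 * (k + q) < p) : HasManySums f R (k + q) (2 * y) := by
  have hp : (0 : ℝ) < p := by exact_mod_cast (Fact.out : p.Prime).pos
  refine (h.add_mul_pow hR q hk).mono ?_
  rw [mul_comm]
  refine mul_le_mul_of_nonneg_left ?_ hy
  have h1 := one_add_mul_le_pow (a := (180 / p : ℝ)) (by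
    have : (0 : ℝ) ≤ 180 / p := by positivity
    linarith) q
  have h2 : (1 : ℝ) ≤ q * (180 / p) := by
    rw [mul_div_assoc', le_div_iff₀ hp, one_mul, mul_comm]
    exact_mod_cast hq
  linarith

lemma HasManySums.two_pow_mul (h : HasManySums f R k y) (hR : IsSpread f R) (hy : 0 ≤ y) {q : ℕ}
    (hq : p ≤ 180 * q) (s : ℕ) (hk : 2 * (k + s * q) < p) :
    HasManySums f R (k + s * q) (2 ^ s * y) := by
  induction s with
  | zero => simpa using h
  | succ s ih =>
    rw [add_mul, one_mul, ← add_assoc] at hk ⊢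
    rw [pow_succ', mul_assoc]
    exact (ih (by omega)).two_mul hR (by positivity) hq hk

lemma exists_large_sums (hR : IsSpread f R) (hp : 200 ≤ p) {a : ℕ} (ha : 2 * a + 1 = p) :
    ∃ U ⊆ R, U.card ≤ 2 * a ∧ ∃ Y : Finset (Fin 3 → ZMod p), p ^ 3 < 2 * Y.card ∧
      ∀ v ∈ Y, ∃ T ⊆ U, T.card = a ∧ ∑ i ∈ T, f i = v := by
  have h1 : HasManySums f R ((p + 3) / 4) ((p : ℝ) ^ 3 / 2 ^ 21) := by
    refine (hasManySums_cube hR (by omega)).mono ?_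
    have h2 : (p : ℝ) / 4 ≤ ((p + 3) / 4 : ℕ) := by
      rw [div_le_iff₀ (by norm_num)]
      exact_mod_cast (by omega : p ≤ (p + 3) / 4 * 4)
    calc (p : ℝ) ^ 3 / 2 ^ 21 = ((p : ℝ) / 4) ^ 3 / 32768 := by ring
      _ ≤ _ := by gcongr; linarith
  obtain ⟨U, hU, hUa, Y, -, hYU, hY⟩ := (h1.two_pow_mul hR (by positivity)
    (q := (p + 179) / 180) (by omega) 21 (by omega)).of_le hR (l := a) (by omega) (by omega)
  refine ⟨U, hU, hUa, Y, hY.elim id fun h ↦ ?_, hYU⟩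
  rw [mul_div_cancel₀ _ (by positivity)] at h
  have h2 : p ^ 3 ≤ Y.card := by exact_mod_cast h
  have h3 : 0 < p ^ 3 := by positivity
  omega

end Growth

/-! ### Zero-sum subsequences of length `p` in rank three -/

section RankThree

variable {p : ℕ} [Fact p.Prime] {ι : Type*}

lemma exists_card_eq_sum_eq_zero_of_hyperplane [Fintype ι] (hp2 : p ≠ 2)
    (f : ι → Fin 3 → ZMod p) {I : Finset ι} {u : Fin 3 → ZMod p} (hu : u ≠ 0) {c : ZMod p}
    (hI : 4 * (p - 1) + 1 < {i ∈ I | u ⬝ᵥ f i = c}.card) :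
    ∃ J ⊆ I, J.card = p ∧ ∑ i ∈ J, f i = 0 := by
  obtain ⟨l, hl⟩ := Function.ne_iff.1 hu
  obtain ⟨J, hJ, hJp, hJ0⟩ :=
    exists_card_eq_sum_eq_zero hp2 (fun i (k : Fin 2) ↦ f i (l.succAbove k)) hI
  refine ⟨J, hJ.trans (Finset.filter_subset _ _), hJp, ?_⟩
  have h1 (k : Fin 2) : (∑ i ∈ J, f i) (l.succAbove k) = 0 := by
    simpa using congrFun hJ0 k
  have h2 : u ⬝ᵥ ∑ i ∈ J, f i = 0 := by
    rw [dotProduct_sum, Finset.sum_congr rfl fun i hi ↦ (Finset.mem_filter.1 (hJ hi)).2,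
      Finset.sum_const, hJp, nsmul_eq_mul, CharP.cast_eq_zero, zero_mul]
  have h3 : (∑ i ∈ J, f i) l = 0 := by
    rw [dotProduct, Fin.sum_univ_succAbove _ l] at h2
    simp only [h1, mul_zero, Finset.sum_const_zero, add_zero] at h2
    exact (mul_eq_zero.1 h2).resolve_left hl
  funext k
  obtain rfl | ⟨k, rfl⟩ := l.eq_self_or_eq_succAbove k
  · exact h3
  · exact h1 k

lemma exists_card_eq_sum_eq_zero_of_isSpread [DecidableEq ι] {f : ι → Fin 3 → ZMod p} {I : Finset ι}
    (hp2 : p ≠ 2) (hp : 200 ≤ p) {i₀ : ι} (hi₀ : i₀ ∈ I)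
    (hI : ∀ U : Finset ι, U.card < p → IsSpread f ((I.erase i₀) \ U)) :
    ∃ J ⊆ I, J.card = p ∧ ∑ i ∈ J, f i = 0 := by
  obtain ⟨a, ha⟩ := (Fact.out : p.Prime).odd_of_ne_two hp2
  obtain ⟨U, hU, hUa, Y, hY, hYU⟩ := exists_large_sums (hI ∅ (by simp; omega)) hp ha.symm
  obtain ⟨W, hW, hWa, Z, hZ, hZW⟩ := exists_large_sums (hI U (by omega)) hp ha.symm
  have hinj : Function.Injective fun z ↦ -f i₀ - z := sub_right_injective
  have hnd : ¬Disjoint Y (Z.image fun z ↦ -f i₀ - z) := by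
    intro hd
    have h1 := Finset.card_le_univ (Y ∪ Z.image fun z ↦ -f i₀ - z)
    rw [Finset.card_union_of_disjoint hd, Finset.card_image_of_injective _ hinj] at h1
    simp only [Fintype.card_pi, ZMod.card, Finset.prod_const, Finset.card_univ,
      Fintype.card_fin] at h1
    omega
  obtain ⟨y, hy, hyz⟩ := Finset.not_disjoint_iff.1 hnd
  obtain ⟨z, hz, rfl⟩ := Finset.mem_image.1 hyz
  obtain ⟨S, hS, hSa, hSy⟩ := hYU _ hy
  obtain ⟨T, hT, hTa, rfl⟩ := hZW z hz
  rw [Finset.sdiff_empty] at hU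
  have hSI := hS.trans hU
  have hTI := hT.trans hW
  have hST : Disjoint S T :=
    Finset.disjoint_left.2 fun i hi hi' ↦ (Finset.mem_sdiff.1 (hTI hi')).2 (hS hi)
  have h0 : i₀ ∉ S ∪ T := by
    rw [Finset.mem_union]
    rintro (h | h)
    · exact Finset.notMem_erase _ _ (hSI h)
    · exact Finset.notMem_erase _ _ (Finset.mem_sdiff.1 (hTI h)).1
  refine ⟨insert i₀ (S ∪ T), ?_, ?_, ?_⟩
  · refine Finset.insert_subset hi₀ (Finset.union_subset ?_ ?_)
    · exact hSI.trans (Finset.erase_subset _ _)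
    · exact hTI.trans (Finset.sdiff_subset.trans (Finset.erase_subset _ _))
  · rw [Finset.card_insert_of_notMem h0, Finset.card_union_of_disjoint hST, hSa, hTa]
    omega
  · rw [Finset.sum_insert h0, Finset.sum_union hST, hSy]
    abel

theorem exists_card_eq_prime_sum_eq_zero [Fintype ι] [DecidableEq ι] (f : ι → Fin 3 → ZMod p)
    {I : Finset ι} (hI : 20369 * (p - 1) + 1 ≤ I.card) : ∃ J ⊆ I, J.card = p ∧ ∑ i ∈ J, f i = 0 := by
  have hp1 := (Fact.out : p.Prime).one_lt
  by_cases hp2 : p = 2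
  · subst hp2
    obtain ⟨i, hi, j, hj, hij, hf⟩ := Finset.exists_ne_map_eq_of_card_lt_of_maps_to
      (s := I) (t := Finset.univ) (f := f) (by
        rw [Finset.card_univ]
        simp only [Fintype.card_pi, ZMod.card, Finset.prod_const, Finset.card_univ,
          Fintype.card_fin]
        omega) (fun _ _ ↦ Finset.mem_coe.2 (Finset.mem_univ _))
    refine ⟨{i, j}, by simp [Finset.insert_subset_iff, hi, hj], Finset.card_pair hij, ?_⟩
    rw [Finset.sum_pair hij, hf]
    funext k
    exact CharTwo.add_self_eq_zero _
  by_cases hplane : ∃ u : Fin 3 → ZMod p, u ≠ 0 ∧ ∃ c,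
      4 * (p - 1) + 1 < {i ∈ I | u ⬝ᵥ f i = c}.card
  · obtain ⟨u, hu, c, hc⟩ := hplane
    exact exists_card_eq_sum_eq_zero_of_hyperplane hp2 f hu hc
  push Not at hplane
  obtain ⟨i₀, hi₀⟩ : I.Nonempty := Finset.card_pos.1 (by omega)
  have hp : 200 ≤ p := by
    have h1 := Finset.card_eq_sum_card_fiberwise (f := fun i ↦ Pi.single 0 1 ⬝ᵥ f i) (s := I)
      (t := Finset.univ) (fun _ _ ↦ Finset.mem_coe.2 (Finset.mem_univ _))
    have h2 := Finset.sum_le_card_nsmul Finset.univ _ _ fun c _ ↦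
      hplane (Pi.single 0 1) (by simp) c
    rw [← h1, Finset.card_univ, ZMod.card, smul_eq_mul] at h2
    obtain ⟨q, rfl⟩ : ∃ q, p = q + 1 := ⟨p - 1, by omega⟩
    simp only [Nat.add_sub_cancel] at *
    by_contra!
    nlinarith
  refine exists_card_eq_sum_eq_zero_of_isSpread hp2 hp hi₀ fun U hU W hW ↦ ?_
  have hcard : 5000 * (4 * (p - 1) + 1) < ((I.erase i₀ \ U) \ W).card := by
    have h1 := Finset.card_erase_of_mem hi₀
    have h2 := Finset.le_card_sdiff U (I.erase i₀)
    have h3 := Finset.le_card_sdiff W (I.erase i₀ \ U)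
    omega
  refine ⟨Finset.card_pos.1 (by omega), fun u hu c ↦ le_trans ?_ hcard.le⟩
  refine Nat.mul_le_mul_left _ ((Finset.card_le_card (Finset.filter_subset_filter _ ?_)).trans
    (hplane u hu c))
  exact Finset.sdiff_subset.trans (Finset.sdiff_subset.trans (Finset.erase_subset _ _))

end RankThree

/-! ### Zero-sum constants of cyclic groups and their powers -/

section Cyclic

lemma hasZeroSum_of_forall_fin {G : Type*} [AddCommGroup G] {A : Set ℕ} {N : ℕ}
    (h : ∀ n, N ≤ n → ∀ f : Fin n → G,
      ∃ J : Finset (Fin n), J.Nonempty ∧ J.card ∈ A ∧ ∑ i ∈ J, f i = 0) :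
    HasZeroSum G A N := by
  intro S hS
  obtain ⟨J, hJ, hJA, hJ0⟩ := h S.toList.length (by simpa using hS) S.toList.get
  refine ⟨J.val.map S.toList.get, ?_, ?_, hJ0, by simpa using hJA⟩
  · calc J.val.map S.toList.get ≤ Finset.univ.val.map S.toList.get :=
          Multiset.map_le_map (Finset.val_le_iff.2 (Finset.subset_univ J))
      _ = S := by rw [Fin.univ_val_map, List.ofFn_get, Multiset.coe_toList]
  · simpa [← Finset.nonempty_iff_ne_empty] using hJ

lemma HasZeroSum.Iic {G : Type*} [AddCommGroup G] {N : ℕ} (h : HasZeroSum G Set.univ N) :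
    HasZeroSum G (Set.Iic N) N := by
  intro S hS
  obtain ⟨S', hS', hcard⟩ : ∃ S' ≤ S, S'.card = N := by
    obtain ⟨S', h'⟩ := Multiset.card_pos_iff_exists_mem.1
      (by rw [Multiset.card_powersetCard]; exact Nat.choose_pos hS :
        0 < (Multiset.powersetCard N S).card)
    exact ⟨S', Multiset.mem_powersetCard.1 h'⟩
  obtain ⟨T, hT, h0, hs, -⟩ := h S' hcard.ge
  exact ⟨T, hT.trans hS', h0, hs, (Multiset.card_le_card hT).trans hcard.le⟩

lemma hasZeroSum_of_subsingleton {G : Type*} [AddCommGroup G] [Subsingleton G] :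
    HasZeroSum G {1} 1 := by
  intro S hS
  obtain ⟨g, hg⟩ := Multiset.card_pos_iff_exists_mem.1 hS
  exact ⟨{g}, Multiset.singleton_le.2 hg, by simp, Subsingleton.elim _ _, by simp⟩

variable {n : ℕ}

lemma hasZeroSum_zmod (hn : n ≠ 0) : HasZeroSum (ZMod n) (Set.Iic n) n := by
  induction n using induction_on_primes with
  | zero => exact absurd rfl hn
  | one => exact hasZeroSum_of_subsingleton.mono (by simp) le_rfl
  | prime_mul p a hp ih =>
    have := Fact.mk hp
    have hprime : HasZeroSum (ZMod p) Set.univ p := by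
      refine HasZeroSum.of_injective (H := Fin 1 → ZMod p) (hasZeroSum_of_forall_fin ?_)
        (Pi.constAddMonoidHom (Fin 1) (ZMod p)) (fun x y h ↦ congrFun h 0)
      intro n hn f
      obtain ⟨J, -, hJ, h⟩ := exists_nonempty_sum_eq_zero f (s := Finset.univ) (by
        have := hp.pos
        rw [Finset.card_univ, Fintype.card_fin]
        omega)
      exact ⟨J, hJ, Set.mem_univ _, h⟩
    refine (HasZeroSum.extension_Iic (isExtension_zmod p a) hprime.Iic
      (ih (by rintro rfl; simp at hn))).mono subset_rfl (by omega)

/-- The embedding of pairs into functions on `Fin 2`. -/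
def pairHom (A : Type*) [AddCommGroup A] : A × A →+ (Fin 2 → A) where
  toFun x := ![x.1, x.2]
  map_zero' := by simp
  map_add' x y := by simp

/-- The embedding of triples into functions on `Fin 3`. -/
def tripleHom (A : Type*) [AddCommGroup A] : A × A × A →+ (Fin 3 → A) where
  toFun x := ![x.1, x.2.1, x.2.2]
  map_zero' := by ext i; fin_cases i <;> rfl
  map_add' x y := by ext i; fin_cases i <;> rfl

lemma pairHom_injective (A : Type*) [AddCommGroup A] : Function.Injective (pairHom A) :=
  fun _ _ h ↦ Prod.ext (congrFun h 0) (congrFun h 1)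

lemma tripleHom_injective (A : Type*) [AddCommGroup A] : Function.Injective (tripleHom A) :=
  fun _ _ h ↦ Prod.ext (congrFun h 0) (Prod.ext (congrFun h 1) (congrFun h 2))

lemma hasZeroSum_Iic_zmod_prime_sq {p : ℕ} (hp : p.Prime) :
    HasZeroSum (ZMod p × ZMod p) (Set.Iic p) (3 * p - 2) := by
  have := Fact.mk hp
  refine HasZeroSum.of_injective (hasZeroSum_of_forall_fin fun n hn f ↦ ?_) (pairHom _)
    (pairHom_injective _)
  obtain ⟨J, -, hJ, hJp, h⟩ := exists_card_le_sum_eq_zero f (s := Finset.univ) (by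
    have := hp.pos
    rw [Finset.card_univ, Fintype.card_fin]
    omega)
  exact ⟨J, hJ, hJp, h⟩

lemma hasZeroSum_univ_zmod_prime_sq {p : ℕ} (hp : p.Prime) :
    HasZeroSum (ZMod p × ZMod p) Set.univ (2 * p - 1) := by
  have := Fact.mk hp
  refine HasZeroSum.of_injective (hasZeroSum_of_forall_fin fun n hn f ↦ ?_) (pairHom _)
    (pairHom_injective _)
  obtain ⟨J, -, hJ, h⟩ := exists_nonempty_sum_eq_zero f (s := Finset.univ) (by
    have := hp.pos
    rw [Finset.card_univ, Fintype.card_fin]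
    omega)
  exact ⟨J, hJ, Set.mem_univ _, h⟩

lemma hasZeroSum_singleton_zmod_prime_cube {p : ℕ} (hp : p.Prime) :
    HasZeroSum (ZMod p × ZMod p × ZMod p) {p} (20369 * (p - 1) + 1) := by
  have := Fact.mk hp
  refine HasZeroSum.of_injective (hasZeroSum_of_forall_fin fun n hn f ↦ ?_) (tripleHom _)
    (tripleHom_injective _)
  obtain ⟨J, -, hJp, h⟩ := exists_card_eq_prime_sum_eq_zero f (I := Finset.univ) (by
    rwa [Finset.card_univ, Fintype.card_fin])
  exact ⟨J, Finset.card_pos.1 (hJp ▸ hp.pos), hJp, h⟩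

lemma hasZeroSum_Iic_zmod_sq (hn : n ≠ 0) :
    HasZeroSum (ZMod n × ZMod n) (Set.Iic n) (3 * n - 2) := by
  induction n using induction_on_primes with
  | zero => exact absurd rfl hn
  | one => exact hasZeroSum_of_subsingleton.mono (by simp) le_rfl
  | prime_mul p a hp ih =>
    have ha : a ≠ 0 := by rintro rfl; simp at hn
    refine (HasZeroSum.extension_Iic ((isExtension_zmod p a).prod (isExtension_zmod p a))
      (hasZeroSum_Iic_zmod_prime_sq hp) (ih ha)).mono subset_rfl ?_
    obtain ⟨a, rfl⟩ := Nat.exists_eq_succ_of_ne_zero ha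
    obtain ⟨p, rfl⟩ := Nat.exists_eq_succ_of_ne_zero hp.ne_zero
    rw [show 3 * (a + 1) - 2 = 3 * a + 1 by omega, show 3 * (p + 1) - 2 = 3 * p + 1 by omega]
    simp only [Nat.succ_eq_add_one]
    ring_nf
    omega

lemma hasZeroSum_univ_zmod_sq (hn : n ≠ 0) :
    HasZeroSum (ZMod n × ZMod n) Set.univ (2 * n - 1) := by
  induction n using induction_on_primes with
  | zero => exact absurd rfl hn
  | one => exact hasZeroSum_of_subsingleton.mono (by simp) le_rfl
  | prime_mul p a hp ih =>
    have ha : a ≠ 0 := by rintro rfl; simp at hn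
    refine (HasZeroSum.extension_univ ((isExtension_zmod p a).prod (isExtension_zmod p a))
      (fun _ h ↦ h) ((hasZeroSum_Iic_zmod_prime_sq hp).mono subset_rfl (by omega))
      (hasZeroSum_univ_zmod_prime_sq hp) (ih ha)).mono subset_rfl ?_
    obtain ⟨a, rfl⟩ := Nat.exists_eq_succ_of_ne_zero ha
    obtain ⟨p, rfl⟩ := Nat.exists_eq_succ_of_ne_zero hp.ne_zero
    rw [show 2 * (a + 1) - 1 = 2 * a + 1 by omega, show 2 * (p + 1) - 1 = 2 * p + 1 by omega]
    simp only [Nat.succ_eq_add_one]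
    ring_nf
    omega

lemma hasZeroSum_singleton_zmod_cube (hn : n ≠ 0) :
    HasZeroSum (ZMod n × ZMod n × ZMod n) {n} (20369 * (n - 1) + 1) := by
  induction n using induction_on_primes with
  | zero => exact absurd rfl hn
  | one => exact hasZeroSum_of_subsingleton.mono subset_rfl le_rfl
  | prime_mul p a hp ih =>
    have ha : a ≠ 0 := by rintro rfl; simp at hn
    have hE := isExtension_zmod p a
    refine (HasZeroSum.extension_singleton (hE.prod (hE.prod hE))
      (hasZeroSum_singleton_zmod_prime_cube hp) (ih ha)).mono subset_rfl ?_
    obtain ⟨a, rfl⟩ := Nat.exists_eq_succ_of_ne_zero ha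
    obtain ⟨p, rfl⟩ := Nat.exists_eq_succ_of_ne_zero hp.ne_zero
    rw [show a.succ - 1 = a from rfl, show p.succ - 1 = p from rfl]
    simp only [Nat.succ_eq_add_one]
    ring_nf
    omega

lemma isExtension_zmod_one (n : ℕ) : IsExtension (ZMod 1) (ZMod n) (ZMod n) := by
  have h := isExtension_zmod n 1
  rwa [mul_one] at h

/-- The upper bound for the Davenport constant of a group of rank two. -/
lemma hasZeroSum_univ_zmod_prod {a c : ℕ} (ha : a ≠ 0) (hc : c ≠ 0) :
    HasZeroSum (ZMod a × ZMod (a * c)) Set.univ (a + a * c - 1) := by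
  refine (HasZeroSum.extension_univ ((isExtension_zmod_one a).prod (isExtension_zmod a c))
    (fun _ h ↦ h) ((hasZeroSum_Iic_zmod_sq ha).mono subset_rfl (by omega))
    (hasZeroSum_univ_zmod_sq ha) (k := c) ?_).mono subset_rfl (by omega)
  exact ((hasZeroSum_zmod hc).mono (Set.subset_univ _) le_rfl).of_injective
    (AddMonoidHom.snd (ZMod 1) (ZMod c)) (fun x y h ↦ Prod.ext (Subsingleton.elim _ _) h)

lemma hasZeroSum_univ_zmod_prod_prod {n a c : ℕ} (hn : n ≠ 0) (ha : a ≠ 0) (hc : c ≠ 0) :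
    HasZeroSum (ZMod n × ZMod (n * a) × ZMod (n * (a * c))) Set.univ
      (20367 * (n - 1) + (n * a - 1) + (n * (a * c) - 1) + 1) := by
  have hcube := hasZeroSum_singleton_zmod_cube hn
  refine (HasZeroSum.extension_univ ((isExtension_zmod_one n).prod
    ((isExtension_zmod n a).prod (isExtension_zmod n (a * c))))
    (fun _ h ↦ le_of_eq h) (hcube.mono subset_rfl (by omega))
    (hcube.mono (Set.subset_univ _) le_rfl) (k := a + a * c - 1) ?_).mono subset_rfl ?_
  · exact (hasZeroSum_univ_zmod_prod ha hc).of_injective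
      (AddMonoidHom.snd (ZMod 1) (ZMod a × ZMod (a * c)))
      (fun x y h ↦ Prod.ext (Subsingleton.elim _ _) h)
  · have h1 : n ≤ n * a := Nat.le_mul_of_pos_right n (Nat.pos_of_ne_zero ha)
    have h2 : n ≤ n * (a * c) := Nat.le_mul_of_pos_right n (by positivity)
    rw [Nat.mul_sub, mul_add, mul_one]
    omega

lemma not_hasZeroSum_of_exists_forall_nsmul_ne {G : Type*} [AddCommGroup G] {g : G}
    (hg : ∀ m : ℕ, m ≠ 0 → m • g ≠ 0) (A : Set ℕ) (N : ℕ) : ¬HasZeroSum G A N := by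
  intro h
  obtain ⟨T, hT, h0, hs, -⟩ := h (Multiset.replicate N g) (by simp)
  obtain ⟨m, -, rfl⟩ := Multiset.le_replicate_iff.1 hT
  rw [Multiset.sum_replicate] at hs
  exact hg m (by rintro rfl; simp at h0) hs

end Cyclic

end ZeroSum

lemma davenport_eq_sInf (G : Type*) [AddCommGroup G] :
    Davenport G = sInf {t | ZeroSum.HasZeroSum G Set.univ t} := by
  simp [Davenport, ZeroSum.HasZeroSum]

theorem stmt_14 (n₁ n₂ n₃ : ℕ) (h₁ : 1 < n₁) (h₁₂ : n₁ ∣ n₂) (h₂₃ : n₂ ∣ n₃) :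
    Davenport (ZMod n₁ × ZMod n₂ × ZMod n₃) ≤
      20367 * (n₁ - 1) + (n₂ - 1) + (n₃ - 1) + 1 := by
  rw [davenport_eq_sInf]
  by_cases hn₃ : n₃ = 0
  · subst hn₃
    have hempty : {t | ZeroSum.HasZeroSum (ZMod n₁ × ZMod n₂ × ZMod 0) Set.univ t} = ∅ :=
      Set.eq_empty_of_forall_notMem fun t ↦ ZeroSum.not_hasZeroSum_of_exists_forall_nsmul_ne
        (g := (0, 0, (1 : ℤ))) (fun m hm h ↦ hm (by
          have h' : m • (1 : ℤ) = 0 := congrArg (fun x ↦ x.2.2) h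
          simpa using h')) _ t
    rw [hempty, Nat.sInf_empty]
    exact Nat.zero_le _
  · obtain ⟨a, rfl⟩ := h₁₂
    obtain ⟨c, rfl⟩ := h₂₃
    rw [mul_assoc] at hn₃ ⊢
    refine Nat.sInf_le (ZeroSum.hasZeroSum_univ_zmod_prod_prod (by omega) ?_ ?_)
    · rintro rfl
      simp at hn₃
    · rintro rfl
      simp at hn₃
end
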